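/- Let I ⊂ ℝ be a finite interval and N ∈ ℤ_{≥0}. There is a constant C depending only on I and N such that for every s = σ + it with σ ∈ I and t ≥ 2π, setting α := √(t/(2π)) and a := α − ⌊α⌋, one has |ζ(s) − Σ_{n ≤ α} n^{−s} − χ(s)·Σ_{n ≤ α} n^{−(1−s)} − (−1)^{⌊α⌋}·(2π)^s e^{πis/2}/(Γ(s)(e^{2πis} − 1)) · exp((s/2 − 1/4)·log(t/(2π)) − it/2 − iπ/8) · (2π/t)^{1/4} · Σ_{k=0}^{N−1} a_k(s) · Σ_{r=0}^{⌊k/2⌋} (i^{r−k}·k!/(r!(k−2r)!)) · Ψ^{(k−2r)}(2a)/(4^r (2π)^{k/2−r})| ≤ C·t^{−N/6 − σ/2}, where the sums over n run over positive integers n ≤ α. -/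

import Mathlib

open Complex Real MeasureTheory

noncomputable section

def chi (s : ℂ) : ℂ := (π : ℂ) ^ (s - 1/2) * Complex.Gamma ((1 - s)/2) / Complex.Gamma (s/2)

def RSOmega : Set ℂ := {s : ℂ | s.im ≠ 0 ∨ (0 < s.re ∧ s.re < 1)}

def IsRSTheta (ϑ : ℂ → ℂ) : Prop :=
  DifferentiableOn ℂ ϑ RSOmega ∧ (∀ s ∈ RSOmega, Complex.exp (-2 * I * ϑ s) = chi s) ∧
    ϑ (1/2) = 0

def zetaSum (x : ℝ) (s : ℂ) : ℂ := ∑ n ∈ Finset.Icc 1 ⌊x⌋₊, (n : ℂ) ^ (-s)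

def Upsilon (u τ : ℂ) : ℂ :=
  ∫ v : ℝ, Complex.exp (3 * (π:ℂ) * I / 4) *
    (Complex.exp (-(π:ℂ) * I * τ * (1/2 + Complex.exp (3 * (π:ℂ) * I / 4) * v) ^ 2
        + 2 * (π:ℂ) * I * u * (1/2 + Complex.exp (3 * (π:ℂ) * I / 4) * v)) /
      (Complex.exp (2 * (π:ℂ) * I * (1/2 + Complex.exp (3 * (π:ℂ) * I / 4) * v)) - 1))

def G (u τ : ℂ) : ℂ :=
  τ ^ ((1:ℂ)/4) * Complex.exp (-(π:ℂ) * I * u ^ 2 / 2 + (π:ℂ) * I / 8) *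
    Upsilon (τ ^ ((1:ℂ)/2) * u) τ

def Gderiv (k : ℕ) (u τ : ℂ) : ℂ := iteratedDeriv k (fun w => G w τ) u

def hermiteH (n : ℕ) (x : ℂ) : ℂ :=
  (Nat.factorial n : ℂ) * ∑ j ∈ Finset.range (n / 2 + 1),
    (-1:ℂ) ^ j / ((Nat.factorial j : ℂ) * (Nat.factorial (n - 2*j) : ℂ)) * (2 * x) ^ (n - 2*j)

def obell (p : ℕ → ℂ) (i j : ℕ) : ℂ :=
  ∑ f ∈ (Finset.Nat.antidiagonalTuple j i).filter (fun f => ∀ l, 1 ≤ f l), ∏ l, p (f l)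

def bernoulliPoly (n : ℕ) (x : ℂ) : ℂ := Polynomial.aeval x (Polynomial.bernoulli n)

def fseq (σ : ℝ) (n : ℕ) : ℂ :=
  (bernoulliPoly (n+1) ((σ:ℂ)/2) + (-1:ℂ)^(n+1) * bernoulliPoly (n+1) ((1-(σ:ℂ))/2)) /
    (2*(n:ℂ)*((n:ℂ)+1))

def um (m : ℕ) (σ : ℝ) : ℂ :=
  (-2:ℂ)^m * ∑ k ∈ Finset.range (m+1), obell (fseq σ) m k / (Nat.factorial k : ℂ)

def seqA (j : ℕ) : ℂ := (-1:ℂ)^(j+1) / ((j:ℂ) + 2)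

def seqB (j : ℕ) : ℂ := (-1:ℂ)^(j+1) / (j:ℂ)

def dd (m r : ℕ) (σ : ℝ) : ℂ :=
  ∑ n ∈ Finset.Icc r m, (obell seqA n r / (Nat.factorial r : ℂ)) *
    ∑ k ∈ Finset.range (m - n + 1),
      (obell seqB (m - n) k / (Nat.factorial k : ℂ)) * ((σ:ℂ) - 1)^k

def qq (n ℓ : ℕ) (σ : ℝ) : ℂ :=
  ∑ m ∈ Finset.Icc (ℓ - n) (ℓ / 3), um m σ * dd (n - 2*m) (n + m - ℓ) σ

def PP (n k : ℕ) (x : ℂ) (σ : ℝ) : ℂ :=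
  Complex.exp (3 * (π:ℂ) * I * (k:ℂ) / 4) * ∑ ℓ ∈ Finset.range (k/2 + 1),
    (Nat.choose (3*n - 2*ℓ) (3*n - k) : ℂ) * (-1:ℂ)^(n + ℓ) * 2^(2*ℓ) / 2^k *
      qq n ℓ σ * hermiteH (k - 2*ℓ) (Complex.exp (-(π:ℂ) * I / 4) * x)

def IsAk (s : ℂ) (a : ℕ → ℂ) : Prop :=
  a 0 = 1 ∧ ∀ k : ℕ, ((k:ℂ) + 1) * (Real.sqrt s.im : ℂ) * a (k+1) =
    -((k:ℂ) + 1 - (s.re:ℂ)) * a k + I * (if 2 ≤ k then a (k-2) else 0)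

def IsPsi (Ψ : ℂ → ℂ) : Prop :=
  Differentiable ℂ Ψ ∧ ∀ u : ℂ, Complex.cos ((π:ℂ)*u) ≠ 0 →
    Ψ u = Complex.cos ((π:ℂ)*(u^2/2 - u - 1/8)) / Complex.cos ((π:ℂ)*u)

def wfun (s z : ℂ) : ℂ :=
  Complex.exp ((s - 1) * Complex.log (1 + z / (Real.sqrt s.im : ℂ))
    - I * (Real.sqrt s.im : ℂ) * z + I * z^2 / 2)

def rn (n : ℕ) (s z : ℂ) : ℂ :=
  wfun s z - ∑ k ∈ Finset.range n, (iteratedDeriv k (wfun s) 0 / (Nat.factorial k : ℂ)) * z^k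

def GammaOmega : Set ℂ := {s : ℂ | s.im ≠ 0 ∨ 0 < s.re}

def IsLogGamma (L : ℂ → ℂ) : Prop :=
  DifferentiableOn ℂ L GammaOmega ∧ (∀ s ∈ GammaOmega, Complex.exp (L s) = Complex.Gamma s) ∧
    L 1 = 0

def gseq (σ : ℝ) (n : ℕ) : ℂ := -(bernoulliPoly (n+1) (σ:ℂ)) / ((n:ℂ)*((n:ℂ)+1))

def gammam (m : ℕ) (σ : ℝ) : ℂ :=
  I^m * ∑ k ∈ Finset.range (m+1), obell (gseq σ) m k / (Nat.factorial k : ℂ)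

lemma g_half (s : ℂ) (hs : s.re = 1/2) : ‖Complex.Gamma s‖ * Real.exp (π * s.im / 2) ≤ Real.sqrt (2*π) := by
  have h1 := Complex.Gamma_mul_Gamma_one_sub s
  have hc : 1 - s = (starRingEnd ℂ) s := by
    apply Complex.ext <;> simp [hs]; norm_num
  rw [hc, Complex.Gamma_conj] at h1
  have hsin : Complex.sin (π * s) = (Real.cosh (π * s.im) : ℂ) := by
    have : (π:ℂ) * s = (π * s.im : ℝ) * I + π / 2 := by
      apply Complex.ext <;> simp [hs]; ring
    rw [this, Complex.sin_add_pi_div_two, Complex.cos_mul_I]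
    simp
  rw [hsin] at h1
  have h2 : ‖Complex.Gamma s‖ ^ 2 = π / Real.cosh (π * s.im) := by
    have := congrArg norm h1
    rw [norm_mul, RCLike.norm_conj, norm_div, Complex.norm_real, Complex.norm_real] at this
    rw [sq, this, Real.norm_of_nonneg Real.pi_pos.le, Real.norm_of_nonneg (Real.cosh_pos _).le]
  apply Real.le_sqrt_of_sq_le
  rw [mul_pow, h2, ← Real.exp_nat_mul, Real.cosh_eq]
  have e1 := Real.exp_pos (π * s.im)
  have e2 := Real.exp_pos (-(π * s.im))
  have : ((2:ℕ):ℝ) * (π * s.im / 2) = π * s.im := by push_cast; ring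
  rw [this, div_mul_eq_mul_div, div_le_iff₀ (by positivity)]
  have : 0 < π * Real.exp (-(π * s.im)) := by positivity
  nlinarith [Real.pi_pos]

lemma g_strip (s : ℂ) (h1 : 1/2 ≤ s.re) (h2 : s.re ≤ 3/2) (ht : 1 ≤ s.im) :
    ‖Complex.Gamma s‖ ≤ 4 * Real.sqrt (2*π) * s.im ^ (s.re - 1/2) * Real.exp (-(π * s.im / 2)) := by
  set T := s.im with hT
  have hT0 : 0 < T := by linarith
  let G : ℂ → ℂ := fun z => Complex.Gamma z * Complex.exp (-(I * π * z / 2)) * (T:ℂ) ^ (3/2 - z) / (z + T)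
  have nG : ∀ z : ℂ, ‖G z‖ = ‖Complex.Gamma z‖ * Real.exp (π * z.im / 2) * T ^ (3/2 - z.re) / ‖z + T‖ := by
    intro z
    simp only [G, norm_div, norm_mul, Complex.norm_exp]
    rw [Complex.norm_cpow_eq_rpow_re_of_pos hT0]
    congr 3
    · congr 1
      simp
      ring
    · simp
  have hre : ∀ z : ℂ, z.re + T ≤ ‖z + T‖ := by
    intro z
    have := Complex.re_le_norm (z + T)
    simpa using this
  have key : ‖G s‖ ≤ Real.sqrt (2*π) := by
    apply PhragmenLindelof.vertical_strip (a := 1/2) (b := 3/2) (f := G) (z := s)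
    · apply DifferentiableOn.diffContOnCl
      intro z hz
      have hz' : 1/2 ≤ z.re := by
        have := closure_minimal (s := re ⁻¹' Set.Ioo (1/2) (3/2)) (t := {z : ℂ | 1/2 ≤ z.re})
          (fun w hw => hw.1.le) (isClosed_le continuous_const Complex.continuous_re)
        exact this hz
      apply DifferentiableAt.differentiableWithinAt
      have hg : DifferentiableAt ℂ Complex.Gamma z := by
        apply Complex.differentiableAt_Gamma
        intro m hm
        have := congrArg Complex.re hm
        simp at this
        have : (0:ℝ) ≤ m := Nat.cast_nonneg m
        linarith
      have hne : z + (T:ℂ) ≠ 0 := by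
        intro h
        have := congrArg Complex.re h
        simp at this
        linarith
      have hTne : (T:ℂ) ≠ 0 := by exact_mod_cast hT0.ne'
      refine DifferentiableAt.div ?_ (by fun_prop) hne
      refine DifferentiableAt.mul (DifferentiableAt.mul hg (by fun_prop)) ?_
      exact DifferentiableAt.const_cpow (by fun_prop) (Or.inl hTne)
    · refine ⟨1, by norm_num; linarith [Real.pi_gt_three], 2, ?_⟩
      obtain ⟨K, hK⟩ : ∃ K, ∀ x ∈ Set.Icc (1/2:ℝ) (3/2), ‖Real.Gamma x‖ ≤ K := by
        apply IsCompact.exists_bound_of_continuousOn isCompact_Icc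
        intro x hx
        apply ContinuousAt.continuousWithinAt
        apply DifferentiableAt.continuousAt (𝕜 := ℝ)
        apply Real.differentiableAt_Gamma
        intro m hm
        have : (0:ℝ) ≤ m := Nat.cast_nonneg m
        linarith [hx.1]
      apply Asymptotics.IsBigO.of_bound (K * T)
      apply Filter.eventually_inf_principal.2
      apply Filter.Eventually.of_forall
      intro z hz
      have hz1 : 1/2 < z.re := hz.1
      have hz2 : z.re < 3/2 := hz.2
      rw [nG, Real.norm_of_nonneg (Real.exp_pos _).le]
      have hK0 : 0 ≤ K := (norm_nonneg _).trans (hK 1 (by constructor <;> norm_num))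
      have a1 : ‖Complex.Gamma z‖ ≤ K := by
        refine le_trans ?_ ((le_abs_self _).trans (hK z.re ⟨hz1.le, hz2.le⟩))
        rw [Complex.Gamma_eq_integral (by linarith), Real.Gamma_eq_integral (by linarith)]
        unfold Complex.GammaIntegral
        refine (norm_integral_le_integral_norm _).trans (le_of_eq ?_)
        apply setIntegral_congr_fun measurableSet_Ioi
        intro x hx
        have hx' : (0:ℝ) < x := hx
        simp only [norm_mul]
        rw [Complex.norm_cpow_eq_rpow_re_of_pos hx']
        simp [Complex.norm_exp]
      have a2 : T ^ (3/2 - z.re) ≤ T := by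
        calc T ^ (3/2 - z.re) ≤ T ^ (1:ℝ) := Real.rpow_le_rpow_of_exponent_le ht (by linarith)
          _ = T := Real.rpow_one T
      have a3 : 1 ≤ ‖z + T‖ := by linarith [hre z]
      have a4 : Real.exp (π * z.im / 2) ≤ Real.exp (2 * Real.exp (1 * |z.im|)) := by
        apply Real.exp_le_exp.2
        have := Real.add_one_le_exp (1 * |z.im|)
        have h3 := le_abs_self z.im
        have h4 := abs_nonneg z.im
        nlinarith [Real.pi_lt_four, Real.pi_pos]
      calc ‖Complex.Gamma z‖ * Real.exp (π * z.im / 2) * T ^ (3/2 - z.re) / ‖z + T‖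
          ≤ ‖Complex.Gamma z‖ * Real.exp (π * z.im / 2) * T ^ (3/2 - z.re) := by
            apply div_le_self (by positivity) a3
        _ ≤ K * Real.exp (2 * Real.exp (1 * |z.im|)) * T := by gcongr
        _ = _ := by ring
    · intro z hz
      rw [nG, hz]
      have := g_half z hz
      have h5 := hre z
      rw [div_le_iff₀ (by linarith)]
      have : T ^ ((3/2:ℝ) - 1/2) = T := by norm_num
      rw [this]
      have := g_half z hz
      gcongr
      linarith
    · intro z hz
      rw [nG, hz]
      have hz1 : z - 1 ≠ 0 := by
        intro h
        have := congrArg Complex.re h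
        simp [hz] at this; norm_num at this
      have h6 : Complex.Gamma z = (z - 1) * Complex.Gamma (z - 1) := by
        have := Complex.Gamma_add_one (z-1) hz1
        simpa using this
      have h7 := g_half (z-1) (by simp [hz]; norm_num)
      simp only [Complex.sub_im, Complex.one_im, sub_zero] at h7
      have h5 := hre z
      rw [div_le_iff₀ (by linarith), h6, norm_mul]
      simp only [sub_self, Real.rpow_zero, mul_one]
      have h8 : ‖z - 1‖ ≤ ‖z + T‖ := by
        have q1 := Complex.sq_norm_sub_sq_re (z - 1)
        have q2 := Complex.sq_norm_sub_sq_re (z + T)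
        simp [hz] at q1 q2
        apply le_of_sq_le_sq ?_ (norm_nonneg _)
        nlinarith
      calc ‖z - 1‖ * ‖Complex.Gamma (z-1)‖ * Real.exp (π * z.im/2)
          = (‖Complex.Gamma (z-1)‖ * Real.exp (π * z.im/2)) * ‖z - 1‖ := by ring
        _ ≤ _ := by gcongr
    · exact h1
    · exact h2
  rw [nG, div_le_iff₀ (by linarith [hre s])] at key
  have h9 : ‖s + T‖ ≤ 4 * T := by
    have := Complex.norm_le_abs_re_add_abs_im (s + T)
    simp at this
    rw [← hT, abs_of_pos hT0, abs_of_pos (by linarith)] at this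
    linarith
  have h10 : T ^ (s.re - 1/2) = T * (T ^ (3/2 - s.re))⁻¹ := by
    rw [← Real.rpow_neg hT0.le]
    nth_rewrite 2 [← Real.rpow_one T]
    rw [← Real.rpow_add hT0]; congr 1; ring
  rw [h10, Real.exp_neg]
  have p1 : 0 < T ^ (3/2 - s.re) := by positivity
  have p2 := Real.exp_pos (π * T / 2)
  rw [← div_eq_mul_inv, ← div_eq_mul_inv, ← mul_div_assoc, le_div_iff₀ p2, le_div_iff₀ p1]
  refine key.trans ?_
  have : 0 ≤ Real.sqrt (2*π) := Real.sqrt_nonneg _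
  nlinarith

lemma g_wide (n : ℕ) : ∃ C : ℝ, 0 ≤ C ∧ ∀ s : ℂ, 1/2 - (n:ℝ) ≤ s.re → s.re ≤ 3/2 + n → 1 ≤ s.im →
    ‖Complex.Gamma s‖ ≤ C * s.im ^ (s.re - 1/2) * Real.exp (-(π * s.im / 2)) := by
  induction n with
  | zero =>
    refine ⟨4 * Real.sqrt (2*π), by positivity, fun s h1 h2 h3 => g_strip s (by simpa using h1) (by simpa using h2) h3⟩
  | succ n ih =>
    obtain ⟨C, hC, h⟩ := ih
    refine ⟨C * (n + 4), by positivity, fun s h1 h2 h3 => ?_⟩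
    push_cast at h1 h2
    have hn : (0:ℝ) ≤ n := Nat.cast_nonneg n
    have ht : 0 < s.im := by linarith
    have E := Real.exp_pos (-(π * s.im / 2))
    by_cases c1 : s.re < 1/2 - n
    · have hs0 : s ≠ 0 := by intro h; rw [h] at h3; simp at h3; linarith
      have h4 := h (s+1) (by simp; linarith) (by simp; linarith) (by simpa using h3)
      rw [Complex.Gamma_add_one s hs0, norm_mul] at h4
      simp only [Complex.add_im, Complex.one_im, add_zero, Complex.add_re, Complex.one_re] at h4
      have h5 : s.im ≤ ‖s‖ := Complex.im_le_norm s
      have h6 : s.im ^ (s.re + 1 - 1/2) = s.im ^ (s.re - 1/2) * s.im := by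
        rw [← Real.rpow_add_one ht.ne']; congr 1; ring
      rw [h6] at h4
      have h7 : s.im * ‖Complex.Gamma s‖ ≤ s.im * (C * s.im ^ (s.re - 1/2) * Real.exp (-(π * s.im / 2))) := by
        calc _ ≤ ‖s‖ * ‖Complex.Gamma s‖ := by gcongr
          _ ≤ _ := h4
          _ = _ := by ring
      have h8 := le_of_mul_le_mul_left h7 ht
      refine h8.trans ?_
      gcongr
      nlinarith
    · by_cases c2 : 3/2 + n < s.re
      · have hs0 : s - 1 ≠ 0 := by
          intro h; have := congrArg Complex.im h; simp at this; linarith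
        have h4 := h (s-1) (by simp; linarith) (by simp; linarith) (by simpa using h3)
        simp only [Complex.sub_im, Complex.one_im, sub_zero, Complex.sub_re, Complex.one_re] at h4
        have h5 : Complex.Gamma s = (s - 1) * Complex.Gamma (s - 1) := by
          have := Complex.Gamma_add_one (s-1) hs0
          simpa using this
        have h6 : s.im ^ (s.re - 1/2) = s.im ^ (s.re - 1 - 1/2) * s.im := by
          rw [← Real.rpow_add_one ht.ne']; congr 1; ring
        have h7 : ‖s - 1‖ ≤ (n + 4) * s.im := by
          have := Complex.norm_le_abs_re_add_abs_im (s - 1)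
          simp at this
          rw [abs_of_pos ht, abs_of_pos (by linarith)] at this
          nlinarith
        rw [h5, norm_mul, h6]
        calc ‖s - 1‖ * ‖Complex.Gamma (s-1)‖ ≤ ((n + 4) * s.im) * (C * s.im ^ (s.re - 1 - 1/2) * Real.exp (-(π * s.im / 2))) := by
              gcongr
          _ = _ := by ring
      · refine (h s (not_lt.1 c1) (not_lt.1 c2) h3).trans ?_
        gcongr
        nlinarith

lemma gamma_inv_bound (A B : ℝ) : ∃ C : ℝ, 0 ≤ C ∧ ∀ s : ℂ, A ≤ s.re → s.re ≤ B → 1 ≤ s.im →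
    ‖(Complex.Gamma s)⁻¹‖ ≤ C * s.im ^ (1/2 - s.re) * Real.exp (π * s.im / 2) := by
  obtain ⟨n, hn⟩ := exists_nat_ge (|A| + |B| + 1)
  obtain ⟨C, hC, h⟩ := g_wide n
  refine ⟨C, hC, fun s h1 h2 h3 => ?_⟩
  have ht : 0 < s.im := by linarith
  have hA := neg_abs_le A
  have hB := le_abs_self B
  have hA' := abs_nonneg A
  have hB' := abs_nonneg B
  have h4 := h ((starRingEnd ℂ) (1 - s)) (by simp; linarith) (by simp; linarith) (by simpa using h3)
  rw [Complex.Gamma_conj, RCLike.norm_conj] at h4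
  simp only [Complex.conj_im, Complex.sub_im, Complex.one_im, zero_sub, neg_neg, Complex.conj_re, Complex.sub_re, Complex.one_re] at h4
  have hG0 : Complex.Gamma s ≠ 0 := by
    apply Complex.Gamma_ne_zero
    intro m hm
    have := congrArg Complex.im hm
    simp at this; linarith
  have hsin0 : Complex.sin (π * s) ≠ 0 := by
    rw [Complex.sin_ne_zero_iff]
    intro k hk
    have := congrArg Complex.im hk
    simp at this
    linarith
  have h5 : (Complex.Gamma s)⁻¹ = Complex.Gamma (1 - s) * Complex.sin (π * s) / π := by
    have := Complex.Gamma_mul_Gamma_one_sub s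
    have hp : (π:ℂ) ≠ 0 := by exact_mod_cast Real.pi_ne_zero
    rw [eq_div_iff hp, inv_mul_eq_iff_eq_mul₀ hG0, ← mul_assoc, this, div_mul_cancel₀ _ hsin0]
  have h6 : ‖Complex.sin (π * s)‖ ≤ Real.exp (π * s.im) := by
    rw [Complex.sin, norm_div, norm_mul, Complex.norm_I, mul_one]
    have : ‖Complex.exp (-(↑π * s) * I) - Complex.exp (↑π * s * I)‖ ≤ Real.exp (π * s.im) + Real.exp (π * s.im) := by
      refine (norm_sub_le _ _).trans ?_
      rw [Complex.norm_exp, Complex.norm_exp]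
      gcongr
      · simp
      · simp
        have : 0 < π * s.im := by positivity
        linarith
    simp only [Complex.norm_ofNat]
    linarith
  rw [h5, norm_div, norm_mul, Complex.norm_real, Real.norm_of_nonneg Real.pi_pos.le]
  have h7 : Real.exp (π * s.im/2) = Real.exp (-(π * s.im/2)) * Real.exp (π * s.im) := by
    rw [← Real.exp_add]; congr 1; ring
  have h8 : s.im ^ (1 - s.re - 1/2) = s.im ^ (1/2 - s.re) := by congr 1; ring
  rw [h8] at h4
  calc _ ≤ ‖Complex.Gamma (1 - s)‖ * ‖Complex.sin (π * s)‖ := by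
        apply div_le_self (by positivity)
        linarith [Real.pi_gt_three]
    _ ≤ (C * s.im ^ (1/2 - s.re) * Real.exp (-(π * s.im/2))) * Real.exp (π * s.im) := by gcongr
    _ = _ := by rw [h7]; ring

def preF (s : ℂ) : ℂ := ((2*π : ℝ):ℂ)^s * Complex.exp ((π:ℂ)*I*s) /
                (Complex.Gamma s * (Complex.exp (2*(π:ℂ)*I*s) - 1))

lemma preF_bound (A B : ℝ) : ∃ C : ℝ, 0 ≤ C ∧ ∀ s : ℂ, A ≤ s.re → s.re ≤ B → 1 ≤ s.im →
    ‖preF s‖ ≤ C * s.im ^ (1/2 - s.re) * Real.exp (-(π * s.im / 2)) := by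
  obtain ⟨C, hC, h⟩ := gamma_inv_bound A B
  refine ⟨C * 2 * (2*π)^B, by positivity, fun s h1 h2 h3 => ?_⟩
  have h4 := h s h1 h2 h3
  have ht : 0 < s.im := by linarith
  have e1 : ‖((2*π : ℝ):ℂ)^s‖ ≤ (2*π)^B := by
    rw [Complex.norm_cpow_eq_rpow_re_of_pos (by positivity)]
    apply Real.rpow_le_rpow_of_exponent_le (by linarith [Real.pi_gt_three]) h2
  have e2 : ‖Complex.exp ((π:ℂ)*I*s)‖ = Real.exp (-(π * s.im)) := by
    rw [Complex.norm_exp]; simp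
  have e3 : 1/2 ≤ ‖Complex.exp (2*(π:ℂ)*I*s) - 1‖ := by
    have : ‖Complex.exp (2*(π:ℂ)*I*s)‖ ≤ 1/2 := by
      rw [Complex.norm_exp]
      simp only [mul_re, Complex.re_ofNat, Complex.ofReal_re, Complex.im_ofNat, Complex.ofReal_im, mul_zero, sub_zero, Complex.I_re, mul_im, zero_mul, add_zero, Complex.I_im, mul_one, sub_self, zero_add, zero_sub]
      rw [Real.exp_neg, inv_le_comm₀ (Real.exp_pos _) (by norm_num)]
      have := Real.add_one_le_exp (2 * π * s.im)
      nlinarith [Real.pi_gt_three]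
    have h5 := norm_sub_norm_le (1:ℂ) (Complex.exp (2*(π:ℂ)*I*s))
    rw [norm_sub_rev] at h5
    simp at h5
    linarith
  have e4 : preF s = ((2*π : ℝ):ℂ)^s * Complex.exp ((π:ℂ)*I*s) * (Complex.Gamma s)⁻¹ * (Complex.exp (2*(π:ℂ)*I*s) - 1)⁻¹ := by
    unfold preF; rw [div_eq_mul_inv, mul_inv]; ring
  rw [e4, norm_mul, norm_mul, norm_mul, e2]
  have e5 : ‖(Complex.exp (2*(π:ℂ)*I*s) - 1)⁻¹‖ ≤ 2 := by
    rw [norm_inv]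
    rw [inv_le_comm₀ (by linarith) (by norm_num)]
    linarith
  have h7 : Real.exp (-(π * s.im/2)) = Real.exp (-(π * s.im)) * Real.exp (π * s.im/2) := by
    rw [← Real.exp_add]; congr 1; ring
  calc _ ≤ (2*π)^B * Real.exp (-(π * s.im)) * (C * s.im ^ (1/2 - s.re) * Real.exp (π * s.im / 2)) * 2 := by gcongr
    _ = _ := by rw [h7]; ring

lemma ak_bound (A B : ℝ) (k : ℕ) : ∃ C : ℝ, 0 ≤ C ∧ ∀ s : ℂ, A ≤ s.re → s.re ≤ B → 1 ≤ s.im →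
    ∀ a, IsAk s a → ‖a k‖ ≤ C * s.im ^ (-(k:ℝ)/6) := by
  induction k using Nat.strong_induction_on with
  | _ k ih =>
  rcases k with _ | k
  · refine ⟨1, by norm_num, fun s _ _ _ a ha => ?_⟩
    rw [ha.1]; simp
  · obtain ⟨C1, hC1, h1⟩ := ih k (by omega)
    obtain ⟨C2, hC2, h2⟩ : ∃ C : ℝ, 0 ≤ C ∧ ∀ s : ℂ, A ≤ s.re → s.re ≤ B → 1 ≤ s.im →
        ∀ a, IsAk s a → ‖(if 2 ≤ k then a (k-2) else 0)‖ ≤ C * s.im ^ (-((k:ℝ)-2)/6) := by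
      by_cases hk : 2 ≤ k
      · obtain ⟨C, hC, h⟩ := ih (k-2) (by omega)
        refine ⟨C, hC, fun s a1 a2 a3 a ha => ?_⟩
        rw [if_pos hk]
        have := h s a1 a2 a3 a ha
        rwa [Nat.cast_sub hk] at this
      · refine ⟨0, le_rfl, fun s _ _ _ a ha => ?_⟩
        simp [hk]
    refine ⟨(k + 1 + |A| + |B|) * C1 + C2, by positivity, fun s a1 a2 a3 a ha => ?_⟩
    have ht : 0 < s.im := by linarith
    have e1 := h1 s a1 a2 a3 a ha
    have e2 := h2 s a1 a2 a3 a ha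
    have e3 := ha.2 k
    have hk0 : (0:ℝ) ≤ k := Nat.cast_nonneg k
    have hst : 0 < Real.sqrt s.im := Real.sqrt_pos.2 ht
    have e4 := congrArg norm e3
    rw [norm_mul, norm_mul] at e4
    have n1 : ‖(k:ℂ)+1‖ = k + 1 := by
      have : (k:ℂ)+1 = ((k+1:ℝ):ℂ) := by push_cast; rfl
      rw [this, Complex.norm_real, Real.norm_of_nonneg (by positivity)]
    have n2 : ‖((Real.sqrt s.im : ℝ):ℂ)‖ = Real.sqrt s.im := by
      rw [Complex.norm_real, Real.norm_of_nonneg hst.le]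
    have n3 : ‖-((k:ℂ) + 1 - (s.re:ℂ))‖ ≤ k + 1 + |A| + |B| := by
      have : -((k:ℂ) + 1 - (s.re:ℂ)) = ((-(k+1 - s.re):ℝ):ℂ) := by push_cast; rfl
      rw [this, Complex.norm_real, Real.norm_eq_abs, abs_le]
      have hA := neg_abs_le A
      have hB := le_abs_self B
      have hA' := abs_nonneg A
      have hB' := abs_nonneg B
      constructor <;> linarith
    rw [n1, n2] at e4
    have e5 : Real.sqrt s.im * ‖a (k+1)‖ ≤ ((k + 1 + |A| + |B|) * C1 + C2) * s.im ^ (-((k:ℝ)-2)/6) := by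
      calc Real.sqrt s.im * ‖a (k+1)‖ ≤ (k+1) * Real.sqrt s.im * ‖a (k+1)‖ := by
            have : 0 ≤ Real.sqrt s.im * ‖a (k+1)‖ := by positivity
            nlinarith
        _ = _ := e4
        _ ≤ ‖-((k:ℂ) + 1 - (s.re:ℂ)) * a k‖ + ‖I * (if 2 ≤ k then a (k-2) else 0)‖ := norm_add_le _ _
        _ ≤ (k + 1 + |A| + |B|) * (C1 * s.im ^ (-((k:ℝ)-2)/6)) + C2 * s.im ^ (-((k:ℝ)-2)/6) := by
            rw [norm_mul, norm_mul, Complex.norm_I, one_mul]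
            gcongr
            refine e1.trans ?_
            gcongr
            linarith
        _ = _ := by ring
    have e6 : s.im ^ (-((k:ℝ)-2)/6) = Real.sqrt s.im * s.im ^ (-((k+1:ℕ):ℝ)/6) := by
      rw [Real.sqrt_eq_rpow, ← Real.rpow_add ht]; congr 1; push_cast; ring
    rw [e6] at e5
    have e7 : Real.sqrt s.im * ‖a (k+1)‖ ≤ Real.sqrt s.im * (((k + 1 + |A| + |B|) * C1 + C2) * s.im ^ (-((k+1:ℕ):ℝ)/6)) := by
      refine e5.trans (le_of_eq ?_); ring
    exact le_of_mul_le_mul_left e7 hst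

def phs (s Z : ℂ) : ℂ := (s - 1) * Complex.log (1 + Z / (Real.sqrt s.im : ℂ))
    - I * (Real.sqrt s.im : ℂ) * Z + I * Z^2 / 2

lemma wfun_eq (s Z : ℂ) : wfun s Z = Complex.exp (phs s Z) := rfl

lemma phs_bound (A B : ℝ) (s Z : ℂ) (h1 : A ≤ s.re) (h2 : s.re ≤ B) (h3 : 1 ≤ s.im)
    (hZ : ‖Z‖ ≤ Real.sqrt s.im / 16) : ‖phs s Z‖ ≤ (|A| + |B| + 1) + ‖Z‖^2 / 40 := by
  have ht : 0 < s.im := by linarith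
  set q := Real.sqrt s.im with hq
  have hq0 : 0 < q := Real.sqrt_pos.2 ht
  have hqq : q * q = s.im := Real.mul_self_sqrt ht.le
  have hqc : (q:ℂ) ≠ 0 := by exact_mod_cast hq0.ne'
  obtain ⟨y, rfl⟩ : ∃ y, Z = q * y := ⟨Z / q, by field_simp⟩
  have hn : ‖(q:ℂ) * y‖ = q * ‖y‖ := by rw [norm_mul, Complex.norm_real, Real.norm_of_nonneg hq0.le]
  rw [hn] at hZ ⊢
  have hy : ‖y‖ ≤ 1/16 := by
    by_contra h
    push Not at h
    nlinarith
  have hs : s = (s.re:ℂ) + I * (q * q) := by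
    have : ((q*q:ℝ):ℂ) = (s.im:ℂ) := by rw [hqq]
    push_cast at this
    rw [this]; apply Complex.ext <;> simp
  have e : phs s (q*y) = ((s.re - 1 : ℝ):ℂ) * Complex.log (1 + y) + I * (q*q) * (Complex.log (1+y) - (y - y^2/2)) := by
    unfold phs
    rw [← hq, mul_div_cancel_left₀ _ hqc]
    conv_lhs => rw [hs]
    push_cast
    ring
  have b1 : ‖Complex.log (1 + y)‖ ≤ 1 := by
    have := Complex.norm_log_one_add_half_le_self (z := y) (by linarith)
    linarith
  have b2 : ‖Complex.log (1+y) - (y - y^2/2)‖ ≤ ‖y‖^3 * (16/15) / 3 := by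
    have := Complex.norm_log_sub_logTaylor_le 2 (z := y) (by linarith)
    have ey : Complex.logTaylor (2+1) y = y - y^2/2 := by
      simp [Complex.logTaylor_succ, Complex.logTaylor_zero]
      ring
    rw [ey] at this
    refine this.trans ?_
    norm_num
    have : (1 - ‖y‖)⁻¹ ≤ 16/15 := by
      rw [inv_le_comm₀ (by linarith) (by norm_num)]; linarith
    gcongr
  have b3 : ‖((s.re - 1 : ℝ):ℂ)‖ ≤ |A| + |B| + 1 := by
    rw [Complex.norm_real, Real.norm_eq_abs, abs_le]
    have hA := neg_abs_le A
    have hB := le_abs_self B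
    have hA' := abs_nonneg A
    have hB' := abs_nonneg B
    constructor <;> linarith
  have b4 : ‖I * ((q:ℂ)*q)‖ = q * q := by
    rw [norm_mul, norm_mul, Complex.norm_I, Complex.norm_real, Real.norm_of_nonneg hq0.le]; ring
  rw [e]
  calc _ ≤ (|A| + |B| + 1) * 1 + (q * q) * (‖y‖^3 * (16/15) / 3) := by
        refine (norm_add_le _ _).trans ?_
        rw [norm_mul, norm_mul, b4]
        gcongr
    _ ≤ _ := by
        have : 0 ≤ q*q*‖y‖^2 := by positivity
        have h : q*q*‖y‖^3 ≤ q*q*‖y‖^2 * (1/16) := by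
          calc q*q*‖y‖^3 = q*q*‖y‖^2*‖y‖ := by ring
            _ ≤ _ := by gcongr
        nlinarith

lemma phs_deriv (s Z : ℂ) (h3 : 1 ≤ s.im) (hZ : ‖Z‖ ≤ Real.sqrt s.im / 16) :
    HasDerivAt (phs s) (((s.re:ℂ) - 1 + I * Z^2) / ((Real.sqrt s.im : ℂ) + Z)) Z := by
  have ht : 0 < s.im := by linarith
  set q := Real.sqrt s.im with hq
  have hq0 : 0 < q := Real.sqrt_pos.2 ht
  have hqq : q * q = s.im := Real.mul_self_sqrt ht.le
  have hqc : (q:ℂ) ≠ 0 := by exact_mod_cast hq0.ne'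
  have hs : s = (s.re:ℂ) + I * (q * q) := by
    have : ((q*q:ℝ):ℂ) = (s.im:ℂ) := by rw [hqq]
    push_cast at this
    rw [this]; apply Complex.ext <;> simp
  have hne : (q:ℂ) + Z ≠ 0 := by
    intro h
    have : Z = -q := by linear_combination h
    rw [this, norm_neg, Complex.norm_real, Real.norm_of_nonneg hq0.le] at hZ
    linarith
  have hsl : 1 + Z / (q:ℂ) ∈ Complex.slitPlane := by
    left
    have : ‖Z / (q:ℂ)‖ < 1 := by
      rw [norm_div, Complex.norm_real, Real.norm_of_nonneg hq0.le, div_lt_one hq0]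
      linarith
    have h2 := (abs_le.1 (Complex.abs_re_le_norm (Z/q))).1
    simp only [Complex.add_re, Complex.one_re]
    linarith
  have d1 : HasDerivAt (fun Z : ℂ => 1 + Z / (q:ℂ)) (1 / q) Z := ((hasDerivAt_id Z).div_const _).const_add 1
  have d2 := ((d1.clog hsl).const_mul (s-1)).sub ((hasDerivAt_id Z).const_mul (I * q))
  have d3 := d2.add (((hasDerivAt_id Z).pow 2).const_mul I |>.div_const 2)
  refine d3.congr_deriv ?_
  have : (1 + Z / (q:ℂ)) ≠ 0 := Complex.slitPlane_ne_zero hsl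
  rw [show (1:ℂ) + Z / q = (q + Z)/q by field_simp]
  have hqZ : Z + (q:ℂ) ≠ 0 := by rwa [add_comm]
  have : s - 1 = (s.re:ℂ) - 1 + I * (q * q) := by
    conv_lhs => rw [hs]
    ring
  rw [this]
  simp
  field_simp
  ring

lemma E_id (s Z : ℂ) (a : ℕ → ℂ) (ha : IsAk s a) (N : ℕ) :
    ((Real.sqrt s.im : ℂ) + Z) * (∑ k ∈ Finset.range N, a k * ((k:ℂ) * Z^(k-1)))
      - ((s.re:ℂ) - 1 + I * Z^2) * (∑ k ∈ Finset.range N, a k * Z^k)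
    = -(Real.sqrt s.im : ℂ) * N * a N * Z^(N-1) - I * (if 2 ≤ N then a (N-2) else 0) * Z^N
      - I * (if 1 ≤ N then a (N-1) else 0) * Z^(N+1) := by
  induction N with
  | zero => simp
  | succ N ih =>
    rw [Finset.sum_range_succ, Finset.sum_range_succ]
    have h := ha.2 N
    have hc : (if 2 ≤ N + 1 then a (N+1-2) else 0) = (if 1 ≤ N then a (N-1) else 0) := by
      by_cases hN : 1 ≤ N
      · rw [if_pos hN, if_pos (by omega)]; congr 1
      · rw [if_neg hN, if_neg (by omega)]
    rw [hc, if_pos (by omega : 1 ≤ N+1)]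
    simp only [Nat.add_sub_cancel]
    push_cast
    have hz : (N:ℂ) * Z^(N-1) * Z = N * Z^N := by
      rcases N with _ | N
      · simp
      · simp [pow_succ, mul_assoc]
    linear_combination ih + Z^N * h + a N * hz

lemma r_bound (A B : ℝ) (N : ℕ) : ∃ C : ℝ, 0 ≤ C ∧ ∀ s : ℂ, A ≤ s.re → s.re ≤ B → 1 ≤ s.im →
    ∀ a, IsAk s a → ∀ Z : ℂ, ‖Z‖ ≤ Real.sqrt s.im / 16 →
    ‖wfun s Z - ∑ k ∈ Finset.range N, a k * Z^k‖ ≤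
      C * s.im ^ (-(N:ℝ)/6) * (1 + ‖Z‖)^(N+2) * Real.exp (‖Z‖^2/20) := by
  set K := |A| + |B| + 1 with hK
  have hK0 : 0 ≤ K := by positivity
  rcases Nat.eq_zero_or_pos N with rfl | hN
  · refine ⟨Real.exp K, by positivity, fun s h1 h2 h3 a ha Z hZ => ?_⟩
    simp only [Finset.range_zero, Finset.sum_empty, sub_zero, CharP.cast_eq_zero, neg_zero, zero_div, Real.rpow_zero, mul_one]
    rw [wfun_eq]
    refine (Complex.norm_exp_le_exp_norm _).trans ?_
    have := phs_bound A B s Z h1 h2 h3 hZ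
    calc Real.exp ‖phs s Z‖ ≤ Real.exp (K + ‖Z‖^2/20) := by
          apply Real.exp_le_exp.2
          have : 0 ≤ ‖Z‖^2 := by positivity
          linarith
      _ = Real.exp K * 1 * Real.exp (‖Z‖^2/20) := by rw [Real.exp_add]; ring
      _ ≤ _ := by
          gcongr
          apply one_le_pow₀
          linarith [norm_nonneg Z]
  obtain ⟨C1, hC1, b1⟩ := ak_bound A B N
  obtain ⟨C3, hC3, b3⟩ := ak_bound A B (N-1)
  obtain ⟨C2, hC2, b2⟩ : ∃ C : ℝ, 0 ≤ C ∧ ∀ s : ℂ, A ≤ s.re → s.re ≤ B → 1 ≤ s.im →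
        ∀ a, IsAk s a → ‖(if 2 ≤ N then a (N-2) else 0)‖ ≤ C * s.im ^ (-((N:ℝ)-2)/6) := by
      by_cases hk : 2 ≤ N
      · obtain ⟨C, hC, h⟩ := ak_bound A B (N-2)
        refine ⟨C, hC, fun s a1 a2 a3 a ha => ?_⟩
        rw [if_pos hk]
        have := h s a1 a2 a3 a ha
        rwa [Nat.cast_sub hk] at this
      · refine ⟨0, le_rfl, fun s _ _ _ a ha => ?_⟩
        simp [hk]
  refine ⟨2 * (N * C1 + C2 + C3) * Real.exp (2*K), by positivity, fun s h1 h2 h3 a ha Z hZ => ?_⟩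
  have ht : 0 < s.im := by linarith
  set q := Real.sqrt s.im with hq
  have hq0 : 0 < q := Real.sqrt_pos.2 ht
  set P : ℂ → ℂ := fun Z => ∑ k ∈ Finset.range N, a k * Z^k with hP
  set Q : ℂ → ℂ := fun Z => P Z * Complex.exp (-phs s Z) with hQ
  have hle : ∀ z ∈ segment ℝ 0 Z, ‖z‖ ≤ ‖Z‖ := by
    intro z hz
    have : segment ℝ (0:ℂ) Z ⊆ Metric.closedBall 0 ‖Z‖ :=
      (convex_closedBall (0:ℂ) ‖Z‖).segment_subset (by simp) (by simp)
    simpa using this hz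
  have hder : ∀ z ∈ segment ℝ 0 Z, HasDerivWithinAt Q
      ((-(q : ℂ) * N * a N * z^(N-1) - I * (if 2 ≤ N then a (N-2) else 0) * z^N
      - I * (if 1 ≤ N then a (N-1) else 0) * z^(N+1)) / (q + z) * Complex.exp (-phs s z)) (segment ℝ 0 Z) z := by
    intro z hz
    have hz' : ‖z‖ ≤ q / 16 := (hle z hz).trans hZ
    have hne : (q:ℂ) + z ≠ 0 := by
      intro h
      have : z = -q := by linear_combination h
      rw [this, norm_neg, Complex.norm_real, Real.norm_of_nonneg hq0.le] at hz'
      linarith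
    have dP : HasDerivAt P (∑ k ∈ Finset.range N, a k * ((k:ℂ) * z^(k-1))) z := by
      apply HasDerivAt.fun_sum
      intro k _
      exact (hasDerivAt_pow k z).const_mul (a k)
    have dp := phs_deriv s z h3 hz'
    have := dP.mul dp.neg.cexp
    refine (this.congr_deriv ?_).hasDerivWithinAt
    rw [← E_id s z a ha N]
    rw [← hq]
    field_simp
    simp only [hP, Pi.neg_apply]
    ring
  have hbd : ∀ z ∈ segment ℝ 0 Z, ‖((-(q : ℂ) * N * a N * z^(N-1) - I * (if 2 ≤ N then a (N-2) else 0) * z^N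
      - I * (if 1 ≤ N then a (N-1) else 0) * z^(N+1)) / (q + z) * Complex.exp (-phs s z))‖ ≤
      2 * (N * C1 + C2 + C3) * s.im ^ (-(N:ℝ)/6) * (1 + ‖Z‖)^(N+1) * Real.exp (K + ‖Z‖^2/40) := by
    intro z hz
    have hz1 := hle z hz
    have hz' : ‖z‖ ≤ q / 16 := (hle z hz).trans hZ
    have n1 : q / 2 ≤ ‖(q:ℂ) + z‖ := by
      have := norm_sub_norm_le (q:ℂ) (-z)
      rw [norm_neg, Complex.norm_real, Real.norm_of_nonneg hq0.le, sub_neg_eq_add] at this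
      linarith
    have n2 : ‖Complex.exp (-phs s z)‖ ≤ Real.exp (K + ‖Z‖^2/40) := by
      refine (Complex.norm_exp_le_exp_norm _).trans ?_
      apply Real.exp_le_exp.2
      rw [norm_neg]
      refine (phs_bound A B s z h1 h2 h3 hz').trans ?_
      gcongr
    have pw : ∀ j ≤ N + 1, ‖z‖^j ≤ (1 + ‖Z‖)^(N+1) := by
      intro j hj
      calc ‖z‖^j ≤ (1 + ‖Z‖)^j := by
            gcongr; linarith
        _ ≤ _ := by
            apply pow_le_pow_right₀ _ hj
            linarith [norm_nonneg Z]
    have m1 := b1 s h1 h2 h3 a ha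
    have m2 : ‖(if 2 ≤ N then a (N-2) else 0)‖ ≤ q * (C2 * s.im ^ (-(N:ℝ)/6)) := by
      refine (b2 s h1 h2 h3 a ha).trans ?_
      have : s.im ^ (-((N:ℝ)-2)/6) ≤ q * s.im ^ (-(N:ℝ)/6) := by
        rw [hq, Real.sqrt_eq_rpow, ← Real.rpow_add ht]
        apply Real.rpow_le_rpow_of_exponent_le h3
        linarith
      calc _ ≤ C2 * (q * s.im ^ (-(N:ℝ)/6)) := by gcongr
        _ = _ := by ring
    have m3 : ‖(if 1 ≤ N then a (N-1) else 0)‖ ≤ q * (C3 * s.im ^ (-(N:ℝ)/6)) := by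
      rw [if_pos (show 1 ≤ N from hN)]
      refine (b3 s h1 h2 h3 a ha).trans ?_
      have : s.im ^ (-((N-1:ℕ):ℝ)/6) ≤ q * s.im ^ (-(N:ℝ)/6) := by
        rw [hq, Real.sqrt_eq_rpow, ← Real.rpow_add ht]
        apply Real.rpow_le_rpow_of_exponent_le h3
        rw [Nat.cast_sub (by omega)]
        push_cast
        linarith
      calc _ ≤ C3 * (q * s.im ^ (-(N:ℝ)/6)) := by gcongr
        _ = _ := by ring
    set X := s.im ^ (-(N:ℝ)/6) with hX
    have hX0 : 0 ≤ X := by positivity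
    set W := (1 + ‖Z‖)^(N+1) with hW
    have hW0 : 0 ≤ W := by positivity
    have n3 : ‖(-(q : ℂ) * N * a N * z^(N-1) - I * (if 2 ≤ N then a (N-2) else 0) * z^N
      - I * (if 1 ≤ N then a (N-1) else 0) * z^(N+1))‖ ≤ q * ((N * C1 + C2 + C3) * X * W) := by
      refine (norm_sub_le _ _).trans ?_
      refine (add_le_add_left (norm_sub_le _ _) _).trans ?_
      simp only [norm_mul, norm_neg, Complex.norm_I, one_mul, norm_pow, Complex.norm_natCast, Complex.norm_real, Real.norm_of_nonneg hq0.le]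
      calc _ ≤ q * N * (C1 * X) * W + q * (C2 * X) * W + q * (C3 * X) * W := by
            gcongr
            · exact pw _ (by omega)
            · exact pw _ (by omega)
            · exact pw _ (by omega)
        _ = _ := by ring
    rw [norm_mul, norm_div]
    calc _ ≤ (q * ((N * C1 + C2 + C3) * X * W)) / (q/2) * Real.exp (K + ‖Z‖^2/40) := by gcongr
      _ = _ := by field_simp
  have hmv := Convex.norm_image_sub_le_of_norm_hasDerivWithin_le hder hbd (convex_segment 0 Z) (left_mem_segment ℝ 0 Z) (right_mem_segment ℝ 0 Z)
  have hQ0 : Q 0 = 1 := by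
    have hP0 : P 0 = 1 := by
      simp only [hP]
      rw [Finset.sum_eq_single 0]
      · simp [ha.1]
      · intro b _ hb; simp [hb]
      · intro h; simp at h; omega
    simp [hQ, hP0, phs]
  rw [hQ0, sub_zero] at hmv
  have hr : wfun s Z - ∑ k ∈ Finset.range N, a k * Z^k = -(wfun s Z * (Q Z - 1)) := by
    have : wfun s Z * Complex.exp (-phs s Z) = 1 := by
      rw [wfun_eq, ← Complex.exp_add]; simp
    simp only [hQ]
    change wfun s Z - P Z = _
    linear_combination (P Z) * this
  rw [hr, norm_neg, norm_mul]
  have hw : ‖wfun s Z‖ ≤ Real.exp (K + ‖Z‖^2/40) := by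
    rw [wfun_eq]
    refine (Complex.norm_exp_le_exp_norm _).trans ?_
    exact Real.exp_le_exp.2 (phs_bound A B s Z h1 h2 h3 hZ)
  have hex : Real.exp (K + ‖Z‖^2/40) * Real.exp (K + ‖Z‖^2/40) = Real.exp (2*K) * Real.exp (‖Z‖^2/20) := by
    rw [← Real.exp_add, ← Real.exp_add]; congr 1; ring
  calc _ ≤ Real.exp (K + ‖Z‖^2/40) * (2 * (N * C1 + C2 + C3) * s.im ^ (-(N:ℝ)/6) * (1 + ‖Z‖)^(N+1) * Real.exp (K + ‖Z‖^2/40) * (1 + ‖Z‖)) := by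
        gcongr
        refine hmv.trans ?_
        gcongr
        linarith
    _ = (2 * (N * C1 + C2 + C3) * s.im ^ (-(N:ℝ)/6) * (1 + ‖Z‖)^(N+2)) * (Real.exp (K + ‖Z‖^2/40) * Real.exp (K + ‖Z‖^2/40)) := by ring
    _ = _ := by rw [hex]; ring

/-- rapidly integrable amplitude -/
def ExpInt (μ : Measure ℝ) (l g : ℝ → ℂ) : Prop :=
  AEStronglyMeasurable l μ ∧ AEStronglyMeasurable g μ ∧
    ∀ D : ℝ, Integrable (fun x => rexp (D * ‖l x‖) * ‖g x‖) μ

lemma ExpInt.integrable {μ : Measure ℝ} {l g : ℝ → ℂ} (h : ExpInt μ l g) (s : ℂ) :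
    Integrable (fun x => Complex.exp (s * l x) * g x) μ := by
  refine (h.2.2 ‖s‖).mono' ((Complex.continuous_exp.comp_aestronglyMeasurable
    (h.1.const_mul s)).mul h.2.1) ?_
  filter_upwards with x
  rw [norm_mul]
  gcongr
  refine (Complex.norm_exp_le_exp_norm _).trans ?_
  rw [norm_mul]

lemma ExpInt.mul {μ : Measure ℝ} {l g : ℝ → ℂ} (h : ExpInt μ l g) :
    ExpInt μ l (fun x => l x * g x) := by
  refine ⟨h.1, h.1.mul h.2.1, fun D => ?_⟩
  refine (h.2.2 (D+1)).mono' ?_ ?_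
  · exact ((Real.continuous_exp.comp_aestronglyMeasurable (h.1.norm.const_mul D))).mul (h.1.mul h.2.1).norm
  · filter_upwards with x
    rw [norm_mul, norm_mul, norm_mul, norm_norm, norm_norm, Real.norm_of_nonneg (Real.exp_pos _).le,
      add_mul, Real.exp_add, one_mul, mul_assoc]
    gcongr
    have := Real.add_one_le_exp ‖l x‖
    linarith

lemma ExpInt.hasDerivAt {μ : Measure ℝ} {l g : ℝ → ℂ} (h : ExpInt μ l g) (s : ℂ) :
    HasDerivAt (fun s : ℂ => ∫ x, Complex.exp (s * l x) * g x ∂μ)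
      (∫ x, Complex.exp (s * l x) * (l x * g x) ∂μ) s := by
  have := hasDerivAt_integral_of_dominated_loc_of_deriv_le (μ := μ) (𝕜 := ℂ)
    (F := fun (s : ℂ) (x : ℝ) => Complex.exp (s * l x) * g x)
    (F' := fun (s : ℂ) (x : ℝ) => Complex.exp (s * l x) * (l x * g x)) (x₀ := s)
    (s := Metric.ball s 1) (bound := fun x => rexp ((‖s‖ + 1) * ‖l x‖) * ‖l x * g x‖)
    (Metric.ball_mem_nhds s one_pos) ?_ (h.integrable s) (h.mul.integrable s).1 ?_
    (h.mul.2.2 _) ?_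
  · exact this.2
  · filter_upwards with z
    exact (h.integrable z).1
  · filter_upwards with x z hz
    rw [norm_mul]
    gcongr
    refine (Complex.norm_exp_le_exp_norm _).trans ?_
    rw [norm_mul]
    gcongr
    have : ‖z - s‖ < 1 := by simpa [dist_eq_norm] using hz
    have h2 := norm_sub_norm_le z s
    linarith
  · filter_upwards with x z hz
    have h1 : HasDerivAt (fun z : ℂ => z * l x) (l x) z := by
      simpa using (hasDerivAt_id z).mul_const (l x)
    refine (h1.cexp.mul_const (g x)).congr_deriv ?_
    ring

lemma ExpInt.pow {μ : Measure ℝ} {l g : ℝ → ℂ} (h : ExpInt μ l g) (k : ℕ) :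
    ExpInt μ l (fun x => l x ^ k * g x) := by
  induction k with
  | zero => simpa using h
  | succ k ih =>
    have := ih.mul
    have e : (fun x => l x * (l x ^ k * g x)) = (fun x => l x ^ (k+1) * g x) := by
      funext x; ring
    rwa [e] at this

lemma ExpInt.iteratedDeriv {μ : Measure ℝ} {l g : ℝ → ℂ} (h : ExpInt μ l g) (k : ℕ) :
    iteratedDeriv k (fun s : ℂ => ∫ x, Complex.exp (s * l x) * g x ∂μ) =
      fun s => ∫ x, Complex.exp (s * l x) * (l x ^ k * g x) ∂μ := by
  induction k with
  | zero => simp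
  | succ k ih =>
    rw [iteratedDeriv_succ, ih]
    funext s
    rw [((h.pow k).hasDerivAt s).deriv]
    congr 1
    funext x; ring

lemma ExpInt.differentiable {μ : Measure ℝ} {l g : ℝ → ℂ} (h : ExpInt μ l g) :
    Differentiable ℂ (fun s : ℂ => ∫ x, Complex.exp (s * l x) * g x ∂μ) :=
  fun s => (h.hasDerivAt s).differentiableAt

/-- half-strip Cauchy theorem -/
lemma half_strip (f : ℂ → ℂ) (b c d : ℝ) (hcd : c ≤ d)
    (hc : ContinuousOn f {z | z.re ≤ b ∧ c ≤ z.im ∧ z.im ≤ d})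
    (hd : DifferentiableOn ℂ f {z | z.re < b ∧ c < z.im ∧ z.im < d})
    (i1 : IntegrableOn (fun x : ℝ => f (x + c * I)) (Set.Iic b))
    (i2 : IntegrableOn (fun x : ℝ => f (x + d * I)) (Set.Iic b))
    (B : ℝ → ℝ) (hB : Filter.Tendsto B Filter.atBot (nhds 0))
    (hfB : ∀ᶠ x in Filter.atBot, ∀ y, c ≤ y → y ≤ d → ‖f ((x:ℝ) + (y:ℝ) * I)‖ ≤ B x) :
    (∫ x in Set.Iic b, f ((x:ℝ) + c * I)) + I * (∫ y in c..d, f (b + (y:ℝ) * I))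
      - (∫ x in Set.Iic b, f ((x:ℝ) + d * I)) = 0 := by
  have t1 := intervalIntegral_tendsto_integral_Iic b i1 Filter.tendsto_id
  have t2 := intervalIntegral_tendsto_integral_Iic b i2 Filter.tendsto_id
  have t3 : Filter.Tendsto (fun x : ℝ => I * ∫ y in c..d, f ((x:ℝ) + (y:ℝ) * I)) Filter.atBot (nhds 0) := by
    rw [tendsto_zero_iff_norm_tendsto_zero]
    have : Filter.Tendsto (fun x => B x * |d - c|) Filter.atBot (nhds 0) := by
      simpa using hB.mul_const |d - c|
    refine squeeze_zero' (Filter.Eventually.of_forall fun x => norm_nonneg _) ?_ this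
    filter_upwards [hfB] with x hx
    rw [norm_mul, Complex.norm_I, one_mul]
    apply intervalIntegral.norm_integral_le_of_norm_le_const
    intro y hy
    rw [Set.uIoc_of_le hcd] at hy
    exact hx y hy.1.le hy.2
  have key : ∀ᶠ x : ℝ in Filter.atBot, (∫ r in x..b, f ((r:ℝ) + c * I)) + I * (∫ y in c..d, f (b + (y:ℝ) * I))
      - (∫ r in x..b, f ((r:ℝ) + d * I)) - I * ∫ y in c..d, f ((x:ℝ) + (y:ℝ) * I) = 0 := by
    filter_upwards [Filter.eventually_le_atBot b] with x hx
    have h0 := Complex.integral_boundary_rect_eq_zero_of_continuousOn_of_differentiableOn f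
      ((x:ℝ) + c * I) ((b:ℝ) + d * I) ?_ ?_
    · simp only [Complex.add_re, Complex.add_im, Complex.ofReal_re, Complex.ofReal_im, Complex.mul_re, Complex.mul_im,
        Complex.I_re, Complex.I_im, mul_zero, mul_one, sub_zero, add_zero, zero_add, zero_sub, smul_eq_mul, neg_zero] at h0
      linear_combination h0
    · refine hc.mono ?_
      intro z hz
      simp [Complex.mem_reProdIm, Set.uIcc_of_le hx, Set.uIcc_of_le hcd] at hz
      exact ⟨hz.1.2, hz.2.1, hz.2.2⟩
    · refine hd.mono ?_
      intro z hz
      simp [Complex.mem_reProdIm, min_eq_left hx, max_eq_right hx, min_eq_left hcd, max_eq_right hcd] at hz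
      exact ⟨hz.1.2, hz.2.1, hz.2.2⟩
  have t4 := ((t1.add_const (I * (∫ y in c..d, f (b + (y:ℝ) * I)))).sub t2).sub t3
  have t5 := t4.congr' key
  rw [sub_zero] at t5
  exact (tendsto_nhds_unique tendsto_const_nhds t5).symm

lemma cpow_tail (w : ℂ) : ∃ C : ℝ, 0 ≤ C ∧ ∀ z : ℂ, 1 ≤ ‖z‖ → ‖z ^ w‖ ≤ C * rexp ‖z‖ := by
  refine ⟨(Nat.factorial ⌈|w.re|⌉₊) * rexp (π * |w.im|), by positivity, fun z hz => ?_⟩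
  refine (Complex.norm_cpow_le z w).trans ?_
  have h1 : ‖z‖ ^ w.re ≤ (Nat.factorial ⌈|w.re|⌉₊) * rexp ‖z‖ := by
    calc ‖z‖ ^ w.re ≤ ‖z‖ ^ ((⌈|w.re|⌉₊ : ℕ):ℝ) :=
          Real.rpow_le_rpow_of_exponent_le hz ((le_abs_self _).trans (Nat.le_ceil _))
      _ = ‖z‖ ^ ⌈|w.re|⌉₊ := Real.rpow_natCast _ _
      _ ≤ _ := by
        have := Real.pow_div_factorial_le_exp ‖z‖ (norm_nonneg z) ⌈|w.re|⌉₊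
        rw [div_le_iff₀ (by positivity)] at this
        linarith
  have h2 : (rexp (z.arg * w.im))⁻¹ ≤ rexp (π * |w.im|) := by
    rw [← Real.exp_neg]
    apply Real.exp_le_exp.2
    calc -(z.arg * w.im) ≤ |z.arg * w.im| := neg_le_abs _
      _ = |z.arg| * |w.im| := abs_mul _ _
      _ ≤ _ := by gcongr; exact Complex.abs_arg_le_pi z
  rw [div_eq_mul_inv]
  calc _ ≤ (Nat.factorial ⌈|w.re|⌉₊) * rexp ‖z‖ * rexp (π * |w.im|) := by gcongr
    _ = _ := by ring

lemma int_Iic (f : ℝ → ℂ) (b C : ℝ) (hc : ContinuousOn f (Set.Iic b))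
    (hB : ∀ x ≤ -1, ‖f x‖ ≤ C * rexp x) : IntegrableOn f (Set.Iic b) := by
  refine (hc.locallyIntegrableOn measurableSet_Iic).integrableOn_of_isBigO_atBot (g := rexp) ?_ ?_
  · refine Asymptotics.IsBigO.of_bound C ?_
    filter_upwards [Filter.eventually_le_atBot (-1)] with x hx
    rw [Real.norm_of_nonneg (Real.exp_pos x).le]
    exact hB x hx
  · exact ⟨Set.Iic 0, Filter.Iic_mem_atBot 0, integrableOn_exp_Iic 0⟩

lemma half_strip' (f : ℂ → ℂ) (b c d C : ℝ) (hcd : c ≤ d)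
    (hc : ContinuousOn f {z | z.re ≤ b ∧ c ≤ z.im ∧ z.im ≤ d})
    (hd : DifferentiableOn ℂ f {z | z.re < b ∧ c < z.im ∧ z.im < d})
    (hB : ∀ z : ℂ, z.re ≤ -1 → c ≤ z.im → z.im ≤ d → ‖f z‖ ≤ C * rexp z.re) :
    (∫ x in Set.Iic b, f ((x:ℝ) + c * I)) + I * (∫ y in c..d, f (b + (y:ℝ) * I))
      - (∫ x in Set.Iic b, f ((x:ℝ) + d * I)) = 0 := by
  refine half_strip f b c d hcd hc hd ?_ ?_ (fun x => C * rexp x) ?_ ?_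
  · refine int_Iic _ b C ?_ ?_
    · refine hc.comp (by fun_prop) ?_
      intro x hx; simpa using ⟨hx, hcd⟩
    · intro x hx; have := hB (x + c * I) (by simpa using hx) (by simp) (by simpa using hcd)
      simpa using this
  · refine int_Iic _ b C ?_ ?_
    · refine hc.comp (by fun_prop) ?_
      intro x hx; simpa using ⟨hx, hcd⟩
    · intro x hx; have := hB (x + d * I) (by simpa using hx) (by simpa using hcd) (by simp)
      simpa using this
  · simpa using Real.tendsto_exp_atBot.const_mul C
  · filter_upwards [Filter.eventually_le_atBot (-1)] with x hx y h1 h2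
    have := hB (x + y * I) (by simpa using hx) (by simpa using h1) (by simpa using h2)
    simpa using this

def Ef (z : ℂ) : ℂ := Complex.exp (-(2 * π * z)) - 1
def gf (m : ℕ) (s z : ℂ) : ℂ := z ^ (s-1) * Complex.exp (2 * π * m * z)
def Ff (m : ℕ) (s z : ℂ) : ℂ := gf m s z / Ef z

lemma Ef_zero_iff (z : ℂ) : Ef z = 0 ↔ ∃ n : ℤ, z = n * I := by
  unfold Ef
  rw [sub_eq_zero, Complex.exp_eq_one_iff]
  have hp : (π:ℂ) ≠ 0 := by exact_mod_cast Real.pi_ne_zero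
  constructor
  · rintro ⟨n, hn⟩
    refine ⟨-n, ?_⟩
    have : (2*π:ℂ) * (z + n * I) = 0 := by linear_combination -hn
    rcases mul_eq_zero.1 this with h | h
    · simp [hp] at h
    · push_cast; linear_combination h
  · rintro ⟨n, rfl⟩
    refine ⟨-n, ?_⟩
    push_cast; ring

lemma Ef_diff : Differentiable ℂ Ef := by unfold Ef; fun_prop

lemma Ef_period (z : ℂ) : Ef (z + I) = Ef z := by
  unfold Ef
  rw [show -(2 * π * (z + I)) = -(2*π*z) - 2 * π * I by ring, Complex.exp_periodic.sub_eq]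

lemma Ef_lower (z : ℂ) (hz : z.re ≤ -1) : rexp (-(2*π*z.re)) / 2 ≤ ‖Ef z‖ := by
  unfold Ef
  have h1 := norm_sub_norm_le (Complex.exp (-(2 * π * z))) 1
  rw [Complex.norm_exp] at h1
  have e : (-(2 * (π:ℂ) * z)).re = -(2*π*z.re) := by simp
  rw [e] at h1
  have h2 : 2 ≤ rexp (-(2*π*z.re)) := by
    have := Real.add_one_le_exp (-(2*π*z.re))
    have hp := Real.pi_gt_three
    nlinarith
  rw [norm_one] at h1
  linarith

lemma Ef_inv_bound (z : ℂ) (hz : z.re ≤ -1) : ‖(Ef z)⁻¹‖ ≤ 2 * rexp (2*π*z.re) := by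
  rw [norm_inv]
  have := Ef_lower z hz
  calc _ ≤ (rexp (-(2*π*z.re)) / 2)⁻¹ := by gcongr
    _ = _ := by rw [inv_div, Real.exp_neg, div_inv_eq_mul]

lemma gf_bound (m : ℕ) (s : ℂ) (Y : ℝ) : ∃ C : ℝ, 0 ≤ C ∧ ∀ z : ℂ, z.re ≤ -1 → |z.im| ≤ Y →
    ‖gf m s z‖ ≤ C * rexp (-z.re) := by
  obtain ⟨C, hC, h⟩ := cpow_tail (s-1)
  refine ⟨C * rexp Y, by positivity, fun z hz hy => ?_⟩
  have h1 : 1 ≤ ‖z‖ := by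
    have := (abs_le.1 (Complex.abs_re_le_norm z)).1
    linarith
  have h2 : ‖z‖ ≤ -z.re + Y := by
    have := Complex.norm_le_abs_re_add_abs_im z
    rw [abs_of_neg (by linarith)] at this
    linarith
  unfold gf
  rw [norm_mul, Complex.norm_exp]
  have e : (2 * π * m * z : ℂ).re = 2*π*m*z.re := by simp
  have h3 : rexp (2*π*m*z.re) ≤ 1 := by
    rw [Real.exp_le_one_iff]
    have : (0:ℝ) ≤ 2 * π * m := by positivity
    nlinarith
  rw [e]
  calc _ ≤ (C * rexp (-z.re + Y)) * 1 := by
        gcongr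
        exact (h z h1).trans (by gcongr)
    _ = _ := by rw [Real.exp_add]; ring

lemma exp_help {x : ℝ} (hx : x ≤ -1) : rexp (-x) * (2 * rexp (2*π*x)) ≤ 2 * rexp x := by
  rw [show rexp (-x) * (2 * rexp (2*π*x)) = 2 * (rexp (-x) * rexp (2*π*x)) by ring, ← Real.exp_add]
  gcongr
  nlinarith [Real.pi_gt_three]

lemma Ff_bound (m : ℕ) (s : ℂ) (Y : ℝ) : ∃ C : ℝ, 0 ≤ C ∧ ∀ z : ℂ, z.re ≤ -1 → |z.im| ≤ Y →
    ‖Ff m s z‖ ≤ C * rexp (z.re) := by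
  obtain ⟨C, hC, h⟩ := gf_bound m s Y
  refine ⟨C * 2, by positivity, fun z hz hy => ?_⟩
  unfold Ff
  rw [div_eq_mul_inv, norm_mul]
  calc _ ≤ C * rexp (-z.re) * (2 * rexp (2*π*z.re)) := by
        gcongr
        · exact h z hz hy
        · exact Ef_inv_bound z hz
    _ = C * (rexp (-z.re) * (2 * rexp (2*π*z.re))) := by ring
    _ ≤ C * (2 * rexp z.re) := mul_le_mul_of_nonneg_left (exp_help hz) hC
    _ = _ := by ring

lemma gf_diff (m : ℕ) (s z : ℂ) (hz : z.im ≠ 0) : DifferentiableAt ℂ (gf m s) z := by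
  unfold gf
  have : z ∈ Complex.slitPlane := Or.inr hz
  exact (differentiableAt_id.cpow_const this).mul (by fun_prop)

lemma K_side (b : ℝ) (hb : 0 < b) (c : ℝ) :
    ∫ y in c..(c+1), (Ef (b + (y:ℝ) * I))⁻¹ = -1 := by
  set q : ℝ → ℂ := fun y => Complex.exp (-(2 * π * (b + (y:ℝ) * I))) with hq
  have hqn : ∀ y, ‖q y‖ < 1 := by
    intro y
    simp only [hq, Complex.norm_exp]
    rw [Real.exp_lt_one_iff]
    simp
    positivity
  have hsl : ∀ y, 1 - q y ∈ Complex.slitPlane := by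
    intro y
    left
    have := Complex.re_le_norm (q y)
    simp only [Complex.sub_re, Complex.one_re]
    linarith [hqn y]
  have hne : ∀ y, 1 - q y ≠ 0 := fun y => Complex.slitPlane_ne_zero (hsl y)
  have hp : (π:ℂ) ≠ 0 := by exact_mod_cast Real.pi_ne_zero
  have hqd : ∀ y, HasDerivAt q (-(2*π*I) * q y) y := by
    intro y
    have h1 : HasDerivAt (fun y : ℝ => -(2 * π * ((b:ℂ) + (y:ℝ) * I))) (-(2*π*I)) y := by
      have := (((Complex.ofRealCLM.hasDerivAt (x := y)).mul_const I).const_add (b:ℂ)).const_mul (2*π:ℂ) |>.fun_neg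
      simpa using this
    exact h1.cexp.congr_deriv (by simp only [hq]; ring)
  have hd : ∀ y ∈ Set.uIcc c (c+1), HasDerivAt (fun y : ℝ => -(y:ℂ) - Complex.log (1 - q y) / (2*π*I))
      ((Ef (b + (y:ℝ) * I))⁻¹) y := by
    intro y _
    have h1 := (Complex.ofRealCLM.hasDerivAt (x := y)).neg
    have h2 := (((hqd y).const_sub 1).clog_real (hsl y)).div_const (2*π*I)
    refine (h1.sub h2).congr_deriv ?_
    have e : Ef (b + (y:ℝ) * I) = -(1 - q y) := by simp only [hq, Ef]; ring
    rw [e]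
    have := hne y
    rw [inv_neg, div_div, show -(-(2 * (π:ℂ) * I) * q y) / ((1 - q y) * (2 * π * I)) = q y / (1 - q y) by
      field_simp]
    simp only [Complex.ofRealCLM_apply, Complex.ofReal_one]
    rw [eq_comm, ← sub_eq_zero]
    field_simp
    ring
  rw [intervalIntegral.integral_eq_sub_of_hasDerivAt hd]
  · have : q (c+1) = q c := by
      simp only [hq]
      rw [show -(2 * π * ((b:ℂ) + ((c+1:ℝ):ℝ) * I)) = -(2 * π * (b + (c:ℝ) * I)) - 2 * π * I by push_cast; ring,
        Complex.exp_periodic.sub_eq]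
    rw [this]; push_cast; ring
  · apply Continuous.intervalIntegrable
    refine Continuous.inv₀ (Ef_diff.continuous.comp (by fun_prop)) ?_
    intro y
    have e : Ef (b + (y:ℝ) * I) = -(1 - q y) := by simp only [hq, Ef]; ring
    rw [e]
    exact neg_ne_zero.2 (hne y)

lemma Ef_ne_of_re {z : ℂ} (h : z.re ≠ 0) : Ef z ≠ 0 := by
  intro h0
  obtain ⟨n, rfl⟩ := (Ef_zero_iff z).1 h0
  simp at h

lemma Ef_ne_of_half (x : ℝ) (n : ℤ) (c : ℝ) (hc : c = n + 1/2) : Ef (x + c * I) ≠ 0 := by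
  intro h0
  obtain ⟨k, hk⟩ := (Ef_zero_iff _).1 h0
  have := congrArg Complex.im hk
  simp at this
  rw [hc] at this
  have h2 : (2*n + 1 : ℝ) = 2 * k := by linarith
  have h3 : (2*n + 1 : ℤ) = 2 * k := by exact_mod_cast h2
  omega

lemma pole_cross (m : ℕ) (s : ℂ) (k : ℤ) (hk : k ≠ 0) (b : ℝ) (hb : 0 < b) (c d : ℝ) (hc : c = k - 1/2) (hdd : d = k + 1/2) :
    (∫ x in Set.Iic b, Ff m s ((x:ℝ) + c * I)) + I * (∫ y in c..d, Ff m s (b + (y:ℝ) * I))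
      - (∫ x in Set.Iic b, Ff m s ((x:ℝ) + d * I)) = -I * gf m s (k * I) := by
  set z0 : ℂ := k * I with hz0
  set h : ℂ → ℂ := fun z => gf m s z - gf m s z0 with hh
  set q : ℂ → ℂ := fun z => dslope h z0 z / dslope Ef z0 z with hq
  have hE0 : Ef z0 = 0 := (Ef_zero_iff _).2 ⟨k, rfl⟩
  have hh0 : h z0 = 0 := by simp [hh]
  set U : Set ℂ := {z | (k:ℝ) - 3/4 < z.im ∧ z.im < k + 3/4} with hU
  have hUo : IsOpen U := (isOpen_lt continuous_const Complex.continuous_im).inter (isOpen_lt Complex.continuous_im continuous_const)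
  have hz0U : z0 ∈ U := by simp [hU, hz0]
  have hUim : ∀ z ∈ U, z.im ≠ 0 := by
    intro z hz h0
    rw [hU, Set.mem_ofPred_eq, h0] at hz
    have h1 : (k:ℝ) < 1 := by linarith [hz.1]
    have h2 : (-1:ℝ) < k := by linarith [hz.2]
    have h1' : k < 1 := by exact_mod_cast h1
    have h2' : -1 < k := by exact_mod_cast h2
    omega
  have hE1 : ∀ z ∈ U, z ≠ z0 → Ef z ≠ 0 := by
    intro z hz hne h0
    obtain ⟨n, rfl⟩ := (Ef_zero_iff z).1 h0
    simp [hU] at hz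
    have h1 : (k:ℝ) - 1 < n := by linarith [hz.1]
    have h2 : (n:ℝ) < k + 1 := by linarith [hz.2]
    have h1' : k - 1 < n := by exact_mod_cast h1
    have h2' : n < k + 1 := by exact_mod_cast h2
    have : n = k := by omega
    exact hne (by rw [this])
  have hEd : ∀ z ∈ U, dslope Ef z0 z ≠ 0 := by
    intro z hz
    by_cases hne : z = z0
    · rw [hne, dslope_same]
      have : HasDerivAt Ef (-(2*π) * Complex.exp (-(2*π*z0))) z0 := by
        have h1 : HasDerivAt (fun z : ℂ => -(2*π*z)) (-(2*π)) z0 := by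
          simpa using ((hasDerivAt_id z0).const_mul (2*π:ℂ)).fun_neg
        exact (h1.cexp.sub_const 1).congr_deriv (by ring)
      rw [this.deriv]
      have hp : (π:ℂ) ≠ 0 := by exact_mod_cast Real.pi_ne_zero
      simp [hp]
    · rw [dslope_of_ne _ hne, slope_def_field, hE0, sub_zero]
      exact div_ne_zero (hE1 z hz hne) (sub_ne_zero.2 hne)
  have hqeq : ∀ z, z ≠ z0 → q z = h z / Ef z := by
    intro z hne
    simp only [hq]
    rw [dslope_of_ne _ hne, dslope_of_ne _ hne, slope_def_field, slope_def_field, hE0, hh0, sub_zero, sub_zero,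
      div_div_div_cancel_right₀ (sub_ne_zero.2 hne)]
  have hqd : DifferentiableOn ℂ q U := by
    refine DifferentiableOn.div ?_ ?_ hEd
    · rw [Complex.differentiableOn_dslope (hUo.mem_nhds hz0U)]
      intro z hz
      exact ((gf_diff m s z (hUim z hz)).sub_const _).differentiableWithinAt
    · rw [Complex.differentiableOn_dslope (hUo.mem_nhds hz0U)]
      exact Ef_diff.differentiableOn
  obtain ⟨C, hC, hgb⟩ := gf_bound m s (|(k:ℝ)| + 1)
  have hFE : ∀ z, z ≠ z0 → Ff m s z = q z + gf m s z0 * (Ef z)⁻¹ := by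
    intro z hne
    rw [hqeq z hne]; simp only [hh, Ff]; ring
  have hcU : ∀ x : ℝ, (x + c * I : ℂ) ∈ U := by intro x; simp [hU, hc]; constructor <;> linarith
  have hdU : ∀ x : ℝ, (x + d * I : ℂ) ∈ U := by intro x; simp [hU, hdd]; constructor <;> linarith
  have hEc : ∀ x : ℝ, Ef (x + c * I) ≠ 0 := fun x => Ef_ne_of_half x (k-1) c (by rw [hc]; push_cast; ring)
  have hEdd : ∀ x : ℝ, Ef (x + d * I) ≠ 0 := fun x => Ef_ne_of_half x k d hdd
  have hnc : ∀ x : ℝ, (x + c * I : ℂ) ≠ z0 := fun x h => hEc x (by rw [h, hE0])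
  have hnd : ∀ x : ℝ, (x + d * I : ℂ) ≠ z0 := fun x h => hEdd x (by rw [h, hE0])
  have hEb : ∀ y : ℝ, Ef (b + y * I) ≠ 0 := fun y => Ef_ne_of_re (by simpa using hb.ne')
  have hnb : ∀ y : ℝ, (b + y * I : ℂ) ≠ z0 := fun y h => hEb y (by rw [h, hE0])
  have hqB : ∀ z : ℂ, z.re ≤ -1 → c ≤ z.im → z.im ≤ d → ‖q z‖ ≤ (2 * (C + ‖gf m s z0‖)) * rexp z.re := by
    intro z h1 h2 h3
    have hne : z ≠ z0 := by
      intro h; rw [h, hz0] at h1; simp at h1; linarith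
    rw [hqeq z hne, div_eq_mul_inv, norm_mul]
    have hy : |z.im| ≤ |(k:ℝ)| + 1 := by
      have i1 := le_abs_self (k:ℝ)
      have i2 := neg_abs_le (k:ℝ)
      rw [abs_le]; constructor <;> linarith
    have h4 : ‖h z‖ ≤ (C + ‖gf m s z0‖) * rexp (-z.re) := by
      simp only [hh]
      refine (norm_sub_le _ _).trans ?_
      have : 1 ≤ rexp (-z.re) := Real.one_le_exp (by linarith)
      rw [add_mul]
      gcongr
      · exact hgb z h1 hy
      · exact le_mul_of_one_le_right (norm_nonneg _) this
    calc _ ≤ (C + ‖gf m s z0‖) * rexp (-z.re) * (2 * rexp (2*π*z.re)) := by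
          gcongr
          exact Ef_inv_bound z h1
      _ = (C + ‖gf m s z0‖) * (rexp (-z.re) * (2 * rexp (2*π*z.re))) := by ring
      _ ≤ (C + ‖gf m s z0‖) * (2 * rexp z.re) := mul_le_mul_of_nonneg_left (exp_help h1) (by positivity)
      _ = _ := by ring
  have hcd : c ≤ d := by rw [hc, hdd]; linarith
  have main := half_strip' q b c d _ hcd (hqd.continuousOn.mono ?_) (hqd.mono ?_) hqB
  rotate_left
  · intro z hz; simp only [hU, Set.mem_ofPred_eq] at hz ⊢; constructor <;> linarith [hz.2.1, hz.2.2]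
  · intro z hz; simp only [hU, Set.mem_ofPred_eq] at hz ⊢; constructor <;> linarith [hz.2.1, hz.2.2]
  -- edges
  have kint : ∀ e : ℝ, (∀ x : ℝ, Ef (x + e * I) ≠ 0) → IntegrableOn (fun x : ℝ => (Ef (x + e * I))⁻¹) (Set.Iic b) := by
    intro e he
    refine int_Iic _ b 2 ?_ ?_
    · exact (Continuous.inv₀ (Ef_diff.continuous.comp (by fun_prop)) he).continuousOn
    · intro x hx
      refine (Ef_inv_bound _ (by simpa using hx)).trans ?_
      simp
      nlinarith [Real.pi_gt_three]
  have qint : ∀ e : ℝ, c ≤ e → e ≤ d → IntegrableOn (fun x : ℝ => q (x + e * I)) (Set.Iic b) := by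
    intro e h1 h2
    refine int_Iic _ b (2 * (C + ‖gf m s z0‖)) ?_ ?_
    · refine ContinuousOn.comp hqd.continuousOn (by fun_prop) ?_
      intro x _; simp [hU]; constructor <;> linarith
    · intro x hx
      have := hqB (x + e * I) (by simpa using hx) (by simpa using h1) (by simpa using h2)
      simpa using this
  have E1 : (∫ x in Set.Iic b, Ff m s ((x:ℝ) + c * I)) = (∫ x in Set.Iic b, q ((x:ℝ) + c * I))
      + gf m s z0 * ∫ x in Set.Iic b, (Ef ((x:ℝ) + c * I))⁻¹ := by
    rw [← integral_const_mul, ← integral_add (qint c le_rfl hcd) ((kint c hEc).const_mul _)]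
    congr 1; funext x; exact hFE _ (hnc x)
  have E2 : (∫ x in Set.Iic b, Ff m s ((x:ℝ) + d * I)) = (∫ x in Set.Iic b, q ((x:ℝ) + d * I))
      + gf m s z0 * ∫ x in Set.Iic b, (Ef ((x:ℝ) + d * I))⁻¹ := by
    rw [← integral_const_mul, ← integral_add (qint d hcd le_rfl) ((kint d hEdd).const_mul _)]
    congr 1; funext x; exact hFE _ (hnd x)
  have E3 : (∫ y in c..d, Ff m s (b + (y:ℝ) * I)) = (∫ y in c..d, q (b + (y:ℝ) * I))
      + gf m s z0 * ∫ y in c..d, (Ef (b + (y:ℝ) * I))⁻¹ := by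
    rw [← intervalIntegral.integral_const_mul, ← intervalIntegral.integral_add]
    · congr 1; funext y; exact hFE _ (hnb y)
    · apply ContinuousOn.intervalIntegrable
      refine ContinuousOn.comp hqd.continuousOn (by fun_prop) ?_
      intro y hy
      rw [Set.uIcc_of_le hcd] at hy
      simp [hU]; constructor <;> linarith [hy.1, hy.2]
    · apply Continuous.intervalIntegrable
      exact (Continuous.inv₀ (Ef_diff.continuous.comp (by fun_prop)) hEb).const_mul _
  have E4 : (∫ x in Set.Iic b, (Ef ((x:ℝ) + d * I))⁻¹) = ∫ x in Set.Iic b, (Ef ((x:ℝ) + c * I))⁻¹ := by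
    congr 1; funext x
    rw [show ((x:ℝ) + d * I : ℂ) = (x + c * I) + I by rw [hc, hdd]; push_cast; ring, Ef_period]
  have E5 : ∫ y in c..d, (Ef (b + (y:ℝ) * I))⁻¹ = -1 := by
    rw [show d = c + 1 by rw [hc, hdd]; ring]; exact K_side b hb c
  rw [E1, E2, E3, E4, E5]
  linear_combination main

def Pf (e : ℂ) (m : ℕ) (s z : ℂ) : ℂ :=
  (z * e) ^ (s - 2) * e * Complex.exp (2 * π * m * z) / dslope Ef 0 z

lemma Ef_z : Ef 0 = 0 := by simp [Ef]

lemma Pf_eq (e : ℂ) (he : e ≠ 0) (m : ℕ) (s z : ℂ) (hz : z ≠ 0) :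
    Pf e m s z = (z * e) ^ (s-1) * Complex.exp (2 * π * m * z) / Ef z := by
  unfold Pf
  rw [dslope_of_ne _ hz, slope_def_field, Ef_z, show s - 1 = (s - 2) + 1 by ring,
    Complex.cpow_add _ _ (mul_ne_zero hz he), Complex.cpow_one]
  simp only [sub_zero]
  rw [div_div_eq_mul_div]
  ring

lemma dEf_ne {z : ℂ} (hz : |z.im| < 1) : dslope Ef 0 z ≠ 0 := by
  by_cases hne : z = 0
  · rw [hne, dslope_same]
    have : HasDerivAt Ef (-(2*π) * Complex.exp (-(2*π*0))) 0 := by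
      have h1 : HasDerivAt (fun z : ℂ => -(2*π*z)) (-(2*π)) 0 := by
        simpa using ((hasDerivAt_id (0:ℂ)).const_mul (2*π:ℂ)).fun_neg
      exact (h1.cexp.sub_const 1).congr_deriv (by ring)
    rw [this.deriv]
    have hp : (π:ℂ) ≠ 0 := by exact_mod_cast Real.pi_ne_zero
    simp [hp]
  · rw [dslope_of_ne _ hne, slope_def_field, Ef_z, sub_zero]
    refine div_ne_zero ?_ (sub_ne_zero.2 hne)
    intro h0
    obtain ⟨n, rfl⟩ := (Ef_zero_iff z).1 h0
    simp at hz
    have : n = 0 := by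
      have h : |n| < 1 := by exact_mod_cast hz
      exact Int.abs_lt_one_iff.1 h
    apply hne; simp [this]

lemma dEf_diff : Differentiable ℂ (dslope Ef 0) := by
  rw [← differentiableOn_univ, Complex.differentiableOn_dslope Filter.univ_mem]
  exact Ef_diff.differentiableOn

lemma Pf_cont (e : ℂ) (m : ℕ) (s z : ℂ) (hs : 2 < s.re) (h1 : 0 ≤ (z*e).re) (h2 : |z.im| < 1) :
    ContinuousAt (Pf e m s) z := by
  unfold Pf
  refine ContinuousAt.div ?_ dEf_diff.continuous.continuousAt (dEf_ne h2)
  refine ContinuousAt.mul (ContinuousAt.mul ?_ continuousAt_const) (by fun_prop)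
  have := Complex.continuousAt_cpow_const_of_re_pos (z := z*e) (w := s-2) (Or.inl h1) (by simpa using hs)
  exact ContinuousAt.comp (f := fun z => z * e) this (by fun_prop)

lemma Pf_diff (e : ℂ) (m : ℕ) (s z : ℂ) (h1 : 0 < (z*e).re) (h2 : |z.im| < 1) :
    DifferentiableAt ℂ (Pf e m s) z := by
  unfold Pf
  refine DifferentiableAt.div ?_ dEf_diff.differentiableAt (dEf_ne h2)
  refine DifferentiableAt.mul (DifferentiableAt.mul ?_ (differentiableAt_const _)) (by fun_prop)
  exact DifferentiableAt.cpow_const (by fun_prop) (Or.inl h1)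

lemma Pf_bound (e : ℂ) (he : ‖e‖ = 1) (m : ℕ) (s : ℂ) : ∃ C : ℝ, ∀ z : ℂ, z.re ≤ -1 → |z.im| ≤ 1 →
    ‖Pf e m s z‖ ≤ C * rexp (z.re) := by
  obtain ⟨C, hC, h⟩ := cpow_tail (s-1)
  refine ⟨C * rexp 1 * 2, fun z hz hy => ?_⟩
  have h1 : 1 ≤ ‖z‖ := by
    have := (abs_le.1 (Complex.abs_re_le_norm z)).1
    linarith
  have h2 : ‖z‖ ≤ -z.re + 1 := by
    have := Complex.norm_le_abs_re_add_abs_im z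
    rw [abs_of_neg (by linarith)] at this
    linarith
  rw [Pf_eq e (by intro h; simp [h] at he) m s z (by intro h; rw [h] at hz; simp at hz; linarith)]
  rw [div_eq_mul_inv, norm_mul, norm_mul, Complex.norm_exp]
  have e1 : (2 * π * m * z : ℂ).re = 2*π*m*z.re := by simp
  have h3 : rexp (2*π*m*z.re) ≤ 1 := by
    rw [Real.exp_le_one_iff]
    have : (0:ℝ) ≤ 2 * π * m := by positivity
    nlinarith
  have hn : ‖z * e‖ = ‖z‖ := by rw [norm_mul, he, mul_one]
  rw [e1]
  calc _ ≤ (C * rexp (-z.re + 1)) * 1 * (2 * rexp (2*π*z.re)) := by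
        gcongr
        · refine (h (z*e) (by rw [hn]; exact h1)).trans ?_
          rw [hn]; gcongr
        · exact Ef_inv_bound z hz
    _ = C * rexp 1 * (rexp (-z.re) * (2 * rexp (2*π*z.re))) := by rw [Real.exp_add]; ring
    _ ≤ C * rexp 1 * (2 * rexp z.re) := mul_le_mul_of_nonneg_left (exp_help hz) (by positivity)
    _ = _ := by ring

lemma log_up (z : ℂ) (hz : z ≠ 0) (h : 0 ≤ z.im) :
    Complex.log z = Complex.log (z * (-I)) + π / 2 * I := by
  have h1 : z = (z * (-I)) * I := by linear_combination z * Complex.I_sq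
  conv_lhs => rw [h1]
  rw [(Complex.log_mul_eq_add_log_iff (by simp [hz]) Complex.I_ne_zero).2, Complex.log_I]
  rw [Complex.arg_I]
  have : |Complex.arg (z * (-I))| ≤ π/2 := Complex.abs_arg_le_pi_div_two_iff.2 (by simpa using h)
  rw [abs_le] at this
  constructor <;> linarith [this.1, this.2, Real.pi_pos]

lemma log_dn (z : ℂ) (hz : z ≠ 0) (h : z.im ≤ 0) (hx : z.im < 0 ∨ 0 < z.re) :
    Complex.log z = Complex.log (z * I) - π / 2 * I := by
  have h1 : z = (z * I) * (-I) := by linear_combination z * Complex.I_sq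
  conv_lhs => rw [h1]
  rw [(Complex.log_mul_eq_add_log_iff (by simp [hz]) (by simp)).2, Complex.log_neg_I]
  · ring
  rw [Complex.arg_neg_I]
  have : |Complex.arg (z * I)| ≤ π/2 := Complex.abs_arg_le_pi_div_two_iff.2 (by simpa using h)
  rw [abs_le] at this
  have h3 : -(π/2) ≠ Complex.arg (z*I) := by
    intro h4
    rw [eq_comm, Complex.arg_eq_neg_pi_div_two_iff] at h4
    simp at h4
    rcases hx with hx | hx
    · linarith [h4.1]
    · linarith [h4.2]
  have h5 := lt_of_le_of_ne this.1 h3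
  constructor <;> linarith [this.1, this.2, Real.pi_pos]

lemma Ff_up (m : ℕ) (s z : ℂ) (hz : z ≠ 0) (h : 0 ≤ z.im) :
    Ff m s z = Complex.exp (π/2 * I * (s-1)) * Pf (-I) m s z := by
  rw [Pf_eq _ (by simp) m s z hz, Ff, gf, Complex.cpow_def_of_ne_zero hz,
    Complex.cpow_def_of_ne_zero (by simp [hz]), log_up z hz h, add_mul, Complex.exp_add]
  ring

lemma Ff_dn (m : ℕ) (s z : ℂ) (hz : z ≠ 0) (h : z.im ≤ 0) (hx : z.im < 0 ∨ 0 < z.re) :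
    Ff m s z = Complex.exp (-(π/2 * I * (s-1))) * Pf I m s z := by
  rw [Pf_eq _ (by simp) m s z hz, Ff, gf, Complex.cpow_def_of_ne_zero hz,
    Complex.cpow_def_of_ne_zero (by simp [hz]), log_dn z hz h hx, sub_mul, sub_eq_add_neg, Complex.exp_add]
  ring

def Lf (m j : ℕ) (b : ℝ) (s : ℂ) : ℂ :=
  (∫ x in Set.Iic b, Ff m s ((x:ℝ) + (-(j + 1/2) : ℝ) * I))
   + I * (∫ y in (-(j+1/2) : ℝ)..(j+1/2 : ℝ), Ff m s (b + (y:ℝ) * I))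
      - (∫ x in Set.Iic b, Ff m s ((x:ℝ) + (j + 1/2 : ℝ) * I))

lemma Ff_side_cont (m : ℕ) (s : ℂ) (b : ℝ) (hb : 0 < b) : Continuous (fun y : ℝ => Ff m s (b + (y:ℝ) * I)) := by
  unfold Ff
  refine Continuous.div ?_ (Ef_diff.continuous.comp (by fun_prop)) (fun y => Ef_ne_of_re (by simpa using hb.ne'))
  unfold gf
  refine Continuous.mul ?_ (by fun_prop)
  refine Continuous.cpow (by fun_prop) continuous_const ?_
  intro y; left; simpa using hb

lemma Lf_succ (m j : ℕ) (b : ℝ) (hb : 0 < b) (s : ℂ) :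
    Lf m (j+1) b s = Lf m j b s - I * (gf m s ((-(j+1:ℤ) : ℤ) * I) + gf m s ((j+1 : ℤ) * I)) := by
  have h1 := pole_cross m s (-(j+1:ℤ)) (by omega) b hb (-(((j+1:ℕ):ℝ)+1/2)) (-(j+1/2)) (by push_cast; ring) (by push_cast; ring)
  have h2 := pole_cross m s (j+1:ℤ) (by omega) b hb (j+1/2) (((j+1:ℕ):ℝ)+1/2) (by push_cast; ring) (by push_cast; ring)
  have hi : ∀ c d : ℝ, IntervalIntegrable (fun y : ℝ => Ff m s (b + (y:ℝ) * I)) volume c d :=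
    fun c d => (Ff_side_cont m s b hb).intervalIntegrable _ _
  have h3 : (∫ y in (-(((j+1:ℕ):ℝ)+1/2) : ℝ)..(((j+1:ℕ):ℝ)+1/2 : ℝ), Ff m s (b + (y:ℝ) * I)) =
     (∫ y in (-(((j+1:ℕ):ℝ)+1/2) : ℝ)..(-(j+1/2)), Ff m s (b + (y:ℝ) * I)) +
     (∫ y in (-(j+1/2) : ℝ)..(j+1/2), Ff m s (b + (y:ℝ) * I)) +
     (∫ y in (j+1/2 : ℝ)..(((j+1:ℕ):ℝ)+1/2), Ff m s (b + (y:ℝ) * I)) := by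
    rw [intervalIntegral.integral_add_adjacent_intervals (hi _ _) (hi _ _),
      intervalIntegral.integral_add_adjacent_intervals (hi _ _) (hi _ _)]
  unfold Lf
  rw [h3]
  linear_combination h1 + h2

lemma Lf_base (m : ℕ) (b : ℝ) (hb : 0 < b) (s : ℂ) (hs : 2 < s.re) :
    Lf m 0 b s = (Complex.exp (π * I * s) - Complex.exp (-(π * I * s))) *
      ∫ y in Set.Ioi (0:ℝ), (y:ℂ)^(s-1) * (Complex.exp (-(2*π*m*y)) / (Complex.exp (2*π*y) - 1)) := by
  set cp := Complex.exp (π/2 * I * (s-1)) with hcp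
  set cm := Complex.exp (-(π/2 * I * (s-1))) with hcm
  obtain ⟨C1, hC1⟩ := Pf_bound (-I) (by simp) m s
  obtain ⟨C2, hC2⟩ := Pf_bound I (by simp) m s
  have H1 := half_strip' (Pf (-I) m s) b 0 (1/2) C1 (by norm_num) ?_ ?_ ?_
  rotate_left
  · intro z hz
    refine (Pf_cont _ m s z hs (by simpa using hz.2.1) ?_).continuousWithinAt
    rw [abs_lt]; constructor <;> linarith [hz.2.1, hz.2.2]
  · intro z hz
    refine (Pf_diff _ m s z (by simpa using hz.2.1) ?_).differentiableWithinAt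
    rw [abs_lt]; constructor <;> linarith [hz.2.1, hz.2.2]
  · intro z h1 h2 h3
    exact hC1 z h1 (by rw [abs_le]; constructor <;> linarith)
  have H2 := half_strip' (Pf I m s) b (-(1/2)) 0 C2 (by norm_num) ?_ ?_ ?_
  rotate_left
  · intro z hz
    refine (Pf_cont _ m s z hs (by simpa using hz.2.2) ?_).continuousWithinAt
    rw [abs_lt]; constructor <;> linarith [hz.2.1, hz.2.2]
  · intro z hz
    refine (Pf_diff _ m s z (by simpa using hz.2.2) ?_).differentiableWithinAt
    rw [abs_lt]; constructor <;> linarith [hz.2.1, hz.2.2]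
  · intro z h1 h2 h3
    exact hC2 z h1 (by rw [abs_le]; constructor <;> linarith)
  have e1 : (∫ x in Set.Iic b, Ff m s ((x:ℝ) + (-(1/2) : ℝ) * I)) = cm * ∫ x in Set.Iic b, Pf I m s ((x:ℝ) + (-(1/2) : ℝ) * I) := by
    rw [← integral_const_mul]; congr 1; funext x
    exact Ff_dn m s _ (by intro h; have := congrArg Complex.im h; simp at this) (by simp) (Or.inl (by simp))
  have e2 : (∫ x in Set.Iic b, Ff m s ((x:ℝ) + (1/2 : ℝ) * I)) = cp * ∫ x in Set.Iic b, Pf (-I) m s ((x:ℝ) + (1/2 : ℝ) * I) := by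
    rw [← integral_const_mul]; congr 1; funext x
    exact Ff_up m s _ (by intro h; have := congrArg Complex.im h; simp at this) (by simp)
  have hbz : ∀ y : ℝ, (b + y * I : ℂ) ≠ 0 := by
    intro y h; have := congrArg Complex.re h; simp at this; exact hb.ne' this
  have e3 : (∫ y in (-(1/2) : ℝ)..(0:ℝ), Ff m s (b + (y:ℝ) * I)) = cm * ∫ y in (-(1/2) : ℝ)..(0:ℝ), Pf I m s (b + (y:ℝ) * I) := by
    rw [← intervalIntegral.integral_const_mul]
    apply intervalIntegral.integral_congr
    intro y hy
    rw [Set.uIcc_of_le (by norm_num)] at hy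
    exact Ff_dn m s _ (hbz y) (by simpa using hy.2) (Or.inr (by simpa using hb))
  have e4 : (∫ y in (0:ℝ)..(1/2:ℝ), Ff m s (b + (y:ℝ) * I)) = cp * ∫ y in (0:ℝ)..(1/2:ℝ), Pf (-I) m s (b + (y:ℝ) * I) := by
    rw [← intervalIntegral.integral_const_mul]
    apply intervalIntegral.integral_congr
    intro y hy
    rw [Set.uIcc_of_le (by norm_num)] at hy
    exact Ff_up m s _ (hbz y) (by simpa using hy.1)
  have hi : ∀ c d : ℝ, IntervalIntegrable (fun y : ℝ => Ff m s (b + (y:ℝ) * I)) volume c d :=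
    fun c d => (Ff_side_cont m s b hb).intervalIntegrable _ _
  have i1 : IntegrableOn (fun x : ℝ => Pf (-I) m s ((x:ℝ) + (0:ℝ) * I)) (Set.Iic b) := by
    refine int_Iic _ b C1 ?_ ?_
    · intro x hx
      refine ContinuousAt.continuousWithinAt ?_
      exact ContinuousAt.comp (f := fun x : ℝ => ((x:ℝ) + (0:ℝ) * I : ℂ)) (Pf_cont _ m s _ hs (by simp) (by simp)) (by fun_prop)
    · intro x hx; simpa using hC1 (x + (0:ℝ) * I) (by simpa using hx) (by simp)
  have i2 : IntegrableOn (fun x : ℝ => Pf I m s ((x:ℝ) + (0:ℝ) * I)) (Set.Iic b) := by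
    refine int_Iic _ b C2 ?_ ?_
    · intro x hx
      refine ContinuousAt.continuousWithinAt ?_
      exact ContinuousAt.comp (f := fun x : ℝ => ((x:ℝ) + (0:ℝ) * I : ℂ)) (Pf_cont _ m s _ hs (by simp) (by simp)) (by fun_prop)
    · intro x hx; simpa using hC2 (x + (0:ℝ) * I) (by simpa using hx) (by simp)
  have L1 : Lf m 0 b s = ∫ x in Set.Iic b, (cm * Pf I m s ((x:ℝ) + (0:ℝ) * I) - cp * Pf (-I) m s ((x:ℝ) + (0:ℝ) * I)) := by
    rw [integral_sub (i2.const_mul cm) (i1.const_mul cp), integral_const_mul, integral_const_mul]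
    unfold Lf
    simp only [Nat.cast_zero, zero_add]
    rw [← intervalIntegral.integral_add_adjacent_intervals (hi _ 0) (hi 0 _), e1, e2, e3, e4]
    linear_combination cp * H1 + cm * H2
  have L2 : (∫ x in Set.Iic b, (cm * Pf I m s ((x:ℝ) + (0:ℝ) * I) - cp * Pf (-I) m s ((x:ℝ) + (0:ℝ) * I))) =
      ∫ x in Set.Iic (0:ℝ), (cm * Pf I m s ((x:ℝ) + (0:ℝ) * I) - cp * Pf (-I) m s ((x:ℝ) + (0:ℝ) * I)) := by
    apply setIntegral_eq_of_subset_of_forall_sdiff_eq_zero measurableSet_Iic (Set.Iic_subset_Iic.2 hb.le)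
    intro x hx
    have hx0 : 0 < x := by simpa using hx.2
    have hz : ((x:ℝ) + (0:ℝ) * I : ℂ) ≠ 0 := by simpa using hx0.ne'
    rw [← Ff_up m s _ hz (by simp), ← Ff_dn m s _ hz (by simp) (Or.inr (by simpa using hx0)), sub_self]
  rw [L1, L2]
  have L3 := integral_comp_neg_Ioi 0 (fun x : ℝ => (cm * Pf I m s ((x:ℝ) + (0:ℝ) * I) - cp * Pf (-I) m s ((x:ℝ) + (0:ℝ) * I)))
  rw [neg_zero] at L3
  rw [← L3, ← integral_const_mul]
  apply setIntegral_congr_fun measurableSet_Ioi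
  intro y hy
  have hy0 : 0 < y := hy
  have hyc : (y:ℂ) ≠ 0 := by exact_mod_cast hy0.ne'
  have hz : (((-y:ℝ):ℂ) + (0:ℝ) * I : ℂ) ≠ 0 := by simpa using hy0.ne'
  simp only
  rw [Pf_eq _ (by simp) m s _ hz, Pf_eq _ (by simp) m s _ hz]
  have c1 : ((((-y:ℝ):ℂ) + (0:ℝ) * I) * I) ^ (s-1) = (y:ℂ)^(s-1) * cm := by
    rw [show (((-y:ℝ):ℂ) + (0:ℝ) * I) * I = (y:ℂ) * (-I) by push_cast; ring]
    rw [Complex.cpow_def_of_ne_zero (by simp [hyc]), Complex.cpow_def_of_ne_zero hyc,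
      Complex.log_ofReal_mul hy0 (by simp), Complex.log_neg_I, Complex.ofReal_log hy0.le, hcm, ← Complex.exp_add]
    congr 1; ring
  have c2 : ((((-y:ℝ):ℂ) + (0:ℝ) * I) * (-I)) ^ (s-1) = (y:ℂ)^(s-1) * cp := by
    rw [show (((-y:ℝ):ℂ) + (0:ℝ) * I) * (-I) = (y:ℂ) * I by push_cast; ring]
    rw [Complex.cpow_def_of_ne_zero (by simp [hyc]), Complex.cpow_def_of_ne_zero hyc,
      Complex.log_ofReal_mul hy0 (by simp), Complex.log_I, Complex.ofReal_log hy0.le, hcp, ← Complex.exp_add]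
    congr 1; ring
  have c3 : cm * cm = - Complex.exp (-(π * I * s)) := by
    rw [hcm, ← Complex.exp_add, show -(π/2 * I * (s-1)) + -(π/2 * I * (s-1)) = -(π * I * s) + π * I by ring,
      Complex.exp_add, Complex.exp_pi_mul_I]; ring
  have c4 : cp * cp = - Complex.exp (π * I * s) := by
    rw [hcp, ← Complex.exp_add, show (π/2 * I * (s-1)) + (π/2 * I * (s-1)) = (π * I * s) - π * I by ring,
      Complex.exp_sub, Complex.exp_pi_mul_I]; ring
  rw [c1, c2]
  unfold Ef
  rw [show -(2 * (π:ℂ) * (((-y:ℝ):ℂ) + (0:ℝ) * I)) = 2 * π * y by push_cast; ring,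
    show 2 * (π:ℂ) * m * (((-y:ℝ):ℂ) + (0:ℝ) * I) = -(2 * π * m * y) by push_cast; ring]
  linear_combination (y:ℂ)^(s-1) * Complex.exp (-(2 * π * m * y)) / (Complex.exp (2*π*y) - 1) * (c3 - c4)

lemma mellin_tail (m : ℕ) (s : ℂ) (hs : 1 < s.re) :
    ∫ y in Set.Ioi (0:ℝ), (y:ℂ)^(s-1) * (Complex.exp (-(2*π*m*y)) / (Complex.exp (2*π*y) - 1)) =
    Complex.Gamma s * ((2*π:ℝ):ℂ)^(-s) * (riemannZeta s - ∑ n ∈ Finset.Icc 1 m, (n:ℂ)^(-s)) := by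
  have hs0 : s ≠ 0 := by intro h; rw [h] at hs; simp at hs; linarith
  have hsum : Summable (fun n : ℕ => 1 / (n:ℂ)^s) := Complex.summable_one_div_nat_cpow.2 hs
  have hz : riemannZeta s = ∑ n ∈ Finset.Icc 1 m, (n:ℂ)^(-s) + ∑' i : ℕ, 1 / ((i + (m+1) : ℕ) : ℂ)^s := by
    rw [zeta_eq_tsum_one_div_nat_cpow hs, ← hsum.sum_add_tsum_nat_add (m+1)]
    congr 1
    rw [Finset.range_eq_Ico, Finset.sum_eq_sum_Ico_succ_bot (by omega)]
    simp only [Nat.cast_zero, Complex.zero_cpow hs0, div_zero, zero_add]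
    apply Finset.sum_congr
    · ext x; simp
    · intro n _; rw [Complex.cpow_neg, one_div]
  have hp : ∀ i : ℕ, (0:ℝ) < 2 * π * (i + m + 1) := fun i => by positivity
  have key := hasSum_mellin (ι := ℕ) (a := fun _ => 1) (p := fun i => 2 * π * (i + m + 1))
    (F := fun y => (Complex.exp (-(2*π*m*y)) / (Complex.exp (2*π*y) - 1))) (s := s)
    (fun i => Or.inr (hp i)) (by linarith) ?_ ?_
  · have e : mellin (fun y : ℝ => (Complex.exp (-(2*π*m*y)) / (Complex.exp (2*π*y) - 1))) s =
       ∫ y in Set.Ioi (0:ℝ), (y:ℂ)^(s-1) * (Complex.exp (-(2*π*m*y)) / (Complex.exp (2*π*y) - 1)) := by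
      unfold mellin; simp only [smul_eq_mul]
    rw [← e, ← key.tsum_eq, hz, add_sub_cancel_left, ← tsum_mul_left]
    congr 1; funext i
    rw [show ((2 * π * (i + m + 1) : ℝ):ℂ) = ((2*π:ℝ):ℂ) * ((i + m + 1 : ℝ):ℂ) by push_cast; ring,
      Complex.mul_cpow_ofReal_nonneg (by positivity) (by positivity), Complex.cpow_neg]
    have : ((i + (m+1) : ℕ) : ℂ) = ((i + m + 1 : ℝ):ℂ) := by push_cast; ring
    rw [this]
    simp only [mul_one, div_eq_mul_inv, mul_inv, one_mul]
    ring
  · intro y hy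
    have hy0 : 0 < y := hy
    have hr : ‖Complex.exp (-(2*π*y))‖ < 1 := by
      rw [Complex.norm_exp, Real.exp_lt_one_iff]; simp; positivity
    have h1 := (hasSum_geometric_of_norm_lt_one hr).mul_left (Complex.exp (-(2*π*m*y)) * Complex.exp (-(2*π*y)))
    have ef : (fun i : ℕ => (1:ℂ) * ((rexp (-(2 * π * (i + m + 1)) * y) : ℝ):ℂ)) =
        fun i : ℕ => Complex.exp (-(2*π*m*y)) * Complex.exp (-(2*π*y)) * Complex.exp (-(2*π*y)) ^ i := by
      funext i
      rw [← Complex.exp_nat_mul, ← Complex.exp_add, ← Complex.exp_add, one_mul, Complex.ofReal_exp]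
      congr 1; push_cast; ring
    have ev : Complex.exp (-(2*π*m*y)) / (Complex.exp (2*π*y) - 1) =
        Complex.exp (-(2*π*m*y)) * Complex.exp (-(2*π*y)) * (1 - Complex.exp (-(2*π*y)))⁻¹ := by
      rw [mul_assoc (Complex.exp (-(2*π*m*y))), div_eq_mul_inv]
      congr 1
      have h2 : Complex.exp (2*π*y) * Complex.exp (-(2*π*y)) = 1 := by rw [← Complex.exp_add]; simp
      have h3 : 1 - Complex.exp (-(2*π*y)) ≠ 0 := by
        intro h; rw [sub_eq_zero] at h; rw [← h] at hr; simp at hr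
      have h4 : Complex.exp (2*π*y) - 1 ≠ 0 := by
        intro h
        apply h3
        rw [sub_eq_zero] at h; rw [h, one_mul] at h2; rw [h2, sub_self]
      rw [inv_eq_iff_eq_inv, mul_inv, inv_inv, ← Complex.exp_neg, neg_neg]
      linear_combination h2
    rw [ev]
    rw [← ef] at h1
    exact h1
  · have : Summable (fun n : ℕ => 1 / (n:ℝ)^s.re) := Real.summable_one_div_nat_rpow.2 hs
    have h2 := ((summable_nat_add_iff (m+1)).2 this).mul_left (1 / (2*π)^s.re)
    refine h2.congr ?_
    intro i
    rw [Real.mul_rpow (x := 2*π) (by positivity) (by positivity)]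
    push_cast
    rw [norm_one, show (i:ℝ) + (m + 1) = i + m + 1 by ring]
    rw [one_div, one_div, one_div, mul_inv]

lemma hline_diff (m : ℕ) (b c : ℝ) (hc : c ≠ 0) (hE : ∀ x : ℝ, Ef (x + c * I) ≠ 0) :
    Differentiable ℂ (fun s => ∫ x in Set.Iic b, Ff m s ((x:ℝ) + c * I)) := by
  set l : ℝ → ℂ := fun x => Complex.log (x + c * I) with hl
  set g : ℝ → ℂ := fun x => Complex.exp (2 * π * m * (x + c * I)) / Ef (x + c * I) with hg
  have hne : ∀ x : ℝ, (x + c * I : ℂ) ≠ 0 := by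
    intro x h; have := congrArg Complex.im h; simp at this; exact hc this
  have hlc : Continuous l := by
    refine Continuous.clog (by fun_prop) ?_
    intro x; right; simpa using hc
  have hgc : Continuous g := Continuous.div (by fun_prop) (Ef_diff.continuous.comp (by fun_prop)) hE
  have hX : ExpInt (volume.restrict (Set.Iic b)) l g := by
    refine ⟨hlc.aestronglyMeasurable, hgc.aestronglyMeasurable, fun D => ?_⟩
    obtain ⟨C, hC, hF⟩ := Ff_bound m (|D| + 1) |c|
    have := int_Iic (fun x => ((rexp (D * ‖l x‖) : ℝ):ℂ) * g x) b (rexp (|D| * π) * C) ?_ ?_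
    · have h2 := this.norm
      refine h2.congr ?_
      filter_upwards with x
      rw [norm_mul, Complex.norm_real, Real.norm_of_nonneg (Real.exp_pos _).le]
    · apply Continuous.continuousOn
      fun_prop
    · intro x hx
      have h1 := hF (x + c * I) (by simpa using hx) (by simp)
      have hn1 : 1 ≤ ‖(x + c * I : ℂ)‖ := by
        have := (abs_le.1 (Complex.abs_re_le_norm (x + c * I))).1
        simp at this; linarith
      have h2 : ‖Ff m (|D|+1) (x + c * I)‖ = ‖(x + c * I : ℂ)‖ ^ |D| * ‖g x‖ := by
        unfold Ff gf
        rw [mul_div_assoc, norm_mul, add_sub_cancel_right, Complex.norm_cpow_real]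
      rw [h2] at h1
      have h3 : ‖l x‖ ≤ Real.log ‖(x + c * I : ℂ)‖ + π := by
        refine (Complex.norm_le_abs_re_add_abs_im _).trans ?_
        simp only [hl, Complex.log_re, Complex.log_im]
        rw [abs_of_nonneg (Real.log_nonneg hn1)]
        gcongr
        exact Complex.abs_arg_le_pi _
      rw [norm_mul, Complex.norm_real, Real.norm_of_nonneg (Real.exp_pos _).le]
      have h4 : rexp (D * ‖l x‖) ≤ rexp (|D| * π) * ‖(x + c * I : ℂ)‖ ^ |D| := by
        rw [Real.rpow_def_of_pos (by linarith), ← Real.exp_add]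
        apply Real.exp_le_exp.2
        calc D * ‖l x‖ ≤ |D| * ‖l x‖ := by gcongr; exact le_abs_self D
          _ ≤ |D| * (Real.log ‖(x + c * I : ℂ)‖ + π) := by gcongr
          _ = _ := by ring
      calc _ ≤ rexp (|D| * π) * ‖(x + c * I : ℂ)‖ ^ |D| * ‖g x‖ := by gcongr
        _ = rexp (|D| * π) * (‖(x + c * I : ℂ)‖ ^ |D| * ‖g x‖) := by ring
        _ ≤ rexp (|D| * π) * (C * rexp x) := by
            exact mul_le_mul_of_nonneg_left (by simpa using h1) (Real.exp_pos _).le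
        _ = _ := by ring
  have := hX.differentiable.comp (show Differentiable ℂ (fun s : ℂ => s - 1) by fun_prop)
  refine (show (fun s : ℂ => ∫ x in Set.Iic b, Ff m s ((x:ℝ) + c * I)) = _ from ?_) ▸ this
  funext s
  simp only [Function.comp]
  congr 1; funext x
  simp only [Ff, gf, hl, hg]
  rw [Complex.cpow_def_of_ne_zero (hne x), mul_comm (Complex.log _)]
  ring

lemma vline_diff (m : ℕ) (b c d : ℝ) (hb : 0 < b) (hcd : c ≤ d) :
    Differentiable ℂ (fun s => ∫ y in c..d, Ff m s (b + (y:ℝ) * I)) := by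
  set l : ℝ → ℂ := fun x => Complex.log (b + x * I) with hl
  set g : ℝ → ℂ := fun x => Complex.exp (2 * π * m * (b + x * I)) / Ef (b + x * I) with hg
  have hne : ∀ x : ℝ, (b + x * I : ℂ) ≠ 0 := by
    intro x h; have := congrArg Complex.re h; simp at this; exact hb.ne' this
  have hlc : Continuous l := by
    refine Continuous.clog (by fun_prop) ?_
    intro x; left; simpa using hb
  have hgc : Continuous g := Continuous.div (by fun_prop) (Ef_diff.continuous.comp (by fun_prop))
    (fun y => Ef_ne_of_re (by simpa using hb.ne'))
  have hX : ExpInt (volume.restrict (Set.Ioc c d)) l g := by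
    refine ⟨hlc.aestronglyMeasurable, hgc.aestronglyMeasurable, fun D => ?_⟩
    have : Continuous (fun x => rexp (D * ‖l x‖) * ‖g x‖) := by fun_prop
    exact (this.integrableOn_Icc).mono_set Set.Ioc_subset_Icc_self
  have := hX.differentiable.comp (show Differentiable ℂ (fun s : ℂ => s - 1) by fun_prop)
  refine (show (fun s : ℂ => ∫ y in c..d, Ff m s (b + (y:ℝ) * I)) = _ from ?_) ▸ this
  funext s
  simp only [Function.comp]
  rw [intervalIntegral.integral_of_le hcd]
  congr 1; funext x
  simp only [Ff, gf, hl, hg]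
  rw [Complex.cpow_def_of_ne_zero (hne x), mul_comm (Complex.log _)]
  ring

lemma Lf_diff (m j : ℕ) (b : ℝ) (hb : 0 < b) : Differentiable ℂ (Lf m j b) := by
  unfold Lf
  have hj : (0:ℝ) < j + 1/2 := by positivity
  refine Differentiable.sub (Differentiable.add ?_ ?_) ?_
  · exact hline_diff m b _ (by linarith) (fun x => Ef_ne_of_half x (-(j:ℤ)-1) _ (by push_cast; ring))
  · exact (vline_diff m b _ _ hb (by linarith)).const_mul _
  · exact hline_diff m b _ (by linarith) (fun x => Ef_ne_of_half x j _ (by push_cast; ring))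

lemma gf_pair (m : ℕ) (s : ℂ) (n : ℕ) :
    gf m s ((-(n+1:ℤ) : ℤ) * I) + gf m s ((n+1 : ℤ) * I) = 2 * ((n+1:ℕ):ℂ)^(s-1) * Complex.sin (π * s / 2) := by
  have hn : (0:ℝ) < (n+1:ℕ) := by positivity
  have hnc : ((n+1:ℕ):ℂ) ≠ 0 := by exact_mod_cast Nat.succ_ne_zero n
  unfold gf
  have e1 : Complex.exp (2 * π * m * (((-(n+1:ℤ) : ℤ):ℂ) * I)) = 1 := by
    rw [Complex.exp_eq_one_iff]
    exact ⟨-(m * (n+1)), by push_cast; ring⟩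
  have e2 : Complex.exp (2 * π * m * (((n+1:ℤ):ℂ) * I)) = 1 := by
    rw [Complex.exp_eq_one_iff]
    exact ⟨(m * (n+1)), by push_cast; ring⟩
  have l1 : (((-(n+1:ℤ) : ℤ):ℂ) * I) ^ (s-1) = ((n+1:ℕ):ℂ)^(s-1) * Complex.exp (-(π/2 * I) * (s-1)) := by
    rw [show ((-(n+1:ℤ) : ℤ):ℂ) * I = (((n+1:ℕ):ℝ):ℂ) * (-I) by push_cast; ring]
    rw [Complex.cpow_def_of_ne_zero (by simpa using hnc), Complex.cpow_def_of_ne_zero hnc,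
      Complex.log_ofReal_mul hn (by simp), Complex.log_neg_I, Complex.ofReal_log hn.le, ← Complex.exp_add]
    congr 1; push_cast; ring
  have l2 : (((n+1:ℤ):ℂ) * I) ^ (s-1) = ((n+1:ℕ):ℂ)^(s-1) * Complex.exp ((π/2 * I) * (s-1)) := by
    rw [show ((n+1:ℤ):ℂ) * I = (((n+1:ℕ):ℝ):ℂ) * I by push_cast; ring]
    rw [Complex.cpow_def_of_ne_zero (by simpa using hnc), Complex.cpow_def_of_ne_zero hnc,
      Complex.log_ofReal_mul hn (by simp), Complex.log_I, Complex.ofReal_log hn.le, ← Complex.exp_add]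
    congr 1; push_cast; ring
  rw [e1, e2, l1, l2]
  have h3 : Complex.exp (-(π/2 * I) * (s-1)) + Complex.exp ((π/2 * I) * (s-1)) = 2 * Complex.sin (π * s / 2) := by
    rw [← Complex.cos_sub_pi_div_two, Complex.two_cos]
    rw [add_comm]; congr 1 <;> congr 1 <;> ring
  linear_combination ((n+1:ℕ):ℂ)^(s-1) * h3

lemma Lf_all (m j : ℕ) (b : ℝ) (hb : 0 < b) (s : ℂ) :
    Lf m j b s = Lf m 0 b s - 2 * I * Complex.sin (π * s / 2) * ∑ n ∈ Finset.Icc 1 j, (n:ℂ)^(s-1) := by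
  induction j with
  | zero => simp
  | succ j ih =>
    rw [Lf_succ m j b hb, ih, gf_pair, Finset.sum_Icc_succ_top (by omega)]
    ring

lemma Lf_formula (m : ℕ) (b : ℝ) (hb : 0 < b) (s : ℂ) (hs : 0 < s.im) :
    Lf m m b s = (Complex.exp (π * I * s) - Complex.exp (-(π * I * s))) *
      (Complex.Gamma s * ((2*π:ℝ):ℂ)^(-s) * (riemannZeta s - ∑ n ∈ Finset.Icc 1 m, (n:ℂ)^(-s)))
       - 2 * I * Complex.sin (π * s / 2) * ∑ n ∈ Finset.Icc 1 m, (n:ℂ)^(s-1) := by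
  rw [Lf_all m m b hb]
  congr 1
  set U : Set ℂ := {s | 0 < s.im} with hU
  have hUo : IsOpen U := isOpen_lt continuous_const Complex.continuous_im
  have hUc : IsPreconnected U := (convex_halfSpace_im_gt 0).isPreconnected
  have a1 : AnalyticOnNhd ℂ (Lf m 0 b) U := ((Lf_diff m 0 b hb).differentiableOn).analyticOnNhd hUo
  have a2 : AnalyticOnNhd ℂ (fun s => (Complex.exp (π * I * s) - Complex.exp (-(π * I * s))) *
      (Complex.Gamma s * ((2*π:ℝ):ℂ)^(-s) * (riemannZeta s - ∑ n ∈ Finset.Icc 1 m, (n:ℂ)^(-s)))) U := by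
    refine DifferentiableOn.analyticOnNhd ?_ hUo
    intro s hs
    have hs' : 0 < s.im := hs
    refine DifferentiableAt.differentiableWithinAt ?_
    refine DifferentiableAt.mul (by fun_prop) (DifferentiableAt.mul (DifferentiableAt.mul ?_ ?_) (DifferentiableAt.sub ?_ ?_))
    · refine Complex.differentiableAt_Gamma s ?_
      intro k h; rw [h] at hs'; simp at hs'
    · refine DifferentiableAt.const_cpow (by fun_prop) (Or.inl ?_)
      exact_mod_cast (by positivity : (2*π:ℝ) ≠ 0)
    · refine differentiableAt_riemannZeta ?_
      intro h; rw [h] at hs'; simp at hs'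
    · refine DifferentiableAt.fun_sum ?_
      intro n hn
      refine DifferentiableAt.const_cpow (by fun_prop) (Or.inl ?_)
      have := (Finset.mem_Icc.1 hn).1
      exact_mod_cast (by omega : n ≠ 0)
  have h0 : (3 + I : ℂ) ∈ U := by simp [hU]
  have := a1.eqOn_of_preconnected_of_eventuallyEq a2 hUc h0 ?_
  · exact this hs
  · have ho : IsOpen {s : ℂ | 2 < s.re} := isOpen_lt continuous_const Complex.continuous_re
    filter_upwards [ho.mem_nhds (show (3 + I : ℂ) ∈ {s : ℂ | 2 < s.re} by simp; norm_num)] with z hz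
    have hz' : 2 < z.re := hz
    rw [Lf_base m b hb z hz', mellin_tail m z (by linarith)]

lemma chi_eq (s : ℂ) (hs : 0 < s.im) :
    chi s * (2 * ((2*π:ℝ):ℂ)^(-s) * Complex.Gamma s * Complex.cos (π * s / 2)) = 1 := by
  have hne : ∀ n : ℕ, s ≠ -(2 * n + 1) := by
    intro n h; rw [h] at hs; simp at hs
  have h1 := Complex.Gammaℝ_div_Gammaℝ_one_sub hne
  have hG1 : Complex.Gamma (s/2) ≠ 0 := by
    apply Complex.Gamma_ne_zero
    intro k h; have := congrArg Complex.im h; simp at this; linarith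
  have hG2 : Complex.Gamma ((1-s)/2) ≠ 0 := by
    apply Complex.Gamma_ne_zero
    intro k h; have := congrArg Complex.im h; simp at this; linarith
  have hπ : (π:ℂ) ≠ 0 := by exact_mod_cast Real.pi_ne_zero
  have h2 : chi s * (Complex.Gammaℝ s / Complex.Gammaℝ (1-s)) = 1 := by
    unfold chi
    rw [Complex.Gammaℝ_def, Complex.Gammaℝ_def]
    have e : (π:ℂ)^(s - 1/2) * (π:ℂ)^(-s/2) = (π:ℂ)^(-(1-s)/2) := by
      rw [← Complex.cpow_add _ _ hπ]; congr 1; ring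
    have hp : (π:ℂ)^(-(1-s)/2) ≠ 0 := by simp [Complex.cpow_eq_zero_iff, hπ]
    rw [mul_div_assoc, mul_assoc, div_mul_div_comm, mul_div_assoc', div_eq_one_iff_eq (by positivity), ← e]
    ring
  rw [h1, Complex.Gammaℂ_def] at h2
  rw [← h2]; push_cast; ring

lemma exact_formula (s : ℂ) (hs : 0 < s.im) (x b : ℝ) (hb : 0 < b) :
    riemannZeta s - zetaSum x s - chi s * zetaSum x (1 - s) = preF s * Lf ⌊x⌋₊ ⌊x⌋₊ b s := by
  rw [Lf_formula _ b hb s hs]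
  have hc := chi_eq s hs
  have hG : Complex.Gamma s ≠ 0 := by
    apply Complex.Gamma_ne_zero
    intro k h; have := congrArg Complex.im h; simp at this; linarith
  have hp0 : ((2*π:ℝ):ℂ) ≠ 0 := by exact_mod_cast (by positivity : (2*π:ℝ) ≠ 0)
  have hp : ((2*π:ℝ):ℂ)^s ≠ 0 := by rw [Ne, Complex.cpow_eq_zero_iff]; tauto
  have e1 : Complex.exp (2*π*I*s) - 1 = Complex.exp (π*I*s) * (Complex.exp (π*I*s) - Complex.exp (-(π*I*s))) := by
    rw [mul_sub, ← Complex.exp_add, ← Complex.exp_add]; simp; ring_nf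
  have hne : Complex.exp (2*π*I*s) - 1 ≠ 0 := by
    intro h
    rw [sub_eq_zero] at h
    have := congrArg norm h
    rw [Complex.norm_exp] at this
    simp at this
    exact hs.ne' this
  have h3 : Complex.exp (π*I*s) - Complex.exp (-(π*I*s)) ≠ 0 := by
    intro h; rw [h, mul_zero] at e1; exact hne e1
  have h4 : Complex.exp (π*I*s) - Complex.exp (-(π*I*s)) = 4 * I * Complex.sin (π*s/2) * Complex.cos (π*s/2) := by
    have := Complex.sin_two_mul (π*s/2)
    have h5 := Complex.two_sin (2 * (π*s/2))
    rw [show -(2 * (π*s/2)) * I = -(π*I*s) by ring, show (2 * (π*s/2)) * I = (π*I*s) by ring] at h5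
    linear_combination 2 * I * this - I * h5 - (Complex.exp (-(π*I*s)) - Complex.exp (π*I*s)) * I_sq
  have hz2 : zetaSum x (1-s) = ∑ n ∈ Finset.Icc 1 ⌊x⌋₊, (n:ℂ)^(s-1) := by
    unfold zetaSum; simp
  have hsin : Complex.sin (π*s/2) ≠ 0 := by intro h; rw [h4, h] at h3; simp at h3
  have hcos : Complex.cos (π*s/2) ≠ 0 := by intro h; rw [h4, h] at h3; simp at h3
  rw [hz2]
  have hz1 : zetaSum x s = ∑ n ∈ Finset.Icc 1 ⌊x⌋₊, (n:ℂ)^(-s) := rfl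
  rw [hz1]
  set S1 := ∑ n ∈ Finset.Icc 1 ⌊x⌋₊, (n:ℂ)^(-s)
  set S2 := ∑ n ∈ Finset.Icc 1 ⌊x⌋₊, (n:ℂ)^(s-1)
  have hpF : preF s = ((2*π:ℝ):ℂ)^s / (Complex.Gamma s * (4 * I * Complex.sin (π*s/2) * Complex.cos (π*s/2))) := by
    unfold preF
    rw [e1, ← h4]
    have := Complex.exp_ne_zero (π*I*s)
    field_simp
  have hchi : chi s = ((2*π:ℝ):ℂ)^s / (2 * Complex.Gamma s * Complex.cos (π*s/2)) := by
    rw [Complex.cpow_neg] at hc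
    field_simp at hc ⊢
    linear_combination hc
  rw [hpF, hchi, h4, Complex.cpow_neg]
  field_simp
  ring

lemma line_shift (H : ℂ → ℂ) (c d C : ℝ) (hcd : c ≤ d)
    (hd : ∀ z : ℂ, c ≤ z.im → z.im ≤ d → DifferentiableAt ℂ H z)
    (hB : ∀ z : ℂ, 1 ≤ |z.re| → c ≤ z.im → z.im ≤ d → ‖H z‖ ≤ C * rexp (-|z.re|)) :
    ∫ x : ℝ, H ((x:ℝ) + c * I) = ∫ x : ℝ, H ((x:ℝ) + d * I) := by
  have h1 := half_strip' H 0 c d C hcd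
    (fun z hz => (hd z hz.2.1 hz.2.2).continuousAt.continuousWithinAt)
    (fun z hz => (hd z hz.2.1.le hz.2.2.le).differentiableWithinAt)
    (by
      intro z h1 h2 h3
      have := hB z (by rw [abs_of_neg (by linarith)]; linarith) h2 h3
      rwa [abs_of_neg (by linarith), neg_neg] at this)
  have h2 := half_strip' (fun z => H (-z)) 0 (-d) (-c) C (by linarith)
    (fun z hz => by
      have : DifferentiableAt ℂ H (-z) := hd (-z) (by simp; linarith [hz.2.2]) (by simp; linarith [hz.2.1])
      exact (ContinuousAt.comp (f := fun z : ℂ => -z) this.continuousAt continuous_neg.continuousAt).continuousWithinAt)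
    (fun z hz => by
      have : DifferentiableAt ℂ H (-z) := hd (-z) (by simp; linarith [hz.2.2]) (by simp; linarith [hz.2.1])
      exact (DifferentiableAt.comp (f := fun z : ℂ => -z) z this (by fun_prop)).differentiableWithinAt)
    (by
      intro z h1 h2 h3
      have := hB (-z) (by rw [Complex.neg_re, abs_neg, abs_of_neg (by linarith)]; linarith) (by simp; linarith) (by simp; linarith)
      rwa [Complex.neg_re, abs_neg, abs_of_neg (by linarith), neg_neg] at this)
  have hint : ∀ e : ℝ, c ≤ e → e ≤ d → ∫ x : ℝ, H ((x:ℝ) + e * I) =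
      (∫ x in Set.Iic (0:ℝ), H ((x:ℝ) + e * I)) + ∫ x in Set.Iic (0:ℝ), H (-((x:ℝ) + (-e:ℝ) * I)) := by
    intro e he1 he2
    have hcont : Continuous (fun x : ℝ => H (x + e * I)) := by
      rw [continuous_iff_continuousAt]
      intro x
      have : ContinuousAt H (x + e * I) := (hd _ (by simpa using he1) (by simpa using he2)).continuousAt
      exact ContinuousAt.comp (f := fun x : ℝ => (x + e * I : ℂ)) this (by fun_prop)
    have j1 : IntegrableOn (fun x : ℝ => H (x + e * I)) (Set.Iic 0) := by
      refine int_Iic _ 0 C hcont.continuousOn ?_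
      intro x hx
      have := hB (x + e * I) (by simp; rw [abs_of_neg (by linarith)]; linarith) (by simpa using he1) (by simpa using he2)
      rw [show (x + e * I : ℂ).re = x by simp, abs_of_neg (by linarith), neg_neg] at this
      exact this
    have j2 : IntegrableOn (fun x : ℝ => H ((-x:ℝ) + e * I)) (Set.Iic 0) := by
      refine int_Iic _ 0 C (hcont.comp continuous_neg).continuousOn ?_
      intro x hx
      have := hB ((-x:ℝ) + e * I) (by simp; rw [abs_of_neg (by linarith)]; linarith) (by simpa using he1) (by simpa using he2)
      rw [show (((-x:ℝ):ℂ) + e * I : ℂ).re = -x by simp, abs_neg, abs_of_neg (by linarith), neg_neg] at this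
      exact this
    have j3 : IntegrableOn (fun x : ℝ => H (x + e * I)) (Set.Ioi 0) := by
      have := (integrableOn_Iic_iff_integrableOn_Iio (b := (0:ℝ)) (f := fun x : ℝ => H ((-x:ℝ) + e * I)) (μ := volume)).1 j2
      have := this.comp_neg
      simpa using this
    have h3 := intervalIntegral.integral_Iic_add_Ioi (b := (0:ℝ)) j1 j3
    rw [← h3]
    congr 1
    have h4 := integral_comp_neg_Iic (0:ℝ) (fun x : ℝ => H (x + e * I))
    rw [neg_zero] at h4
    rw [← h4]
    congr 1; funext x; congr 1; push_cast; ring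
  have h5 : ∫ y in (-d)..(-c), H (-(((0:ℝ):ℂ) + y * I)) = ∫ y in c..d, H (((0:ℝ):ℂ) + y * I) := by
    have := intervalIntegral.integral_comp_neg (a := -d) (b := -c) (fun y : ℝ => H (((0:ℝ):ℂ) + y * I))
    rw [neg_neg, neg_neg] at this
    rw [← this]
    congr 1; funext x; congr 1; push_cast; ring
  rw [h5] at h2
  rw [hint c le_rfl hcd, hint d hcd le_rfl]
  linear_combination h1 - h2

lemma K_low (A : ℝ) : 1/2 ≤ ‖1 + Complex.exp (-(A * (1 + I)))‖ := by
  have hn : ‖Complex.exp (-(A * (1 + I)))‖ = rexp (-A) := by rw [Complex.norm_exp]; simp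
  have hre : (1 + Complex.exp (-(A * (1 + I)))).re = 1 + rexp (-A) * Real.cos A := by
    rw [Complex.add_re, Complex.exp_re]; simp
  rcases le_total 1 A with h | h
  · have h1 := norm_sub_le_norm_add (1:ℂ) (Complex.exp (-(A * (1 + I))))
    have h2 : rexp (-A) ≤ rexp (-1) := Real.exp_le_exp.2 (by linarith)
    have h3 := Real.exp_neg_one_lt_half
    rw [hn, norm_one] at h1
    linarith
  rcases le_total A (-1) with h' | h'
  · have h1 := norm_sub_le_norm_add (Complex.exp (-(A * (1 + I)))) (1:ℂ)
    have h2 : -A + 1 ≤ rexp (-A) := Real.add_one_le_exp _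
    rw [hn, norm_one, add_comm] at h1
    linarith
  · have : 0 ≤ Real.cos A := Real.cos_nonneg_of_mem_Icc ⟨by linarith [Real.pi_gt_three], by linarith [Real.pi_gt_three]⟩
    have h1 := Complex.re_le_norm (1 + Complex.exp (-(A * (1 + I))))
    rw [hre] at h1
    have := mul_nonneg (Real.exp_pos (-A)).le this
    linarith

/-- the direction `exp (3πi/4)` -/
def om : ℂ := ((√2/2:ℝ):ℂ) * (-1 + I)

lemma rt_sq : ((√2/2:ℝ):ℂ)^2 = 1/2 := by
  rw [← Complex.ofReal_pow, div_pow, Real.sq_sqrt (by norm_num)]; norm_num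

lemma om_sq : om^2 = -I := by
  unfold om; linear_combination (-1+I)^2 * rt_sq + 1/2 * I_sq

lemma om_ne : om ≠ 0 := by intro h; have := om_sq; rw [h] at this; simp at this

lemma om_re : om.re = -(√2/2) := by simp [om]
lemma om_im : om.im = √2/2 := by simp [om]

lemma om_norm : ‖om‖ = 1 := by
  have h := congrArg norm om_sq
  rw [norm_pow, norm_neg, Complex.norm_I] at h
  exact (pow_eq_one_iff_of_nonneg (norm_nonneg _) two_ne_zero).1 h

/-- the exponent `-π i X²` on the line `X = c + om v` -/
lemma om_exp (c v : ℝ) : (-(π * I) * (c + om * v)^2).re = -π * v^2 + √2 * π * c * v := by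
  rw [show -(π * I) * (c + om * v : ℂ)^2 = -(π * I) * c^2 - 2 * π * c * v * (I * om) - (π * I) * om^2 * v^2 by ring, om_sq]
  rw [show -(π * I) * (c:ℂ)^2 - 2 * π * c * v * (I * om) - (π * I) * -I * v^2 =
    ((-π * c^2 : ℝ):ℂ) * I - ((2 * π * c * v:ℝ):ℂ) * (I * om) + ((π * v^2 : ℝ):ℂ) * (I^2) by push_cast; ring, I_sq]
  simp only [Complex.add_re, Complex.sub_re, Complex.mul_re, om_im, om_re]
  simp [-Complex.ofReal_pow]
  ring

/-- `exp(2πiX) - 1` -/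
def Dd (X : ℂ) : ℂ := Complex.exp (2 * π * I * X) - 1

lemma Dd_line (c : ℝ) (hc : c = 1/2 ∨ c = -1/2) (v : ℝ) :
    Dd (c + om * v) = -(1 + Complex.exp (-(((√2 * π * v : ℝ):ℂ) * (1 + I)))) := by
  unfold Dd
  have h : 2 * π * I * (c + om * v : ℂ) = 2 * π * I * c + -(((√2 * π * v : ℝ):ℂ) * (1 + I)) := by
    unfold om; push_cast; linear_combination π * √2 * v * I_sq
  rw [h, Complex.exp_add]
  have : Complex.exp (2 * π * I * c) = -1 := by
    rcases hc with rfl | rfl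
    · rw [← Complex.exp_pi_mul_I]; congr 1; push_cast; ring
    · rw [show 2 * π * I * ((-1/2:ℝ):ℂ) = -(π * I) by push_cast; ring, Complex.exp_neg, Complex.exp_pi_mul_I]; norm_num
  rw [this]; ring

lemma Dd_line_low (c : ℝ) (hc : c = 1/2 ∨ c = -1/2) (v : ℝ) : 1/2 ≤ ‖Dd (c + om * v)‖ := by
  rw [Dd_line c hc, norm_neg]; exact K_low _

lemma Dd_far (c v : ℝ) (hv : 1/2 ≤ |v|) : 1/2 ≤ ‖Dd (c + om * v)‖ := by
  have hn : ‖Complex.exp (2 * π * I * (c + om * v))‖ = rexp (-(√2 * π * v)) := by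
    rw [Complex.norm_exp]
    congr 1
    simp [om_im, om_re, Complex.mul_re, Complex.mul_im]
    ring
  have h2 : (2:ℝ) ≤ √2 * π := by
    have := Real.one_le_sqrt.2 (by norm_num : (1:ℝ) ≤ 2)
    nlinarith [Real.pi_gt_three]
  unfold Dd
  rcases le_abs.1 hv with h | h
  · have h1 := norm_sub_norm_le (1:ℂ) (Complex.exp (2 * π * I * (c + om * v)))
    rw [norm_sub_rev, hn, norm_one] at h1
    have h3 : rexp (-(√2 * π * v)) ≤ rexp (-1) := Real.exp_le_exp.2 (by nlinarith)
    have h4 := Real.exp_neg_one_lt_half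
    linarith
  · have h1 := norm_sub_norm_le (Complex.exp (2 * π * I * (c + om * v))) 1
    rw [hn, norm_one] at h1
    have h3 := Real.add_one_le_exp (-(√2 * π * v))
    nlinarith

lemma quad_dom (K v : ℝ) : -π * v^2 + K * |v| ≤ K^2 - v^2 := by
  have := Real.pi_gt_three
  rw [← sq_abs v]
  nlinarith [sq_nonneg (K - |v|/2), sq_nonneg |v|, sq_nonneg (|v|)]

def Ll (c : ℝ) (v : ℝ) : ℂ := 2 * π * I * (c + om * v)
def Gg (c : ℝ) (v : ℝ) : ℂ := om * Complex.exp (-(π * I) * (c + om * v)^2) / Dd (c + om * v)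

lemma Ll_norm (c v : ℝ) : ‖Ll c v‖ ≤ 2 * π * (|c| + |v|) := by
  unfold Ll
  rw [norm_mul]
  have h1 : ‖(2 * π * I : ℂ)‖ = 2 * π := by simp [abs_of_pos Real.pi_pos]
  rw [h1]
  have : ‖(c + om * v : ℂ)‖ ≤ |c| + |v| := by
    refine (norm_add_le _ _).trans ?_
    rw [norm_mul, om_norm]; simp
  exact mul_le_mul_of_nonneg_left this (by positivity)

lemma Gg_norm (c : ℝ) (hc : c = 1/2 ∨ c = -1/2) (v : ℝ) : ‖Gg c v‖ ≤ 2 * rexp (-π * v^2 + 3 * |v|) := by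
  unfold Gg
  rw [norm_div, norm_mul, om_norm, one_mul, Complex.norm_exp, om_exp]
  have h1 := Dd_line_low c hc v
  rw [div_le_iff₀ (by linarith)]
  have h2 : rexp (-π * v^2 + √2 * π * c * v) ≤ rexp (-π * v^2 + 3 * |v|) := by
    apply Real.exp_le_exp.2
    have hs : √2 ≤ 1.5 := by rw [Real.sqrt_le_left (by norm_num)]; norm_num
    have hs0 := Real.sqrt_nonneg 2
    have h3 : √2 * π ≤ 6 := by nlinarith [Real.pi_lt_four, Real.pi_pos]
    have h4 : c * v ≤ |v|/2 := by
      rcases hc with rfl | rfl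
      · linarith [le_abs_self v]
      · linarith [neg_abs_le v]
    have h5 : √2 * π * (c * v) ≤ √2 * π * (|v|/2) := mul_le_mul_of_nonneg_left h4 (by positivity)
    nlinarith [abs_nonneg v]
  nlinarith [Real.exp_pos (-π * v^2 + 3 * |v|)]

lemma Gg_cont (c : ℝ) (hc : c = 1/2 ∨ c = -1/2) : Continuous (Gg c) := by
  unfold Gg
  refine Continuous.div (by fun_prop) (by unfold Dd; fun_prop) ?_
  intro v h
  have := Dd_line_low c hc v
  rw [h] at this; norm_num at this

lemma Ll_cont (c : ℝ) : Continuous (Ll c) := by unfold Ll; fun_prop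

lemma Ups_ExpInt (c : ℝ) (hc : c = 1/2 ∨ c = -1/2) : ExpInt volume (Ll c) (Gg c) := by
  refine ⟨(Ll_cont c).aestronglyMeasurable, (Gg_cont c hc).aestronglyMeasurable, fun D => ?_⟩
  have hi : Integrable (fun v : ℝ => (rexp (|D| * (2*π) * |c|) * 2 * rexp ((|D| * (2 * π) + 3)^2)) * rexp (-1 * v^2)) :=
    (integrable_exp_neg_mul_sq one_pos).const_mul _
  refine hi.mono' ?_ ?_
  · have h1 := Ll_cont c
    have h2 := Gg_cont c hc
    exact Continuous.aestronglyMeasurable (by fun_prop)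
  · filter_upwards with v
    rw [norm_mul, norm_norm, Real.norm_of_nonneg (Real.exp_pos _).le]
    have h1 : rexp (D * ‖Ll c v‖) ≤ rexp (|D| * (2 * π * (|c| + |v|))) := by
      apply Real.exp_le_exp.2
      calc D * ‖Ll c v‖ ≤ |D| * ‖Ll c v‖ := mul_le_mul_of_nonneg_right (le_abs_self D) (norm_nonneg _)
        _ ≤ _ := mul_le_mul_of_nonneg_left (Ll_norm c v) (abs_nonneg D)
    calc _ ≤ rexp (|D| * (2 * π * (|c| + |v|))) * (2 * rexp (-π * v^2 + 3 * |v|)) :=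
          mul_le_mul h1 (Gg_norm c hc v) (norm_nonneg _) (Real.exp_pos _).le
      _ = (rexp (|D| * (2*π) * |c|) * 2) * rexp (-π * v^2 + (|D| * (2 * π) + 3) * |v|) := by
          rw [show |D| * (2 * π * (|c| + |v|)) = |D| * (2*π) * |c| + |D| * (2*π) * |v| by ring, Real.exp_add,
            show -π * v^2 + (|D| * (2 * π) + 3) * |v| = |D| * (2 * π) * |v| + (-π * v^2 + 3 * |v|) by ring,
            Real.exp_add (|D| * (2 * π) * |v|)]; ring
      _ ≤ (rexp (|D| * (2*π) * |c|) * 2) * rexp ((|D| * (2 * π) + 3)^2 - v^2) := by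
          refine mul_le_mul_of_nonneg_left (Real.exp_le_exp.2 (quad_dom _ _)) (by positivity)
      _ = _ := by rw [sub_eq_add_neg, Real.exp_add]; ring_nf

def Ups (c : ℝ) (u : ℂ) : ℂ := ∫ v : ℝ, Complex.exp (u * Ll c v) * Gg c v

lemma Dd_line_ne (c : ℝ) (hc : c = 1/2 ∨ c = -1/2) (v : ℝ) : Dd (c + om * v) ≠ 0 := by
  intro h
  have := Dd_line_low c hc v
  rw [h] at this; norm_num at this

lemma Ups_gauss (u : ℂ) : Ups (1/2) (u+1) - Ups (1/2) u = om * Complex.exp (I * π * u^2) := by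
  have hX := Ups_ExpInt (1/2) (Or.inl rfl)
  unfold Ups
  rw [← integral_sub (hX.integrable _) (hX.integrable _)]
  have e : ∀ v : ℝ, Complex.exp ((u+1) * Ll (1/2) v) * Gg (1/2) v - Complex.exp (u * Ll (1/2) v) * Gg (1/2) v
      = om * Complex.exp ((-π) * v^2 + (π * I * om * (2*u-1)) * v + (-π*I/4 + π * I * u)) := by
    intro v
    have hne := Dd_line_ne (1/2) (Or.inl rfl) v
    rw [add_mul, one_mul, Complex.exp_add, Gg, ← sub_mul, ← mul_sub_one]
    rw [show Complex.exp (Ll (1/2) v) - 1 = Dd (((1/2:ℝ):ℂ) + om * v) from rfl]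
    have : Complex.exp (u * Ll (1/2) v) * Complex.exp (-(π * I) * (((1/2:ℝ):ℂ) + om * v)^2) =
       Complex.exp ((-π) * v^2 + (π * I * om * (2*u-1)) * v + (-π*I/4 + π * I * u)) := by
      rw [← Complex.exp_add]; congr 1
      unfold Ll; push_cast
      linear_combination (-π * I * v^2) * om_sq + (π * v^2) * I_sq
    rw [← this]
    field_simp
  simp_rw [e]
  rw [integral_const_mul, integral_cexp_quadratic (by simpa using Real.pi_pos)]
  have hπ : (π:ℂ) ≠ 0 := by exact_mod_cast Real.pi_ne_zero
  rw [neg_neg, div_self hπ, Complex.one_cpow, one_mul]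
  congr 2
  field_simp
  linear_combination (2*u-1)^2*I*om_sq - (2*u-1)^2*I_sq

lemma Ups_shift (u : ℂ) : Ups (-1/2) u = -Complex.exp (-(2*π*I*u)) * Ups (1/2) (u+1) := by
  unfold Ups
  rw [← integral_const_mul]
  congr 1; funext v
  have hd : Dd (((-1/2:ℝ):ℂ) + om * v) = Dd (((1/2:ℝ):ℂ) + om * v) := by
    rw [Dd_line _ (Or.inr rfl), Dd_line _ (Or.inl rfl)]
  unfold Gg
  rw [hd]
  have : Complex.exp (u * Ll (-1/2) v) * Complex.exp (-(π * I) * (((-1/2:ℝ):ℂ) + om * v)^2) =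
    -Complex.exp (-(2*π*I*u)) * (Complex.exp ((u+1) * Ll (1/2) v) * Complex.exp (-(π * I) * (((1/2:ℝ):ℂ) + om * v)^2)) := by
    rw [← Complex.exp_add, ← Complex.exp_add, neg_mul (Complex.exp _), ← Complex.exp_add, neg_eq_neg_one_mul (Complex.exp _), ← Complex.exp_pi_mul_I, ← Complex.exp_add,
      Complex.exp_eq_exp_iff_exists_int]
    refine ⟨-1, ?_⟩
    unfold Ll; push_cast; ring
  linear_combination om / Dd (((1/2:ℝ):ℂ) + om * v) * this

lemma Dd_zero : Dd 0 = 0 := by simp [Dd]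
lemma Dd_diff : Differentiable ℂ Dd := by unfold Dd; fun_prop
lemma Dd_deriv : deriv Dd 0 = 2 * π * I := by
  have h : HasDerivAt Dd (Complex.exp (2 * π * I * 0) * (2 * π * I * 1)) 0 := by
    unfold Dd
    exact (((hasDerivAt_id (0:ℂ)).const_mul (2*π*I)).cexp).sub_const 1
  rw [h.deriv]; simp

def qX (u X : ℂ) : ℂ := 2 * π * I * om * Complex.exp (u * (2 * π * I * X) + -(π * I) * X^2) / dslope Dd 0 X

lemma dsl_ne {X : ℂ} (h : X ≠ 0) : dslope Dd 0 X = Dd X / X := by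
  rw [dslope_of_ne _ h, slope_def_field, Dd_zero, sub_zero, sub_zero]

lemma dsl_diff : Differentiable ℂ (dslope Dd 0) := by
  rw [← differentiableOn_univ]
  exact (Complex.differentiableOn_dslope Filter.univ_mem).2 Dd_diff.differentiableOn

lemma om_split (z : ℂ) : om * z = ((-√2 * z.im : ℝ):ℂ) + om * ((z.re - z.im : ℝ):ℂ) := by
  conv_lhs => rw [← Complex.re_add_im z]
  unfold om
  push_cast
  linear_combination (√2 / 2 * z.im:ℂ) * I_sq

lemma dsl_nz (z : ℂ) (h1 : -(√2/4) ≤ z.im) (h2 : z.im ≤ √2/4) : dslope Dd 0 (om * z) ≠ 0 := by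
  by_cases h0 : om * z = 0
  · rw [h0, dslope_same, Dd_deriv]; simp [Real.pi_ne_zero]
  · rw [dsl_ne h0]
    intro h
    rw [div_eq_zero_iff] at h
    rcases h with h | h
    · unfold Dd at h
      rw [sub_eq_zero, Complex.exp_eq_one_iff] at h
      obtain ⟨n, hn⟩ := h
      have hX : om * z = n := by
        have h3 : (2 * π * I : ℂ) ≠ 0 := by simp [Real.pi_ne_zero]
        apply mul_left_cancel₀ h3; rw [hn]; ring
      have e := om_split z
      rw [hX] at e
      have er := congrArg Complex.re e
      have ei := congrArg Complex.im e
      simp only [Complex.add_re, Complex.add_im, Complex.ofReal_re, Complex.ofReal_im, Complex.mul_re, Complex.mul_im, om_re, om_im, Complex.intCast_re, Complex.intCast_im] at er ei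
      have hs : (0:ℝ) < √2 := by positivity
      have h5 : z.re - z.im = 0 := by
        have : √2 / 2 * (z.re - z.im) = 0 := by linarith
        rcases mul_eq_zero.1 this with h | h
        · linarith
        · exact h
      rw [h5] at er
      have hs2 : √2 * √2 = 2 := Real.mul_self_sqrt (by norm_num)
      have hn1 : (n:ℝ) < 1 := by nlinarith
      have hn2 : (-1:ℝ) < n := by nlinarith
      have : n = 0 := by
        have a : n < 1 := by exact_mod_cast hn1
        have b : -1 < n := by exact_mod_cast hn2
        omega
      rw [this] at hX; simp at hX; rcases hX with h | h
      · exact om_ne h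
      · rw [h] at h0; simp at h0
    · exact h0 h

lemma qX_diff (u z : ℂ) (h1 : -(√2/4) ≤ z.im) (h2 : z.im ≤ √2/4) : DifferentiableAt ℂ (fun z => qX u (om * z)) z := by
  unfold qX
  refine DifferentiableAt.div (by fun_prop) ?_ (dsl_nz z h1 h2)
  exact (dsl_diff.comp (show Differentiable ℂ (fun z => om * z) by fun_prop)) z

lemma qX_bound (u : ℂ) : ∃ C : ℝ, ∀ z : ℂ, 1 ≤ |z.re| → -(√2/4) ≤ z.im → z.im ≤ √2/4 →
    ‖qX u (om * z)‖ ≤ C * rexp (-|z.re|) := by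
  set K : ℝ := 2 * π * ‖u‖ + 4 with hK
  refine ⟨2 * π * (2 * rexp (π * ‖u‖ + 1/2 + K^2 + 2)), ?_⟩
  intro z hz h1 h2
  have hs2 : √2 * √2 = 2 := Real.mul_self_sqrt (by norm_num)
  have hs : √2 ≤ 1.5 := by rw [Real.sqrt_le_left (by norm_num)]; norm_num
  have hs0 := Real.sqrt_nonneg 2
  set c : ℝ := -√2 * z.im with hc
  set v : ℝ := z.re - z.im with hv
  have hX : om * z = c + om * v := om_split z
  have hca : |c| ≤ 1/2 := by rw [abs_le]; constructor <;> nlinarith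
  have hi : |z.im| ≤ 1/2 := by rw [abs_le]; constructor <;> linarith
  have hvr : |z.re| ≤ |v| + 1/2 := by
    have : z.re = v + z.im := by rw [hv]; ring
    rw [this]; exact (abs_add_le _ _).trans (by linarith)
  have hv2 : 1/2 ≤ |v| := by linarith
  have hD := Dd_far c v hv2
  rw [hX]
  have hXn : ‖(c + om * v : ℂ)‖ ≤ 1/2 + |v| := by
    refine (norm_add_le _ _).trans ?_
    rw [norm_mul, om_norm, one_mul, Complex.norm_real, Complex.norm_real, Real.norm_eq_abs, Real.norm_eq_abs]; linarith
  have hX0 : (c + om * v : ℂ) ≠ 0 := by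
    intro h; rw [h, Dd_zero] at hD; norm_num at hD
  unfold qX
  rw [dsl_ne hX0, norm_div, norm_mul, norm_div, Complex.exp_add, norm_mul (Complex.exp _)]
  have n1 : ‖(2 * π * I * om : ℂ)‖ = 2 * π := by rw [norm_mul, om_norm]; simp [abs_of_pos Real.pi_pos]
  have n2 : ‖Complex.exp (u * (2 * π * I * (c + om * v)))‖ ≤ rexp (2 * π * ‖u‖ * (1/2 + |v|)) := by
    refine (Complex.norm_exp_le_exp_norm _).trans (Real.exp_le_exp.2 ?_)
    rw [norm_mul, norm_mul]
    have : ‖(2 * π * I : ℂ)‖ = 2 * π := by simp [abs_of_pos Real.pi_pos]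
    rw [this]
    calc ‖u‖ * (2 * π * ‖(c + om * v : ℂ)‖) = 2 * π * ‖u‖ * ‖(c + om * v : ℂ)‖ := by ring
      _ ≤ _ := mul_le_mul_of_nonneg_left hXn (by positivity)
  have n3 : ‖Complex.exp (-(π * I) * (c + om * v)^2)‖ ≤ rexp (-π * v^2 + 3 * |v|) := by
    rw [Complex.norm_exp, om_exp]
    apply Real.exp_le_exp.2
    have h3 : √2 * π ≤ 6 := by nlinarith [Real.pi_lt_four, Real.pi_pos]
    have h4 : c * v ≤ |v|/2 := by
      calc c * v ≤ |c * v| := le_abs_self _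
        _ = |c| * |v| := abs_mul _ _
        _ ≤ 1/2 * |v| := mul_le_mul_of_nonneg_right hca (abs_nonneg _)
        _ = _ := by ring
    have h5 : √2 * π * (c * v) ≤ √2 * π * (|v|/2) := mul_le_mul_of_nonneg_left h4 (by positivity)
    nlinarith [abs_nonneg v]
  have n4 : 1 / (‖Dd (c + om * v)‖ / ‖(c + om * v : ℂ)‖) ≤ 2 * rexp (1/2 + |v|) := by
    rw [one_div_div, div_le_iff₀ (by linarith)]
    have := Real.add_one_le_exp (1/2 + |v|)
    nlinarith [Real.exp_pos (1/2 + |v|)]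
  rw [n1, div_eq_mul_one_div]
  calc _ ≤ 2 * π * (rexp (2 * π * ‖u‖ * (1/2 + |v|)) * rexp (-π * v^2 + 3 * |v|)) * (2 * rexp (1/2 + |v|)) := by
        refine mul_le_mul (mul_le_mul_of_nonneg_left (mul_le_mul n2 n3 (norm_nonneg _) (Real.exp_pos _).le) (by positivity)) n4 (by positivity) (by positivity)
    _ = 2 * π * (2 * rexp (π * ‖u‖ + 1/2 + (-π * v^2 + K * |v|))) := by
        have e : rexp (π * ‖u‖ + 1/2 + (-π * v^2 + K * |v|)) = rexp (2 * π * ‖u‖ * (1/2 + |v|)) * rexp (-π * v^2 + 3 * |v|) * rexp (1/2 + |v|) := by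
          rw [← Real.exp_add, ← Real.exp_add]; congr 1; rw [hK]; ring
        rw [e]; ring
    _ ≤ 2 * π * (2 * rexp (π * ‖u‖ + 1/2 + K^2 + 2 - |z.re|)) := by
        have : -π * v^2 + K * |v| ≤ K^2 + 2 - |z.re| := by
          have := quad_dom K v
          have h6 : |v|^2 = v^2 := sq_abs v
          nlinarith [sq_nonneg (|v| - 1)]
        have := Real.exp_le_exp.2 (show π * ‖u‖ + 1/2 + (-π * v^2 + K * |v|) ≤ π * ‖u‖ + 1/2 + K^2 + 2 - |z.re| by linarith)
        have hp := Real.pi_pos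
        exact mul_le_mul_of_nonneg_left (by linarith) (by positivity)
    _ = _ := by rw [sub_eq_add_neg, Real.exp_add]; ring

lemma Ups_deriv (c : ℝ) (hc : c = 1/2 ∨ c = -1/2) (u : ℂ) :
    HasDerivAt (Ups c) (∫ x : ℝ, qX u (om * (x + ((-(c * (√2/2)) : ℝ):ℂ) * I))) u := by
  have h := (Ups_ExpInt c hc).hasDerivAt u
  have e : ∫ v : ℝ, Complex.exp (u * Ll c v) * (Ll c v * Gg c v) = ∫ x : ℝ, qX u (om * (x + ((-(c * (√2/2)) : ℝ):ℂ) * I)) := by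
    rw [← integral_add_right_eq_self _ (c * (√2/2))]
    congr 1; funext x
    have hX : om * (x + ((-(c * (√2/2)) : ℝ):ℂ) * I) = c + om * ((x + c * (√2/2) : ℝ):ℂ) := by
      have hr := rt_sq
      push_cast at hr ⊢
      unfold om; push_cast
      linear_combination (2 * c:ℂ) * hr - (c * (√2/2)^2 : ℂ) * I_sq
    rw [hX]
    have hne := Dd_line_ne c hc (x + c * (√2/2))
    set v := x + c * (√2/2)
    have hX0 : (c + om * v : ℂ) ≠ 0 := by
      intro h; rw [h, Dd_zero] at hne; exact hne rfl
    unfold qX Gg Ll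
    rw [dsl_ne hX0, Complex.exp_add]
    field_simp
  rw [e] at h
  exact h

lemma Ups_delta (u : ℂ) : Ups (1/2) u - Ups (-1/2) u = 1 := by
  have hd : ∀ u, HasDerivAt (fun u => Ups (1/2) u - Ups (-1/2) u) 0 u := by
    intro u
    have h1 := Ups_deriv (1/2) (Or.inl rfl) u
    have h2 := Ups_deriv (-1/2) (Or.inr rfl) u
    have h3 := h1.sub h2
    obtain ⟨C, hC⟩ := qX_bound u
    have hs0 := Real.sqrt_nonneg 2
    have := line_shift (fun z => qX u (om * z)) (-(√2/4)) (√2/4) C (by linarith) (qX_diff u) hC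
    rw [show -(1/2 * (√2/2)) = -(√2/4) by ring, show -(-1/2 * (√2/2)) = (√2/4) by ring, this, sub_self] at h3
    exact h3
  have hc := is_const_of_deriv_eq_zero (fun u => (hd u).differentiableAt) (fun u => (hd u).deriv) u (1/2)
  rw [hc, Ups_shift]
  have h := Ups_gauss (1/2)
  rw [show Complex.exp (-(2 * π * I * (1/2))) = -1 by
    rw [show -(2 * π * I * (1/2)) = -(π * I) by ring, Complex.exp_neg, Complex.exp_pi_mul_I]; norm_num]
  have h4 : om * Complex.exp (I * π * (1/2)^2) = -1 := by
    rw [show I * π * (1/2)^2 = ((π/4:ℝ):ℂ) * I by push_cast; ring, Complex.exp_mul_I, ← Complex.ofReal_cos, ← Complex.ofReal_sin,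
      Real.cos_pi_div_four, Real.sin_pi_div_four]
    unfold om
    have hr := rt_sq
    push_cast at hr ⊢
    linear_combination (-2) * hr + (√2/2:ℂ)^2 * I_sq
  rw [h4] at h
  linear_combination -h

lemma Ups_eq (u : ℂ) : Ups (1/2) u * (2 * Complex.cos (π * u)) = Complex.exp (π * I * u) - om * Complex.exp (I * π * u^2 - π * I * u) := by
  have h1 := Ups_delta u
  have h2 := Ups_shift u
  have h3 := Ups_gauss u
  rw [h2] at h1
  have h4 : Ups (1/2) u * (1 + Complex.exp (-(2*π*I*u))) = 1 - om * Complex.exp (-(2*π*I*u)) * Complex.exp (I * π * u^2) := by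
    linear_combination h1 - Complex.exp (-(2*π*I*u)) * h3
  have e1 : Complex.exp (π * I * u) * Complex.exp (-(2*π*I*u)) = Complex.exp (-(π * I * u)) := by
    rw [← Complex.exp_add]; congr 1; ring
  have e2 : Complex.exp (I * π * u^2 - π * I * u) = Complex.exp (-(π * I * u)) * Complex.exp (I * π * u^2) := by
    rw [← Complex.exp_add]; congr 1; ring
  have e3 : 2 * Complex.cos (π * u) = Complex.exp (π * I * u) + Complex.exp (-(π * I * u)) := by
    rw [Complex.two_cos]; congr 2 <;> ring
  rw [e2, e3]
  linear_combination Complex.exp (π * I * u) * h4 + (-Ups (1/2) u - om * Complex.exp (I * π * u^2)) * e1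

lemma exp_pi_quarter : Complex.exp (-(I * π / 4)) = -om := by
  rw [show -(I * π / 4) = ((-(π/4):ℝ):ℂ) * I by push_cast; ring, Complex.exp_mul_I, ← Complex.ofReal_cos, ← Complex.ofReal_sin,
      Real.cos_neg, Real.sin_neg, Real.cos_pi_div_four, Real.sin_pi_div_four]
  unfold om; push_cast; ring

lemma Ups_psi (Ψ : ℂ → ℂ) (h : IsPsi Ψ) (u : ℂ) :
    Ups (1/2) u = Complex.exp (-(I * π / 8) + π * I * u^2 / 2) * Ψ u := by
  have key : ∀ u : ℂ, Complex.cos (π * u) ≠ 0 → Ups (1/2) u = Complex.exp (-(I * π / 8) + π * I * u^2 / 2) * Ψ u := by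
    intro u hu
    rw [h.2 u hu, mul_div_assoc', eq_div_iff hu]
    have h1 := Ups_eq u
    have h2 : 2 * Complex.cos (π * (u^2/2 - u - 1/8)) = Complex.exp (π * (u^2/2 - u - 1/8) * I) + Complex.exp (-(π * (u^2/2 - u - 1/8)) * I) := Complex.two_cos _
    have e1 : Complex.exp (-(I * π / 8) + π * I * u^2 / 2) * Complex.exp (π * (u^2/2 - u - 1/8) * I) = -om * Complex.exp (I * π * u^2 - π * I * u) := by
      rw [← exp_pi_quarter, ← Complex.exp_add, ← Complex.exp_add]; congr 1; ring
    have e2 : Complex.exp (-(I * π / 8) + π * I * u^2 / 2) * Complex.exp (-(π * (u^2/2 - u - 1/8)) * I) = Complex.exp (π * I * u) := by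
      rw [← Complex.exp_add]; congr 1; ring
    linear_combination (1/2) * h1 - (1/2) * Complex.exp (-(I * π / 8) + π * I * u^2 / 2) * h2 - (1/2) * e1 - (1/2) * e2
  have c1 : Continuous (Ups (1/2)) := (Ups_ExpInt (1/2) (Or.inl rfl)).differentiable.continuous
  have c2 : Continuous (fun u => Complex.exp (-(I * π / 8) + π * I * u^2 / 2) * Ψ u) := by
    have := h.1.continuous
    fun_prop
  have hev := (ContinuousAt.eventuallyEq_nhds_iff_eventuallyEq_nhdsNE (x := u) c1.continuousAt c2.continuousAt).1 ?_
  · exact hev.self_of_nhds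
  · have han : AnalyticAt ℂ (fun u : ℂ => Complex.cos (π * u)) u := by
      have : Differentiable ℂ (fun u : ℂ => Complex.cos (π * u)) := by fun_prop
      exact this.analyticAt u
    rcases han.eventually_eq_zero_or_eventually_ne_zero with h0 | h0
    · exfalso
      have hall : AnalyticOnNhd ℂ (fun u : ℂ => Complex.cos (π * u)) Set.univ := by
        have : Differentiable ℂ (fun u : ℂ => Complex.cos (π * u)) := by fun_prop
        exact fun z _ => this.analyticAt z
      have := hall.eqOn_zero_of_preconnected_of_eventuallyEq_zero isPreconnected_univ (Set.mem_univ u) h0 (Set.mem_univ 0)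
      simp at this
    · filter_upwards [h0] with z hz
      exact key z hz

lemma ExpInt.affine {μ : Measure ℝ} {l g : ℝ → ℂ} (h : ExpInt μ l g) (p q s : ℂ) :
    ExpInt μ (fun x => p * l x + q) (fun x => Complex.exp (s * l x) * g x) := by
  have m1 : AEStronglyMeasurable (fun x => p * l x + q) μ := (h.1.const_mul p).add_const q
  have m2 : AEStronglyMeasurable (fun x => Complex.exp (s * l x) * g x) μ := (h.integrable s).1
  refine ⟨m1, m2, fun D => ?_⟩
  refine ((h.2.2 (|D| * ‖p‖ + ‖s‖)).const_mul (rexp (|D| * ‖q‖))).mono' ?_ ?_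
  · exact (Real.continuous_exp.comp_aestronglyMeasurable (m1.norm.const_mul D)).mul m2.norm
  · filter_upwards with x
    rw [norm_mul, norm_norm, Real.norm_of_nonneg (Real.exp_pos _).le, norm_mul]
    have h1 : rexp (D * ‖p * l x + q‖) ≤ rexp (|D| * ‖q‖) * rexp (|D| * ‖p‖ * ‖l x‖) := by
      rw [← Real.exp_add]; apply Real.exp_le_exp.2
      have : ‖p * l x + q‖ ≤ ‖p‖ * ‖l x‖ + ‖q‖ := (norm_add_le _ _).trans (by rw [norm_mul])
      calc D * ‖p * l x + q‖ ≤ |D| * ‖p * l x + q‖ := mul_le_mul_of_nonneg_right (le_abs_self D) (norm_nonneg _)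
        _ ≤ |D| * (‖p‖ * ‖l x‖ + ‖q‖) := mul_le_mul_of_nonneg_left this (abs_nonneg _)
        _ = _ := by ring
    have h2 : ‖Complex.exp (s * l x)‖ ≤ rexp (‖s‖ * ‖l x‖) := by
      refine (Complex.norm_exp_le_exp_norm _).trans ?_
      rw [norm_mul]
    calc _ ≤ (rexp (|D| * ‖q‖) * rexp (|D| * ‖p‖ * ‖l x‖)) * (rexp (‖s‖ * ‖l x‖) * ‖g x‖) :=
          mul_le_mul h1 (mul_le_mul_of_nonneg_right h2 (norm_nonneg _)) (by positivity) (by positivity)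
      _ = _ := by rw [add_mul, Real.exp_add]; ring

lemma gd_rec (c : ℂ) (n : ℕ) : iteratedDeriv (n+2) (fun z : ℂ => Complex.exp (c * z^2)) =
    fun z => 2 * c * (z * iteratedDeriv (n+1) (fun z : ℂ => Complex.exp (c * z^2)) z + (n+1) * iteratedDeriv n (fun z : ℂ => Complex.exp (c * z^2)) z) := by
  set G : ℂ → ℂ := fun z : ℂ => Complex.exp (c * z^2) with hG
  have hsm : ContDiff ℂ ⊤ G := by rw [hG]; fun_prop
  have hd : ∀ n : ℕ, Differentiable ℂ (iteratedDeriv n G) := fun n => hsm.differentiable_iteratedDeriv n (by exact_mod_cast WithTop.coe_lt_top _)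
  have hder : ∀ (n : ℕ) z, HasDerivAt (iteratedDeriv n G) (iteratedDeriv (n+1) G z) z := by
    intro n z; rw [iteratedDeriv_succ]; exact (hd n z).hasDerivAt
  have h1 : iteratedDeriv 1 G = fun z => 2 * c * (z * G z) := by
    rw [iteratedDeriv_one]; funext z
    have : HasDerivAt G (Complex.exp (c * z^2) * (c * (2 * z^(2-1) * 1))) z := by
      have := (((hasDerivAt_id z).pow 2).const_mul c).cexp
      simpa [hG] using this
    rw [this.deriv, hG]; simp; ring
  induction n with
  | zero =>
    rw [iteratedDeriv_succ, h1]; funext z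
    have h2 := ((hasDerivAt_id z).mul (hder 0 z)).const_mul (2 * c)
    simp only [iteratedDeriv_zero, id] at h2
    have h3 : HasDerivAt (fun z => 2 * c * (z * G z)) (2 * c * (1 * G z + z * iteratedDeriv (0+1) G z)) z := h2
    have h4 : iteratedDeriv (0+1) G z = 2 * c * (z * G z) := congrFun h1 z
    rw [h3.deriv, h4]
    simp only [iteratedDeriv_zero, Nat.cast_zero]; ring
  | succ n ih =>
    funext z
    have h2 := (((hasDerivAt_id z).mul (hder (n+1) z)).add ((hder n z).const_mul (n+1:ℂ))).const_mul (2 * c)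
    have h3 : HasDerivAt (fun z => 2 * c * (z * iteratedDeriv (n+1) G z + (n+1) * iteratedDeriv n G z))
       (2 * c * (1 * iteratedDeriv (n+1) G z + z * iteratedDeriv (n+1+1) G z + (n+1) * iteratedDeriv (n+1) G z)) z := h2
    have h4 : iteratedDeriv (n+1+2) G z = 2 * c * (1 * iteratedDeriv (n+1) G z + z * iteratedDeriv (n+1+1) G z + (n+1) * iteratedDeriv (n+1) G z) := by
      have h5 : iteratedDeriv (n+1+2) G z = deriv (iteratedDeriv (n+2) G) z := by rw [← iteratedDeriv_succ]
      rw [h5, congrArg deriv ih, h3.deriv]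
    rw [h4]
    push_cast; ring

lemma gd_even (c : ℂ) (r : ℕ) : iteratedDeriv (2*r) (fun z : ℂ => Complex.exp (c * z^2)) 0 = ((2*r).factorial / r.factorial : ℂ) * c^r := by
  induction r with
  | zero => simp
  | succ r ih =>
    rw [show 2 * (r+1) = 2*r + 2 by ring, gd_rec]
    beta_reduce
    rw [ih]
    rw [show (2*r+2).factorial = (2*r+2) * ((2*r+1) * (2*r).factorial) by rw [Nat.factorial_succ, Nat.factorial_succ], Nat.factorial_succ]
    have h1 : ((r:ℂ)+1) ≠ 0 := by exact_mod_cast Nat.succ_ne_zero r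
    have h2 : (r.factorial : ℂ) ≠ 0 := by exact_mod_cast r.factorial_ne_zero
    push_cast
    field_simp
    ring

lemma gd_odd (c : ℂ) (r : ℕ) : iteratedDeriv (2*r+1) (fun z : ℂ => Complex.exp (c * z^2)) 0 = 0 := by
  induction r with
  | zero =>
    rw [show 2 * 0 + 1 = 1 by ring, iteratedDeriv_one]
    have : HasDerivAt (fun z : ℂ => Complex.exp (c * z^2)) (Complex.exp (c * (0:ℂ)^2) * (c * (2 * (0:ℂ)^(2-1) * 1))) 0 := by
      have := (((hasDerivAt_id (0:ℂ)).pow 2).const_mul c).cexp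
      simpa using this
    rw [this.deriv]; simp
  | succ r ih =>
    rw [show 2 * (r+1) + 1 = (2*r+1) + 2 by ring, gd_rec]
    beta_reduce
    rw [ih]; simp

/-- inner coefficient sum in the statement -/
def ck (Ψ : ℂ → ℂ) (x : ℂ) (k : ℕ) : ℂ := ∑ r ∈ Finset.range (k/2 + 1),
                  (I ^ ((r:ℤ) - (k:ℤ)) * (Nat.factorial k : ℂ) /
                      ((Nat.factorial r : ℂ) * (Nat.factorial (k - 2*r) : ℂ))) *
                    (iteratedDeriv (k - 2*r) Ψ x /
                      ((4:ℂ)^r * ((((2*π) ^ ((k:ℝ)/2 - (r:ℝ)) : ℝ)) : ℂ)))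

lemma ck_deriv (Ψ : ℂ → ℂ) (h : Differentiable ℂ Ψ) (x : ℂ) (k : ℕ) :
    iteratedDeriv k (fun z => Complex.exp ((-I/4) * z^2) * Ψ (x + (1/(I * ((√(2*π):ℝ):ℂ))) * z)) 0 = ck Ψ x k := by
  set b : ℂ := 1/(I * ((√(2*π):ℝ):ℂ)) with hb
  have hΨ : ∀ j : ℕ, ContDiff ℂ j Ψ := fun j => h.contDiff
  have e : (fun z => Complex.exp ((-I/4) * z^2) * Ψ (x + b * z)) = (fun z => Complex.exp ((-I/4) * z^2)) * (fun z => Ψ (x + b * z)) := rfl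
  have hc2 : ContDiff ℂ k (fun z => Ψ (x + b * z)) := (hΨ k).comp (by fun_prop)
  rw [e, iteratedDeriv_mul (ContDiff.contDiffAt (by fun_prop)) hc2.contDiffAt]
  have hd : ∀ j, iteratedDeriv j (fun z => Ψ (x + b * z)) 0 = b^j * iteratedDeriv j Ψ x := by
    intro j
    have h1 := iteratedDeriv_comp_const_mul (n := j) (f := fun w => Ψ (x + w)) ((hΨ j).comp (by fun_prop)) b
    rw [h1, iteratedDeriv_comp_const_add]; simp
  unfold ck
  symm
  refine Finset.sum_of_injOn (fun r => 2 * r) (fun a _ b _ h => by simpa using h) ?_ ?_ ?_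
  · intro r hr; simp at hr ⊢; omega
  · intro i hi hni
    rcases Nat.even_or_odd' i with ⟨r, rfl | rfl⟩
    · exfalso; apply hni; refine ⟨r, ?_, rfl⟩; simp at hi ⊢; omega
    · rw [gd_odd]; simp
  · intro r hr
    have hrk : 2 * r ≤ k := by simp at hr; omega
    rw [gd_even, hd]
    have hch : ((k.choose (2*r) : ℕ):ℂ) = (k.factorial : ℂ) / ((2*r).factorial * (k - 2*r).factorial) := by
      rw [Nat.cast_choose ℂ hrk]
    rw [hch]
    have f1 : ((2*r).factorial : ℂ) ≠ 0 := by exact_mod_cast Nat.factorial_ne_zero _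
    have f2 : ((k-2*r).factorial : ℂ) ≠ 0 := by exact_mod_cast Nat.factorial_ne_zero _
    have f3 : (r.factorial : ℂ) ≠ 0 := by exact_mod_cast Nat.factorial_ne_zero _
    have hp : (((2*π) ^ ((k:ℝ)/2 - (r:ℝ)) : ℝ) : ℂ) = ((√(2*π):ℝ):ℂ)^(k - 2*r) := by
      rw [← Complex.ofReal_pow]; congr 1
      rw [Real.sqrt_eq_rpow, ← Real.rpow_natCast, ← Real.rpow_mul (by positivity)]
      congr 1; rw [Nat.cast_sub hrk]; push_cast; ring
    have hs0 : ((√(2*π):ℝ):ℂ) ≠ 0 := by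
      have : √(2*π) ≠ 0 := (Real.sqrt_pos.2 (by positivity)).ne'
      exact_mod_cast this
    have hI : I ^ ((r:ℤ) - (k:ℤ)) = (-I)^r * (1/I)^(k-2*r) := by
      have : (-I) = I⁻¹ := by simp
      rw [this, one_div, inv_pow, inv_pow, ← zpow_natCast I r, ← zpow_natCast I (k - 2*r), ← zpow_neg, ← zpow_neg, ← zpow_add₀ I_ne_zero]
      have h4 : I ^ ((r:ℤ) - k) = I ^ ((r:ℤ) - k) := rfl
      congr 1; rw [Nat.cast_sub hrk]; push_cast; ring
    rw [hI, hp, hb, div_pow (-I) 4, div_pow 1 (I * _), div_pow 1 I, one_pow, mul_pow]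
    field_simp

lemma Ik_eval (Ψ : ℂ → ℂ) (h : IsPsi Ψ) (a : ℂ) (k : ℕ) :
    ∫ v : ℝ, (((√(2*π):ℝ):ℂ) * ((1/2 + om * v) - a))^k * (Complex.exp (2 * a * Ll (1/2) v) * Gg (1/2) v) =
      Complex.exp (2 * π * I * a^2 - I * π / 8) * ck Ψ (2 * a) k := by
  have hs0 : ((√(2*π):ℝ):ℂ) ≠ 0 := by
    have : √(2*π) ≠ 0 := (Real.sqrt_pos.2 (by positivity)).ne'
    exact_mod_cast this
  have hs2 : ((√(2*π):ℝ):ℂ)^2 = 2 * π := by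
    rw [← Complex.ofReal_pow, Real.sq_sqrt (by positivity)]; push_cast; ring
  set r : ℂ := ((√(2*π):ℝ):ℂ) with hr
  have hpi : (π:ℂ) ≠ 0 := by exact_mod_cast Real.pi_ne_zero
  have hE := (Ups_ExpInt (1/2) (Or.inl rfl)).affine (1/(I*r)) (-(r*a)) (2*a)
  have hl : ∀ v : ℝ, 1/(I*r) * Ll (1/2) v + -(r*a) = r * ((1/2 + om * v) - a) := by
    intro v; unfold Ll
    rw [← sub_eq_zero]; field_simp [I_ne_zero]; push_cast; linear_combination (-(1 + om * v * 2)) * hs2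
  have h1 := congrFun (hE.iteratedDeriv k) 0
  simp only [zero_mul, Complex.exp_zero, one_mul, hl] at h1
  rw [← h1, ← ck_deriv Ψ h.1, ← iteratedDeriv_const_mul_field]
  congr 1; funext z
  have h2 : ∀ v : ℝ, Complex.exp (z * (r * ((1/2 + om * v) - a))) * (Complex.exp (2 * a * Ll (1/2) v) * Gg (1/2) v)
     = Complex.exp (-(z * (r * a))) * (Complex.exp ((2 * a + 1/(I*r) * z) * Ll (1/2) v) * Gg (1/2) v) := by
    intro v
    rw [← hl, ← mul_assoc, ← Complex.exp_add, ← mul_assoc, ← Complex.exp_add]; congr 2; ring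
  simp only [h2]
  rw [integral_const_mul]
  change Complex.exp (-(z * (r * a))) * Ups (1/2) (2 * a + 1/(I*r) * z) = _
  rw [Ups_psi Ψ h, ← mul_assoc (cexp _), ← mul_assoc (cexp _), ← Complex.exp_add, ← Complex.exp_add]
  congr 2
  have hI : (1/(I*r)) * (1/(I*r)) = -(1/(2*π)) := by
    rw [← hs2]; field_simp; rw [I_sq]; ring
  have h3 : π * I * (1/(I*r)) = r/2 := by field_simp; rw [hs2]; ring
  have h4 : (π:ℂ) * (1/(2*π)) = 1/2 := by field_simp
  linear_combination 2 * a * z * h3 + (π * I * z^2/2) * hI - I*z^2/2 * h4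

lemma psi_unique (Ψ : ℂ → ℂ) (h : IsPsi Ψ) : Ψ = fun u => Complex.exp (I * π / 8 - π * I * u^2 / 2) * Ups (1/2) u := by
  funext u
  rw [Ups_psi Ψ h, ← mul_assoc, ← Complex.exp_add, show I * π / 8 - π * I * u^2 / 2 + (-(I * π / 8) + π * I * u^2 / 2) = 0 by ring]
  simp

/-- uniform bound on the coefficients -/
lemma ck_bound (k : ℕ) : ∃ C : ℝ, 0 ≤ C ∧ ∀ Ψ, IsPsi Ψ → ∀ a : ℝ, 0 ≤ a → a ≤ 1 → ‖ck Ψ (2 * a) k‖ ≤ C := by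
  by_cases hex : ∃ Ψ, IsPsi Ψ
  · obtain ⟨Ψ, h⟩ := hex
    have hc : Continuous (fun a : ℝ => ck Ψ (2 * a) k) := by
      unfold ck
      have hd : ∀ j, Continuous (iteratedDeriv j Ψ) := fun j => (h.1.contDiff (n := ⊤)).continuous_iteratedDeriv j (by exact_mod_cast le_top)
      refine continuous_finsetSum _ fun r _ => ?_
      refine continuous_const.mul (Continuous.div_const ((hd _).comp (by fun_prop)) _)
    obtain ⟨C, hC⟩ := (isCompact_Icc (a := (0:ℝ)) (b := 1)).exists_bound_of_continuousOn hc.continuousOn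
    refine ⟨max C 0, le_max_right _ _, fun Ψ' h' a h0 h1 => ?_⟩
    rw [psi_unique Ψ' h', ← psi_unique Ψ h]
    exact (hC a ⟨h0, h1⟩).trans (le_max_left _ _)
  · exact ⟨0, le_rfl, fun Ψ h => (hex ⟨Ψ, h⟩).elim⟩

lemma seg_int (F G : ℂ → ℂ) (c : ℂ) (r : ℝ) (hG : ∀ z ∈ Metric.ball c r, HasDerivAt G (F z) z)
    (hF : ContinuousOn F (Metric.ball c r)) (p q : ℂ) (a b : ℝ)
    (ha : p + q * a ∈ Metric.ball c r) (hb : p + q * b ∈ Metric.ball c r) :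
    ∫ v in a..b, q * F (p + q * (v:ℝ)) = G (p + q * b) - G (p + q * a) := by
  have hmem : ∀ v ∈ Set.uIcc a b, p + q * (v:ℝ) ∈ Metric.ball c r := by
    intro v hv
    rw [← segment_eq_uIcc] at hv
    obtain ⟨x, y, hx, hy, hxy, rfl⟩ := hv
    have := (convex_ball c r) ha hb hx hy hxy
    have e2 : p + q * ((x • a + y • b : ℝ):ℂ) = x • (p + q * a) + y • (p + q * b) := ?_
    · rw [e2]; exact this
    simp only [Complex.real_smul, smul_eq_mul]
    have e : (x:ℂ) + y = 1 := by exact_mod_cast hxy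
    push_cast; linear_combination (-p) * e
  have := intervalIntegral.integral_eq_sub_of_hasDerivAt (f := fun v : ℝ => G (p + q * (v:ℝ))) (f' := fun v : ℝ => q * F (p + q * (v:ℝ))) (a := a) (b := b) ?_ ?_
  · exact this
  · intro v hv
    have h1 : HasDerivAt (fun v : ℝ => p + q * (v:ℂ)) q v := by
      simpa using ((Complex.ofRealCLM.hasDerivAt (x := v)).const_mul q).const_add p
    have := (hG _ (hmem v hv)).comp v h1
    exact this.congr_deriv (mul_comm _ _)
  · refine ContinuousOn.intervalIntegrable (continuousOn_const.mul (hF.comp (by fun_prop) hmem))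

lemma ball_Ff_diff (m : ℕ) (s : ℂ) (h x : ℝ) (hx : |x| = h) (hh : h = (m+1/2)/32) (hm : 1 ≤ m) :
    DifferentiableOn ℂ (Ff m s) (Metric.ball ((x:ℂ) - I * ((m:ℂ) + 1/2)) (√(h^2+1/4))) := by
  intro z hz
  have hm' : (1:ℝ) ≤ m := by exact_mod_cast hm
  rw [Metric.mem_ball, dist_eq_norm] at hz
  have hz2 : (z.re - x)^2 + (z.im + (m + 1/2))^2 < h^2 + 1/4 := by
    have h1 : ‖z - ((x:ℂ) - I * ((m:ℂ) + 1/2))‖^2 < h^2+1/4 := by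
      rw [← Real.sq_sqrt (show 0 ≤ h^2+1/4 by positivity)]
      exact pow_lt_pow_left₀ hz (norm_nonneg _) two_ne_zero
    rw [← Complex.normSq_eq_norm_sq, Complex.normSq_apply] at h1
    simp at h1; nlinarith
  have him : z.im < 0 := by
    by_contra hc; push Not at hc
    have : (m + 1/2:ℝ)^2 ≤ (z.im + (m+1/2))^2 := pow_le_pow_left₀ (by positivity) (by linarith) 2
    rw [hh] at hz2
    nlinarith [sq_nonneg (z.re - x)]
  have hE : Ef z ≠ 0 := by
    intro h0
    obtain ⟨n, rfl⟩ := (Ef_zero_iff z).1 h0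
    simp at hz2
    have h1 : x^2 = h^2 := by rw [← hx, sq_abs]
    have h2 : ((n:ℝ) + (m+1/2))^2 < 1/4 := by simp only [one_div]; linarith
    have h3 : ((n:ℝ) + m) * (n + m + 1) < 0 := by nlinarith
    have h4 : (n + m) * (n + m + 1) < (0:ℤ) := by exact_mod_cast h3
    rcases le_or_gt 0 (n + (m:ℤ)) with h5 | h5 <;> nlinarith
  exact ((gf_diff m s z him.ne).div Ef_diff.differentiableAt hE).differentiableWithinAt

/-- the point on the diagonal line -/
def zd (m : ℕ) (v : ℝ) : ℂ := -I * (((m:ℂ) + 1/2) + om * v)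

lemma zd_eq (m : ℕ) (v : ℝ) : zd m v = -I * ((m:ℂ)+1/2) + (-I * om) * v := by unfold zd; ring

lemma Iom (h : ℝ) : (-I * om) * ((√2 * h : ℝ):ℂ) = h * (1 + I) := by
  unfold om
  have h2 : ((√2:ℝ):ℂ)^2 = 2 := by rw [← Complex.ofReal_pow, Real.sq_sqrt (by norm_num)]; norm_num
  push_cast; linear_combination (h * (I - I^2)/2) * h2 - h * I_sq

lemma diag_left (m : ℕ) (s : ℂ) (h : ℝ) (hh : h = (m+1/2)/32) (hm : 1 ≤ m) :
    ∫ x in (-h)..0, Ff m s ((x:ℝ) + (-((m:ℝ)+1/2):ℝ) * I) =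
      -(I * ∫ y in (-((m:ℝ)+1/2+h))..(-((m:ℝ)+1/2)), Ff m s ((-h:ℝ) + (y:ℝ) * I))
      + ∫ v in (-(√2*h))..0, (-I * om) * Ff m s (zd m v) := by
  have hh0 : 0 < h := by rw [hh]; positivity
  have hd := ball_Ff_diff m s h (-h) (by rw [abs_neg, abs_of_pos hh0]) hh hm
  obtain ⟨G, hG⟩ := hd.isExactOn_ball
  have hr : h < √(h^2+1/4) := by
    rw [Real.lt_sqrt hh0.le]; linarith
  set c : ℂ := ((-h:ℝ):ℂ) - I * ((m:ℂ) + 1/2) with hc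
  have mem : ∀ z : ℂ, ‖z - c‖ ≤ h → z ∈ Metric.ball c (√(h^2+1/4)) := by
    intro z hz; rw [Metric.mem_ball, dist_eq_norm]; linarith
  have m1 : c ∈ Metric.ball c (√(h^2+1/4)) := mem _ (by simp [hh0.le])
  have m2 : -I * ((m:ℂ) + 1/2) ∈ Metric.ball c (√(h^2+1/4)) := mem _ (by
    rw [hc, show -I * ((m:ℂ) + 1/2) - (((-h:ℝ):ℂ) - I * ((m:ℂ) + 1/2)) = (h:ℂ) by push_cast; ring]
    rw [Complex.norm_real, Real.norm_of_nonneg hh0.le])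
  have m3 : c - h * I ∈ Metric.ball c (√(h^2+1/4)) := mem _ (by
    rw [show c - h * I - c = -(h * I) by ring, norm_neg, norm_mul, Complex.norm_I, mul_one, Complex.norm_real, Real.norm_of_nonneg hh0.le])
  have s1 := seg_int _ G c _ hG hd.continuousOn (-I * ((m:ℂ) + 1/2)) 1 (-h) 0 (by convert m1 using 1; rw [hc]; push_cast; ring) (by convert m2 using 1; simp)
  have s2 := seg_int _ G c _ hG hd.continuousOn ((-h:ℝ):ℂ) I (-((m:ℝ)+1/2+h)) (-((m:ℝ)+1/2)) (by convert m3 using 1; rw [hc]; push_cast; ring) (by convert m1 using 1; rw [hc]; push_cast; ring)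
  have hI := Iom (-h)
  have s3 := seg_int _ G c _ hG hd.continuousOn (-I * ((m:ℂ) + 1/2)) (-I * om) (√2*(-h)) 0 (by rw [hI]; convert m3 using 1; rw [hc]; push_cast; ring) (by convert m2 using 1; simp)
  rw [hI] at s3
  simp only [← zd_eq] at s3
  rw [show √2 * -h = -(√2*h) by ring] at s3
  rw [s3]
  rw [intervalIntegral.integral_const_mul] at s2
  have e2 : ∀ y : ℝ, Ff m s (((-h:ℝ):ℂ) + I * y) = Ff m s ((-h:ℝ) + (y:ℝ) * I) := fun y => by rw [mul_comm I]
  simp only [e2] at s2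
  rw [s2]
  have e1 : ∀ x : ℝ, (1:ℂ) * Ff m s (-I * ((m:ℂ) + 1/2) + 1 * x) = Ff m s ((x:ℝ) + (-((m:ℝ)+1/2):ℝ) * I) := by
    intro x; rw [one_mul]; congr 1; push_cast; ring
  simp only [e1] at s1
  rw [s1]
  have g1 : (-I * ((m:ℂ) + 1/2) + 1 * ((-h:ℝ):ℂ)) = ((-h:ℝ):ℂ) + I * ((-((m:ℝ)+1/2):ℝ):ℂ) := by push_cast; ring
  have g2 : -I * ((m:ℂ) + 1/2) + ((-h:ℝ):ℂ) * (1 + I) = ((-h:ℝ):ℂ) + I * ((-((m:ℝ)+1/2+h):ℝ):ℂ) := by push_cast; ring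
  rw [g1, g2]; simp [zd]

lemma diag_right (m : ℕ) (s : ℂ) (h : ℝ) (hh : h = (m+1/2)/32) (hm : 1 ≤ m) :
    (∫ x in (0:ℝ)..h, Ff m s ((x:ℝ) + (-((m:ℝ)+1/2):ℝ) * I))
      + I * (∫ y in (-((m:ℝ)+1/2))..(-((m:ℝ)+1/2-h)), Ff m s (h + (y:ℝ) * I)) =
      ∫ v in (0:ℝ)..(√2*h), (-I * om) * Ff m s (zd m v) := by
  have hh0 : 0 < h := by rw [hh]; positivity
  have hd := ball_Ff_diff m s h h (by rw [abs_of_pos hh0]) hh hm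
  obtain ⟨G, hG⟩ := hd.isExactOn_ball
  have hr : h < √(h^2+1/4) := by
    rw [Real.lt_sqrt hh0.le]; linarith
  set c : ℂ := (h:ℂ) - I * ((m:ℂ) + 1/2) with hc
  have mem : ∀ z : ℂ, ‖z - c‖ ≤ h → z ∈ Metric.ball c (√(h^2+1/4)) := by
    intro z hz; rw [Metric.mem_ball, dist_eq_norm]; linarith
  have m1 : c ∈ Metric.ball c (√(h^2+1/4)) := mem _ (by simp [hh0.le])
  have m2 : -I * ((m:ℂ) + 1/2) ∈ Metric.ball c (√(h^2+1/4)) := mem _ (by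
    rw [hc, show -I * ((m:ℂ) + 1/2) - ((h:ℂ) - I * ((m:ℂ) + 1/2)) = -(h:ℂ) by ring]
    rw [norm_neg, Complex.norm_real, Real.norm_of_nonneg hh0.le])
  have m3 : c + h * I ∈ Metric.ball c (√(h^2+1/4)) := mem _ (by
    rw [show c + h * I - c = (h * I) by ring, norm_mul, Complex.norm_I, mul_one, Complex.norm_real, Real.norm_of_nonneg hh0.le])
  have s1 := seg_int _ G c _ hG hd.continuousOn (-I * ((m:ℂ) + 1/2)) 1 0 h (by convert m2 using 1; simp) (by convert m1 using 1; rw [hc]; push_cast; ring)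
  have s2 := seg_int _ G c _ hG hd.continuousOn (h:ℂ) I (-((m:ℝ)+1/2)) (-((m:ℝ)+1/2-h)) (by convert m1 using 1; rw [hc]; push_cast; ring) (by convert m3 using 1; rw [hc]; push_cast; ring)
  have hI := Iom h
  have s3 := seg_int _ G c _ hG hd.continuousOn (-I * ((m:ℂ) + 1/2)) (-I * om) 0 (√2*h) (by convert m2 using 1; simp) (by rw [hI]; convert m3 using 1; rw [hc]; push_cast; ring)
  rw [hI] at s3
  simp only [← zd_eq] at s3
  rw [s3]
  rw [intervalIntegral.integral_const_mul] at s2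
  have e2 : ∀ y : ℝ, Ff m s ((h:ℂ) + I * y) = Ff m s (h + (y:ℝ) * I) := fun y => by rw [mul_comm I]
  simp only [e2] at s2
  rw [s2]
  have e1 : ∀ x : ℝ, (1:ℂ) * Ff m s (-I * ((m:ℂ) + 1/2) + 1 * x) = Ff m s ((x:ℝ) + (-((m:ℝ)+1/2):ℝ) * I) := by
    intro x; rw [one_mul]; congr 1; push_cast; ring
  simp only [e1] at s1
  rw [s1]
  have g1 : (-I * ((m:ℂ) + 1/2) + 1 * (h:ℂ)) = (h:ℂ) + I * ((-((m:ℝ)+1/2):ℝ):ℂ) := by push_cast; ring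
  have g2 : -I * ((m:ℂ) + 1/2) + (h:ℂ) * (1 + I) = (h:ℂ) + I * ((-((m:ℝ)+1/2-h):ℝ):ℂ) := by push_cast; ring
  rw [g1, g2]; simp [zd]

lemma Ff_hline_cont (m : ℕ) (s : ℂ) (c : ℝ) (n : ℤ) (hc : c = n + 1/2) : Continuous (fun x : ℝ => Ff m s ((x:ℝ) + (c:ℝ) * I)) := by
  have hc0 : c ≠ 0 := by
    intro h; rw [h] at hc
    have h1 : (2 * n + 1 : ℝ) = 0 := by linarith
    have h2 : 2 * n + 1 = 0 := by exact_mod_cast h1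
    omega
  rw [continuous_iff_continuousAt]; intro x
  have h1 : DifferentiableAt ℂ (Ff m s) ((x:ℝ) + (c:ℝ) * I) :=
    (gf_diff m s _ (by simpa using hc0)).div Ef_diff.differentiableAt (Ef_ne_of_half x n c hc)
  exact ContinuousAt.comp (f := fun x : ℝ => ((x:ℝ):ℂ) + (c:ℝ) * I) h1.continuousAt (by fun_prop)

lemma Ff_hline_int (m : ℕ) (s : ℂ) (c b : ℝ) (n : ℤ) (hc : c = n + 1/2) :
    IntegrableOn (fun x : ℝ => Ff m s ((x:ℝ) + (c:ℝ) * I)) (Set.Iic b) := by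
  obtain ⟨C, _, h⟩ := Ff_bound m s |c|
  refine int_Iic _ b C (Ff_hline_cont m s c n hc).continuousOn fun x hx => ?_
  have := h (x + c * I) (by simpa using hx) (by simp)
  simpa using this

lemma zd_cont (m : ℕ) : Continuous (zd m) := by unfold zd; fun_prop

lemma zd_Ef (m : ℕ) (v : ℝ) : Ef (zd m v) = Dd (((1/2:ℝ):ℂ) + om * v) := by
  unfold Ef Dd zd
  rw [show -(2 * π * (-I * (((m:ℂ) + 1/2) + om * v))) = 2 * π * I * (((1/2:ℝ):ℂ) + om * v) + m * (2 * π * I) by push_cast; ring]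
  rw [Complex.exp_periodic.nat_mul m]

lemma diag_cont (m : ℕ) (s : ℂ) (h : ℝ) (hh : h = (m+1/2)/32) : ContinuousOn (fun v : ℝ => Ff m s (zd m v)) (Set.Icc (-(√2*h)) (√2*h)) := by
  intro v hv
  refine ContinuousAt.continuousWithinAt ?_
  have him : (zd m v).im ≠ 0 := by
    have e : (zd m v).im = -((m+1/2) - √2/2 * v) := by
      unfold zd; simp [om_re]; ring
    rw [e]
    have h2 : √2/2 * v ≤ h := by
      have := mul_le_mul_of_nonneg_left hv.2 (show 0 ≤ √2/2 by positivity)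
      have h2 : √2 * √2 = 2 := Real.mul_self_sqrt (by norm_num)
      nlinarith
    have : (0:ℝ) ≤ m := by positivity
    have : 0 < (m+1/2) - √2/2 * v := by rw [hh] at h2; linarith
    linarith
  have hE : Ef (zd m v) ≠ 0 := by
    rw [zd_Ef]; intro h0
    have := Dd_line_low (1/2) (Or.inl rfl) v
    rw [h0] at this; norm_num at this
  have h1 : DifferentiableAt ℂ (Ff m s) (zd m v) :=
    (gf_diff m s _ him).div Ef_diff.differentiableAt hE
  exact ContinuousAt.comp (f := zd m) h1.continuousAt (zd_cont m).continuousAt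

lemma Lf_decomp (m : ℕ) (s : ℂ) (h : ℝ) (hh : h = (m+1/2)/32) (hm : 1 ≤ m) :
    Lf m m h s - (∫ v in (-(√2*h))..(√2*h), (-I * om) * Ff m s (zd m v)) =
      (∫ x in Set.Iic (-h), Ff m s ((x:ℝ) + (-((m:ℝ)+1/2):ℝ) * I))
      - I * (∫ y in (-((m:ℝ)+1/2+h))..(-((m:ℝ)+1/2)), Ff m s ((-h:ℝ) + (y:ℝ) * I))
      + I * (∫ y in (-((m:ℝ)+1/2-h))..((m:ℝ)+1/2), Ff m s (h + (y:ℝ) * I))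
      - (∫ x in Set.Iic h, Ff m s ((x:ℝ) + ((m:ℝ) + 1/2 : ℝ) * I)) := by
  have hh0 : 0 < h := by rw [hh]; positivity
  have h1 := diag_left m s h hh hm
  have h2 := diag_right m s h hh hm
  have hb := Ff_hline_int m s (-((m:ℝ)+1/2)) h (-(m+1:ℤ)) (by push_cast; ring)
  have hs0 : (0:ℝ) ≤ √2 * h := by positivity
  have hdc := (continuousOn_const (c := -I * om)).mul (diag_cont m s h hh)
  have i1 : IntervalIntegrable (fun v : ℝ => (-I * om) * Ff m s (zd m v)) volume (-(√2*h)) 0 := by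
    apply ContinuousOn.intervalIntegrable; rw [Set.uIcc_of_le (by linarith)]
    exact hdc.mono (Set.Icc_subset_Icc_right hs0)
  have i2 : IntervalIntegrable (fun v : ℝ => (-I * om) * Ff m s (zd m v)) volume 0 (√2*h) := by
    apply ContinuousOn.intervalIntegrable; rw [Set.uIcc_of_le hs0]
    exact hdc.mono (Set.Icc_subset_Icc_left (by linarith))
  have h3 := intervalIntegral.integral_add_adjacent_intervals i1 i2
  have hc := Ff_hline_cont m s (-((m:ℝ)+1/2)) (-(m+1:ℤ)) (by push_cast; ring)
  have h4 := intervalIntegral.integral_add_adjacent_intervals (hc.intervalIntegrable (μ := volume) (-h) 0) (hc.intervalIntegrable 0 h)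
  have h5 := intervalIntegral.integral_Iic_sub_Iic (hb.mono_set (Set.Iic_subset_Iic.2 (show -h ≤ h by linarith))) hb
  have hi : ∀ c d : ℝ, IntervalIntegrable (fun y : ℝ => Ff m s (h + (y:ℝ) * I)) volume c d :=
    fun c d => (Ff_side_cont m s h hh0).intervalIntegrable _ _
  have h6 := intervalIntegral.integral_add_adjacent_intervals (hi (-((m:ℝ)+1/2)) (-((m:ℝ)+1/2-h))) (hi _ ((m:ℝ)+1/2))
  unfold Lf
  linear_combination -h6 * I + h3 + h5 - h4 + h1 + h2

lemma arctan_poly (v : ℝ) (hv : 0 ≤ v) : Real.arctan v ≤ v - v^3/3 + v^5/5 := by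
  have hd : ∀ x : ℝ, HasDerivAt (fun x : ℝ => x - x^3/3 + x^5/5 - Real.arctan x) (x^6/(1+x^2)) x := by
    intro x
    have h := ((((hasDerivAt_id x).sub (((hasDerivAt_id x).pow 3).div_const 3)).add (((hasDerivAt_id x).pow 5).div_const 5)).sub (Real.hasDerivAt_arctan x))
    refine h.congr_deriv ?_
    have : (1 + x^2) ≠ 0 := by positivity
    simp; field_simp; ring
  have hm : Monotone (fun x : ℝ => x - x^3/3 + x^5/5 - Real.arctan x) :=
    monotone_of_deriv_nonneg (fun x => (hd x).differentiableAt) (fun x => by rw [(hd x).deriv]; positivity)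
  have := hm hv
  simp at this; linarith

lemma arctan_up (v : ℝ) (hv : 1/32 ≤ v) : Real.arctan v ≤ (1 - 1/4000) * v := by
  have hd : ∀ x : ℝ, HasDerivAt (fun x : ℝ => (1 - 1/4000) * x - Real.arctan x) ((1-1/4000) - 1/(1+x^2)) x := by
    intro x
    have h := ((hasDerivAt_id x).const_mul (1 - 1/4000 : ℝ)).sub (Real.hasDerivAt_arctan x)
    refine h.congr_deriv ?_
    ring
  have hm : MonotoneOn (fun x : ℝ => (1 - 1/4000) * x - Real.arctan x) (Set.Ici (1/32)) := by
    refine monotoneOn_of_deriv_nonneg (convex_Ici _) (fun x _ => (hd x).continuousAt.continuousWithinAt) (fun x _ => (hd x).differentiableAt.differentiableWithinAt) ?_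
    intro x hx
    rw [interior_Ici, Set.mem_Ioi] at hx
    rw [(hd x).deriv, sub_nonneg, div_le_iff₀ (by positivity)]
    nlinarith
  have h1 := hm (Set.mem_Ici.2 le_rfl) (Set.mem_Ici.2 hv) hv
  have h2 := arctan_poly (1/32) (by norm_num)
  norm_num at h1 h2 ⊢
  linarith

lemma arctan_lo (v : ℝ) (hv : 1/31 ≤ v) : 31/962 ≤ Real.arctan v := by
  have hd : ∀ x : ℝ, HasDerivAt (fun x : ℝ => Real.arctan x - x + x^3/3) (x^4/(1+x^2)) x := by
    intro x
    have h := ((Real.hasDerivAt_arctan x).sub (hasDerivAt_id x)).add (((hasDerivAt_id x).pow 3).div_const 3)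
    refine h.congr_deriv ?_
    have : (1 + x^2) ≠ 0 := by positivity
    simp; field_simp; ring
  have hm : Monotone (fun x : ℝ => Real.arctan x - x + x^3/3) :=
    monotone_of_deriv_nonneg (fun x => (hd x).differentiableAt) (fun x => by rw [(hd x).deriv]; positivity)
  have h1 := hm (show (0:ℝ) ≤ 1/31 by norm_num)
  have h2 : Real.arctan (1/31) ≤ Real.arctan v := Real.arctan_strictMono.monotone hv
  norm_num at h1 ⊢
  linarith

lemma arg_low (z : ℂ) (hz : z.im < 0) : z.arg = Real.arctan (z.re / (-z.im)) - π/2 := by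
  have h0 : z ≠ 0 := by rintro rfl; simp at hz
  have h1 := congrArg Complex.im (log_dn z h0 hz.le (Or.inl hz))
  simp [Complex.log_im] at h1
  have h2 : 0 < (z * I).re := by simpa using hz
  have h3 := Complex.abs_arg_lt_pi_div_two_iff.2 (Or.inl h2)
  have h4 := Complex.tan_arg (z * I)
  have h5 : (z * I).arg = Real.arctan (z.re / (-z.im)) := by
    rw [← Real.arctan_tan (abs_lt.1 h3).1 (abs_lt.1 h3).2, h4]; simp
  rw [h1, h5]

lemma Ff_norm_le (B : ℝ) : ∃ D : ℝ, 0 ≤ D ∧ ∀ (m : ℕ) (s z : ℂ), s.re ≤ B → 1 ≤ ‖z‖ →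
    ‖Ff m s z‖ ≤ D * rexp (‖z‖ - s.im * z.arg + 2 * π * m * z.re) * ‖(Ef z)⁻¹‖ := by
  refine ⟨(Nat.factorial ⌈|B|⌉₊), by positivity, fun m s z hB hz => ?_⟩
  have hz0 : z ≠ 0 := by rintro rfl; simp at hz; linarith
  have h1 : ‖z‖ ^ (s.re - 1) ≤ (Nat.factorial ⌈|B|⌉₊) * rexp ‖z‖ := by
    calc ‖z‖ ^ (s.re - 1) ≤ ‖z‖ ^ ((⌈|B|⌉₊ : ℕ):ℝ) :=
          Real.rpow_le_rpow_of_exponent_le hz (by linarith [le_abs_self B, Nat.le_ceil |B|])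
      _ = ‖z‖ ^ ⌈|B|⌉₊ := Real.rpow_natCast _ _
      _ ≤ _ := by
        have := Real.pow_div_factorial_le_exp ‖z‖ (norm_nonneg _) ⌈|B|⌉₊
        rwa [div_le_iff₀ (by positivity), mul_comm] at this
  unfold Ff gf
  rw [div_eq_mul_inv, norm_mul, norm_mul, Complex.norm_cpow_of_ne_zero hz0, Complex.norm_exp]
  have e1 : (2 * π * m * z : ℂ).re = 2*π*m*z.re := by simp
  have e2 : (s - 1).re = s.re - 1 := by simp
  have e3 : (s - 1).im = s.im := by simp
  rw [e1, e2, e3]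
  refine mul_le_mul_of_nonneg_right ?_ (norm_nonneg _)
  have e4 : rexp (‖z‖ - s.im * z.arg + 2 * π * m * z.re) = rexp ‖z‖ * (rexp (z.arg * s.im))⁻¹ * rexp (2 * π * m * z.re) := by
    rw [← Real.exp_neg, ← Real.exp_add, ← Real.exp_add]; congr 1; ring
  rw [e4, div_eq_mul_inv, ← mul_assoc, ← mul_assoc]
  exact mul_le_mul_of_nonneg_right (mul_le_mul_of_nonneg_right h1 (by positivity)) (by positivity)

lemma Ef_half (x : ℝ) (n : ℤ) (c : ℝ) (hc : c = n + 1/2) : ‖Ef (x + c * I)‖ = rexp (-(2*π*x)) + 1 := by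
  unfold Ef
  rw [show -(2 * π * ((x:ℂ) + c * I)) = ((-(2*π*x):ℝ):ℂ) + -(π * I) - n * (2 * π * I) by rw [hc]; push_cast; ring]
  rw [Complex.exp_periodic.sub_int_mul_eq n, Complex.exp_add, Complex.exp_neg (π * I), Complex.exp_pi_mul_I, ← Complex.ofReal_exp]
  rw [show ((rexp (-(2*π*x)) : ℝ):ℂ) * (-1)⁻¹ - 1 = -((rexp (-(2*π*x)) + 1 : ℝ):ℂ) by push_cast; norm_num; ring]
  rw [norm_neg, Complex.norm_real, Real.norm_of_nonneg (by positivity)]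

lemma core_exp (M t p a : ℝ) (hM : 10^6 ≤ M) (ht0 : 0 ≤ t) (ht : t ≤ 2 * π * (M+1/2)^2) (hp : M/32 ≤ p)
    (ha : a ≤ (1-1/4000) * (p/M)) : p + M + t * a - 2 * π * (M+1/2) * p ≤ -(M/1000) * p - 100 * p := by
  have hM0 : 0 < M := by linarith
  have hp0 : 0 < p := by linarith
  have h1 : t * a ≤ 2 * π * (M+1/2)^2 * ((1-1/4000) * (p/M)) :=
    (mul_le_mul_of_nonneg_left ha ht0).trans (mul_le_mul_of_nonneg_right ht (by positivity))
  have h2 : (M+1/2)^2 * ((1-1/4000) * (p/M)) ≤ (M + 1/2) * p - M * p / 5000 := by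
    rw [show (M+1/2)^2 * ((1-1/4000) * (p/M)) = (M+1/2)^2 * (1-1/4000) * p / M by ring, div_le_iff₀ hM0]
    have : (M+1/2)^2 * (1-1/4000) ≤ ((M + 1/2) - M / 5000) * M := by nlinarith
    nlinarith
  have h3 : 2 * π * ((M+1/2)^2 * ((1-1/4000) * (p/M))) ≤ 2 * π * ((M + 1/2) * p - M * p / 5000) :=
    mul_le_mul_of_nonneg_left h2 (by positivity)
  have h4 : 3 * (M * p) ≤ π * (M * p) := mul_le_mul_of_nonneg_right Real.pi_gt_three.le (by positivity)
  have h5 : 10^6 * p ≤ M * p := mul_le_mul_of_nonneg_right hM hp0.le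
  nlinarith

lemma tail_bot (B : ℝ) : ∃ D : ℝ, 0 ≤ D ∧ ∀ (m : ℕ) (s : ℂ) (h : ℝ), s.re ≤ B → 10^6 ≤ (m:ℝ) → 2 * π * (m:ℝ)^2 ≤ s.im →
    s.im ≤ 2 * π * (m+1)^2 → h = (m+1/2)/32 →
    ‖∫ x in Set.Iic (-h), Ff m s ((x:ℝ) + (-((m:ℝ)+1/2):ℝ) * I)‖ ≤ D * rexp (π * s.im / 2 - s.im / 10^6) := by
  obtain ⟨D, hD, hF⟩ := Ff_norm_le B
  refine ⟨D, hD, fun m s h hB hm ht1 ht2 hh => ?_⟩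
  set M : ℝ := m + 1/2 with hM
  have hM1 : (10:ℝ)^6 ≤ M := by linarith
  have ht0 : 0 ≤ s.im := le_trans (by positivity) ht1
  have ht2' : s.im ≤ 2 * π * (M+1/2)^2 := by rw [hM]; convert ht2 using 3; ring
  have hc : (0:ℝ) < M/1000 := by positivity
  have hg := integrableOn_exp_mul_Iic hc (-h)
  have hb : ‖∫ x in Set.Iic (-h), Ff m s ((x:ℝ) + (-M:ℝ) * I)‖ ≤ ∫ x in Set.Iic (-h), D * rexp (π * s.im/2) * rexp (M/1000 * x) := by
    refine norm_integral_le_of_norm_le (hg.const_mul _) ?_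
    filter_upwards [ae_restrict_mem measurableSet_Iic] with x hx
    rw [Set.mem_Iic] at hx
    have hre : ((x:ℂ) + (-M:ℝ) * I).re = x := by simp
    have him : ((x:ℂ) + (-M:ℝ) * I).im = -M := by simp
    have hz1 : 1 ≤ ‖(x:ℂ) + (-M:ℝ) * I‖ := by
      have := Complex.abs_im_le_norm ((x:ℂ) + (-M:ℝ) * I)
      rw [him, abs_neg, abs_of_pos (by linarith)] at this; linarith
    have hz2 : ‖(x:ℂ) + (-M:ℝ) * I‖ ≤ -x + M := by
      have := Complex.norm_le_abs_re_add_abs_im ((x:ℂ) + (-M:ℝ) * I)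
      rw [him, hre, abs_neg, abs_of_pos (show 0 < M by linarith), abs_of_neg (by linarith)] at this; linarith
    refine (hF m s _ hB hz1).trans ?_
    rw [arg_low _ (by rw [him]; linarith), him, hre, neg_neg, norm_inv,
      Ef_half x (-(m+1:ℤ)) (-M) (by rw [hM]; push_cast; ring)]
    have hp : M/32 ≤ -x := by linarith
    have ha : Real.arctan (-x/M) ≤ (1-1/4000) * (-x/M) := arctan_up _ (by rw [le_div_iff₀ (by linarith)]; linarith)
    have hce := core_exp M s.im (-x) _ hM1 ht0 ht2' hp ha
    have hinv : (rexp (-(2*π*x)) + 1)⁻¹ ≤ rexp (2*π*x) := by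
      rw [show rexp (2*π*x) = (rexp (-(2*π*x)))⁻¹ by rw [← Real.exp_neg, neg_neg]]
      gcongr; linarith
    calc _ ≤ D * rexp (-x + M - s.im * (Real.arctan (x/M) - π/2) + 2 * π * m * x) * rexp (2*π*x) := by
          refine mul_le_mul (mul_le_mul_of_nonneg_left (Real.exp_le_exp.2 (by linarith)) hD) hinv (by positivity) (by positivity)
      _ ≤ _ := by
          rw [mul_assoc D, mul_assoc D, ← Real.exp_add, ← Real.exp_add]
          refine mul_le_mul_of_nonneg_left (Real.exp_le_exp.2 ?_) hD
          rw [neg_div, Real.arctan_neg] at hce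
          have e : (m:ℝ) = M - 1/2 := by rw [hM]; ring
          rw [e]; nlinarith
  refine hb.trans ?_
  rw [integral_const_mul, integral_exp_mul_Iic hc, mul_assoc]
  refine mul_le_mul_of_nonneg_left ?_ hD
  calc rexp (π * s.im / 2) * (rexp (M/1000 * -h) / (M/1000)) ≤ rexp (π * s.im / 2) * (rexp (M/1000 * -h) / 1) := by
        gcongr; linarith
    _ ≤ _ := by
        rw [div_one, ← Real.exp_add]
        refine Real.exp_le_exp.2 ?_
        have := Real.pi_lt_d2
        have h3 : s.im ≤ 2 * 3.15 * (M+1/2)^2 := ht2'.trans (by gcongr)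
        rw [hh]; nlinarith

lemma tail_left (B : ℝ) : ∃ D : ℝ, 0 ≤ D ∧ ∀ (m : ℕ) (s : ℂ) (h : ℝ), s.re ≤ B → 10^6 ≤ (m:ℝ) → 2 * π * (m:ℝ)^2 ≤ s.im →
    s.im ≤ 2 * π * (m+1)^2 → h = (m+1/2)/32 →
    ‖∫ y in (-((m:ℝ)+1/2+h))..(-((m:ℝ)+1/2)), Ff m s ((-h:ℝ) + (y:ℝ) * I)‖ ≤ D * rexp (π * s.im / 2 - s.im / 10^6) := by
  obtain ⟨D, hD, hF⟩ := Ff_norm_le B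
  refine ⟨D*2, by positivity, fun m s h hB hm ht1 ht2 hh => ?_⟩
  set M : ℝ := m + 1/2 with hM
  have hM1 : (10:ℝ)^6 ≤ M := by linarith
  have hh1 : 1 ≤ h := by linarith
  have ht0 : 0 ≤ s.im := le_trans (by positivity) ht1
  have ht2' : s.im ≤ 2 * π * (M+1/2)^2 := by rw [hM]; convert ht2 using 3; ring
  have hb : ∀ y ∈ Set.uIoc (-(M+h)) (-M), ‖Ff m s ((-h:ℝ) + (y:ℝ) * I)‖ ≤ D * 2 * rexp (π * s.im/2 + (-(M/1000) * h - h)) := by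
    intro y hy
    rw [Set.uIoc_of_le (by linarith)] at hy
    have hre : (((-h:ℝ):ℂ) + (y:ℝ) * I).re = -h := by simp
    have him : (((-h:ℝ):ℂ) + (y:ℝ) * I).im = y := by simp
    have hy0 : y < 0 := by linarith [hy.2]
    have hz1 : 1 ≤ ‖((-h:ℝ):ℂ) + (y:ℝ) * I‖ := by
      have := Complex.abs_im_le_norm (((-h:ℝ):ℂ) + (y:ℝ) * I)
      rw [him, abs_of_neg hy0] at this; linarith [hy.2]
    have hz2 : ‖((-h:ℝ):ℂ) + (y:ℝ) * I‖ ≤ 2 * h + M := by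
      have := Complex.norm_le_abs_re_add_abs_im (((-h:ℝ):ℂ) + (y:ℝ) * I)
      rw [him, hre, abs_neg, abs_of_pos (show 0 < h by linarith), abs_of_neg hy0] at this; linarith [hy.1]
    refine (hF m s _ hB hz1).trans ?_
    have hinv := Ef_inv_bound (((-h:ℝ):ℂ) + (y:ℝ) * I) (by rw [hre]; linarith)
    rw [arg_low _ (by rw [him]; linarith), him, hre]
    rw [hre] at hinv
    have ha : Real.arctan (h/M) ≤ (1-1/4000) * (h/M) := arctan_up _ (by rw [le_div_iff₀ (by linarith)]; linarith)
    have ha2 : -Real.arctan (h/M) ≤ Real.arctan (-h/(-y)) := by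
      rw [← Real.arctan_neg]; apply Real.arctan_strictMono.monotone
      rw [neg_div]; apply neg_le_neg
      apply div_le_div_of_nonneg_left <;> linarith [hy.2]
    have hce := core_exp M s.im h _ hM1 ht0 ht2' (by linarith) ha
    calc _ ≤ D * rexp (2 * h + M - s.im * (-Real.arctan (h/M) - π/2) + 2 * π * m * (-h)) * (2 * rexp (2*π*(-h))) := by
          refine mul_le_mul (mul_le_mul_of_nonneg_left (Real.exp_le_exp.2 ?_) hD) hinv (by positivity) (by positivity)
          have := mul_le_mul_of_nonneg_left ha2 ht0
          linarith
      _ = D * 2 * rexp (2 * h + M - s.im * (-Real.arctan (h/M) - π/2) + 2 * π * m * (-h) + 2*π*(-h)) := by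
          rw [Real.exp_add _ (2*π*(-h))]; ring
      _ ≤ _ := by
          refine mul_le_mul_of_nonneg_left (Real.exp_le_exp.2 ?_) (by positivity)
          have e : (m:ℝ) = M - 1/2 := by rw [hM]; ring
          rw [e]; nlinarith
  refine (intervalIntegral.norm_integral_le_of_norm_le_const hb).trans ?_
  rw [show -M - -(M+h) = h by ring, abs_of_pos (by linarith)]
  calc D * 2 * rexp (π * s.im/2 + (-(M/1000) * h - h)) * h ≤ D * 2 * rexp (π * s.im/2 + (-(M/1000) * h - h)) * rexp h := by
        gcongr; linarith [Real.add_one_le_exp h]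
    _ ≤ _ := by
        rw [mul_assoc, ← Real.exp_add]
        refine mul_le_mul_of_nonneg_left (Real.exp_le_exp.2 ?_) (by positivity)
        have := Real.pi_lt_d2
        have h3 : s.im ≤ 2 * 3.15 * (M+1/2)^2 := ht2'.trans (by gcongr)
        rw [hh]; nlinarith

lemma tail_right (B : ℝ) : ∃ D : ℝ, 0 ≤ D ∧ ∀ (m : ℕ) (s : ℂ) (h : ℝ), s.re ≤ B → 10^6 ≤ (m:ℝ) → 2 * π * (m:ℝ)^2 ≤ s.im →
    s.im ≤ 2 * π * (m+1)^2 → h = (m+1/2)/32 →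
    ‖∫ y in (-((m:ℝ)+1/2-h))..((m:ℝ)+1/2), Ff m s (h + (y:ℝ) * I)‖ ≤ D * rexp (π * s.im / 2 - s.im / 10^6) := by
  obtain ⟨D, hD, hF⟩ := Ff_norm_le B
  refine ⟨D*2, by positivity, fun m s h hB hm ht1 ht2 hh => ?_⟩
  set M : ℝ := m + 1/2 with hM
  have hM1 : (10:ℝ)^6 ≤ M := by linarith
  have hh1 : 1 ≤ h := by linarith
  have ht0 : 0 ≤ s.im := le_trans (by positivity) ht1
  have hb : ∀ y ∈ Set.uIoc (-(M-h)) M, ‖Ff m s (h + (y:ℝ) * I)‖ ≤ D * 2 * rexp (2 * M - s.im * (31/962 - π/2) + 2 * π * m * h) := by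
    intro y hy
    rw [Set.uIoc_of_le (by linarith)] at hy
    have hre : ((h:ℂ) + (y:ℝ) * I).re = h := by simp
    have him : ((h:ℂ) + (y:ℝ) * I).im = y := by simp
    have hz1 : 1 ≤ ‖(h:ℂ) + (y:ℝ) * I‖ := by
      have := Complex.abs_re_le_norm ((h:ℂ) + (y:ℝ) * I)
      rw [hre, abs_of_pos (by linarith)] at this; linarith
    have hz2 : ‖(h:ℂ) + (y:ℝ) * I‖ ≤ 2 * M := by
      have := Complex.norm_le_abs_re_add_abs_im ((h:ℂ) + (y:ℝ) * I)
      have h2 : |y| ≤ M := abs_le.2 ⟨by linarith [hy.1], hy.2⟩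
      rw [him, hre, abs_of_pos (show 0 < h by linarith)] at this; linarith
    refine (hF m s _ hB hz1).trans ?_
    have hinv : ‖(Ef ((h:ℂ) + (y:ℝ) * I))⁻¹‖ ≤ 2 := by
      rw [norm_inv]
      have h1 := norm_sub_norm_le (1:ℂ) (Complex.exp (-(2 * π * ((h:ℂ) + (y:ℝ) * I))))
      rw [Complex.norm_exp, norm_one, norm_sub_rev] at h1
      have e : (-(2 * (π:ℂ) * ((h:ℂ) + (y:ℝ) * I))).re = -(2*π*h) := by simp
      rw [e] at h1
      have h2 : rexp (-(2*π*h)) ≤ 1/2 := by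
        rw [Real.exp_neg, one_div]
        gcongr
        nlinarith [Real.add_one_le_exp (2*π*h), Real.pi_gt_three]
      have h3 : (1/2:ℝ) ≤ ‖Ef ((h:ℂ) + (y:ℝ) * I)‖ := by unfold Ef; linarith
      calc _ ≤ (1/2:ℝ)⁻¹ := by gcongr
        _ = 2 := by norm_num
    have harg : 31/962 - π/2 ≤ ((h:ℂ) + (y:ℝ) * I).arg := by
      rcases lt_or_ge y 0 with hy0 | hy0
      · rw [arg_low _ (by rw [him]; exact hy0), him, hre]
        have := arctan_lo (h/(-y)) (by rw [le_div_iff₀ (by linarith)]; linarith [hy.1])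
        linarith
      · have := Complex.arg_nonneg_iff.2 (show 0 ≤ ((h:ℂ) + (y:ℝ) * I).im by rw [him]; exact hy0)
        linarith [Real.pi_gt_three]
    rw [hre]
    have h4 := mul_le_mul_of_nonneg_left harg ht0
    calc _ ≤ D * rexp (2 * M - s.im * (31/962 - π/2) + 2 * π * m * h) * 2 := by
          refine mul_le_mul (mul_le_mul_of_nonneg_left (Real.exp_le_exp.2 (by linarith)) hD) hinv (by positivity) (by positivity)
      _ = _ := by ring
  refine (intervalIntegral.norm_integral_le_of_norm_le_const hb).trans ?_
  have hl : |M - -(M-h)| ≤ rexp (2 * M) := by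
    rw [abs_of_pos (by linarith)]; linarith [Real.add_one_le_exp (2*M)]
  refine (mul_le_mul_of_nonneg_left hl (by positivity)).trans ?_
  rw [mul_assoc, ← Real.exp_add]
  refine mul_le_mul_of_nonneg_left (Real.exp_le_exp.2 ?_) (by positivity)
  have h1 := mul_le_mul_of_nonneg_right ht1 (show (0:ℝ) ≤ 31/962 - 1/10^6 by norm_num)
  have h2 : 2 * π * (m:ℝ) * h = π * (m * (m + 1/2)) / 16 := by rw [hh]; ring
  have h3 : 4 * M ≤ π * (2 * (m:ℝ)^2 * (31/962 - 1/10^6) - (m:ℝ) * (m+1/2)/16) := by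
    refine le_trans ?_ (mul_le_mul_of_nonneg_right Real.pi_gt_three.le (by nlinarith))
    rw [hM]; nlinarith
  nlinarith

lemma tail_top (B : ℝ) : ∃ D : ℝ, 0 ≤ D ∧ ∀ (m : ℕ) (s : ℂ) (h : ℝ), s.re ≤ B → 10^6 ≤ (m:ℝ) → 2 * π * (m:ℝ)^2 ≤ s.im →
    s.im ≤ 2 * π * (m+1)^2 → h = (m+1/2)/32 →
    ‖∫ x in Set.Iic h, Ff m s ((x:ℝ) + ((m:ℝ) + 1/2 : ℝ) * I)‖ ≤ D * rexp (π * s.im / 2 - s.im / 10^6) := by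
  obtain ⟨D, hD, hF⟩ := Ff_norm_le B
  refine ⟨D, hD, fun m s h hB hm ht1 ht2 hh => ?_⟩
  set M : ℝ := m + 1/2 with hM
  have hM1 : (10:ℝ)^6 ≤ M := by linarith
  have ht0 : 0 ≤ s.im := le_trans (by positivity) ht1
  have hg := integrableOn_exp_mul_Iic one_pos h
  have hb : ‖∫ x in Set.Iic h, Ff m s ((x:ℝ) + (M:ℝ) * I)‖ ≤ ∫ x in Set.Iic h, D * rexp (2 * M + 2 * π * M * h - h) * rexp (1 * x) := by
    refine norm_integral_le_of_norm_le (hg.const_mul _) ?_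
    filter_upwards [ae_restrict_mem measurableSet_Iic] with x hx
    rw [Set.mem_Iic] at hx
    have hre : ((x:ℂ) + (M:ℝ) * I).re = x := by simp
    have him : ((x:ℂ) + (M:ℝ) * I).im = M := by simp
    have hz1 : 1 ≤ ‖(x:ℂ) + (M:ℝ) * I‖ := by
      have := Complex.abs_im_le_norm ((x:ℂ) + (M:ℝ) * I)
      rw [him, abs_of_pos (by linarith)] at this; linarith
    have hz2 : ‖(x:ℂ) + (M:ℝ) * I‖ ≤ 2 * h - x + M := by
      have := Complex.norm_le_abs_re_add_abs_im ((x:ℂ) + (M:ℝ) * I)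
      have h2 : |x| ≤ 2 * h - x := abs_le.2 ⟨by linarith, by linarith⟩
      rw [him, hre, abs_of_pos (show 0 < M by linarith)] at this; linarith
    refine (hF m s _ hB hz1).trans ?_
    have harg := Complex.arg_nonneg_iff.2 (show 0 ≤ ((x:ℂ) + (M:ℝ) * I).im by rw [him]; linarith)
    rw [hre, norm_inv, Ef_half x m M (by rw [hM]; push_cast; ring)]
    have hinv : (rexp (-(2*π*x)) + 1)⁻¹ ≤ rexp (π*x) := by
      rw [show rexp (π*x) = (rexp (-(π*x)))⁻¹ by rw [← Real.exp_neg, neg_neg]]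
      gcongr
      rw [show -(2*π*x) = -(π*x) + -(π*x) by ring, Real.exp_add]
      nlinarith [sq_nonneg (rexp (-(π*x)) - 1)]
    have h4 := mul_nonneg ht0 harg
    calc _ ≤ D * rexp (2 * h - x + M + 2 * π * m * x) * rexp (π*x) := by
          refine mul_le_mul (mul_le_mul_of_nonneg_left (Real.exp_le_exp.2 (by linarith)) hD) hinv (by positivity) (by positivity)
      _ ≤ _ := by
          rw [mul_assoc D, mul_assoc D, ← Real.exp_add, ← Real.exp_add]
          refine mul_le_mul_of_nonneg_left (Real.exp_le_exp.2 ?_) hD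
          have e : (m:ℝ) = M - 1/2 := by rw [hM]; ring
          have h5 : 0 ≤ (π * M - 1) * (h - x) := mul_nonneg (by nlinarith [Real.pi_gt_three]) (by linarith)
          rw [e]; nlinarith
  refine hb.trans ?_
  rw [integral_const_mul, integral_exp_mul_Iic one_pos, mul_assoc]
  refine mul_le_mul_of_nonneg_left ?_ hD
  rw [div_one, ← Real.exp_add]
  refine Real.exp_le_exp.2 ?_
  have h3 : s.im * 1 ≤ s.im * (π/2 - 1/10^6) := mul_le_mul_of_nonneg_left (by linarith [Real.pi_gt_three]) ht0
  have h6 : 2 * M + π * (M * M / 16) ≤ 2 * π * (m:ℝ)^2 := by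
    have : 2 * M ≤ π * (2 * (m:ℝ)^2 - M * M / 16) := by
      refine le_trans ?_ (mul_le_mul_of_nonneg_right Real.pi_gt_three.le (by rw [hM]; nlinarith))
      rw [hM]; nlinarith
    linarith
  have h7 : 2 * π * M * h = π * (M * M / 16) := by rw [hh]; ring
  linarith

lemma tail_all (B : ℝ) : ∃ D : ℝ, 0 ≤ D ∧ ∀ (m : ℕ) (s : ℂ) (h : ℝ), s.re ≤ B → 10^6 ≤ (m:ℝ) → 2 * π * (m:ℝ)^2 ≤ s.im →
    s.im ≤ 2 * π * (m+1)^2 → h = (m+1/2)/32 →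
    ‖Lf m m h s - (∫ v in (-(√2*h))..(√2*h), (-I * om) * Ff m s (zd m v))‖ ≤ D * rexp (π * s.im / 2 - s.im / 10^6) := by
  obtain ⟨D1, h1, H1⟩ := tail_bot B
  obtain ⟨D2, h2, H2⟩ := tail_left B
  obtain ⟨D3, h3, H3⟩ := tail_right B
  obtain ⟨D4, h4, H4⟩ := tail_top B
  refine ⟨D1 + D2 + D3 + D4, by positivity, fun m s h hB hm ht1 ht2 hh => ?_⟩
  have hm1 : 1 ≤ m := by
    have : (1:ℝ) ≤ m := by linarith
    exact_mod_cast this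
  rw [Lf_decomp m s h hh hm1]
  have g1 := H1 m s h hB hm ht1 ht2 hh
  have g2 := H2 m s h hB hm ht1 ht2 hh
  have g3 := H3 m s h hB hm ht1 ht2 hh
  have g4 := H4 m s h hB hm ht1 ht2 hh
  refine (norm_sub_le _ _).trans ?_
  refine (add_le_add_left ((norm_add_le _ _).trans (add_le_add_left (norm_sub_le _ _) _)) _).trans ?_
  rw [norm_mul I, norm_mul I, Complex.norm_I, one_mul, one_mul]
  linarith

def kap (s : ℂ) (α a : ℝ) : ℂ :=
  Complex.exp ((s - 1) * (Real.log α : ℂ) - π / 2 * I * s - 2 * π * I * α * a - π * I * a^2)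

lemma kap_norm (s : ℂ) (α a : ℝ) (hα : 0 < α) : ‖kap s α a‖ = α ^ (s.re - 1) * rexp (π * s.im / 2) := by
  unfold kap
  rw [Complex.norm_exp, Real.rpow_def_of_pos hα, ← Real.exp_add]
  congr 1
  have e : (s - 1) * (Real.log α : ℂ) - π / 2 * I * s - 2 * π * I * α * a - π * I * a^2 =
    (s-1) * ((Real.log α:ℝ):ℂ) - (π/2:ℝ) * (I * s) - (2 * π * α * a + π * a^2 : ℝ) * I := by push_cast; ring
  rw [e]
  simp only [Complex.sub_re, Complex.mul_re, Complex.I_re, Complex.I_im, Complex.ofReal_re, Complex.ofReal_im, Complex.one_re]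
  ring

lemma kap_phase (s : ℂ) (α a : ℝ) (m : ℕ) (ha : a = α - m) (ht : s.im = 2 * π * α^2) :
    kap s α a * Complex.exp (2 * π * I * a^2 - I * π / 8) =
      (-1)^m * Complex.exp ((s-1) * (Real.log α : ℂ) - π/2 * I * s - I * s.im / 2 - I * π / 8) := by
  have h1 : (-1:ℂ)^m = Complex.exp (π * I * m^2) := by
    rw [← Complex.exp_pi_mul_I, ← Complex.exp_nat_mul, Complex.exp_eq_exp_iff_exists_int]
    obtain ⟨r, hr⟩ : 2 ∣ ((m:ℤ) - m^2) := by
      have := Int.even_mul_pred_self (m:ℤ)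
      obtain ⟨q, hq⟩ := this
      exact ⟨-q, by linarith⟩
    refine ⟨r, ?_⟩
    have hr' : ((m:ℂ) - m^2) = 2 * r := by exact_mod_cast hr
    linear_combination π * I * hr'
  rw [h1]; unfold kap
  rw [← Complex.exp_add, ← Complex.exp_add, ht, ha]
  congr 1
  push_cast; ring

lemma diag_id (m : ℕ) (s : ℂ) (α a v : ℝ) (hα : 0 < α) (ha : a = α - m) (ht : s.im = 2 * π * α^2)
    (hZ : ‖((√(2*π):ℝ):ℂ) * ((1/2 + om * v) - a)‖ ≤ √s.im / 16) :
    (-I * om) * Ff m s (zd m v) = kap s α a * (wfun s (((√(2*π):ℝ):ℂ) * ((1/2 + om * v) - a)) *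
      (Complex.exp (2 * a * Ll (1/2) v) * Gg (1/2) v)) := by
  set r := √(2*π) with hr
  have hr0 : 0 < r := Real.sqrt_pos.2 (by positivity)
  have hr2 : r^2 = 2*π := Real.sq_sqrt (by positivity)
  have hrt : √s.im = r * α := by
    rw [ht, Real.sqrt_mul (by positivity), Real.sqrt_sq hα.le]
  set X : ℂ := 1/2 + om * v with hX
  set Z : ℂ := (r:ℂ) * (X - a) with hZd
  have hst0 : 0 < √s.im := by rw [hrt]; positivity
  have hαc : (α:ℂ) ≠ 0 := by exact_mod_cast hα.ne'
  have hrc : (r:ℂ) ≠ 0 := by exact_mod_cast hr0.ne'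
  have hac : (a:ℂ) = α - m := by rw [ha]; push_cast; ring
  have hrc2 : (r:ℂ)^2 = 2 * π := by exact_mod_cast hr2
  have hw : (m:ℂ) + X = α * (1 + Z / (√s.im : ℂ)) := by
    rw [hrt, hZd, hac]; push_cast; field_simp; ring
  have hn : ‖Z / (√s.im : ℂ)‖ ≤ 1/16 := by
    rw [norm_div, Complex.norm_real, Real.norm_of_nonneg hst0.le, div_le_iff₀ hst0]; linarith
  have hre : 0 < (1 + Z / (√s.im : ℂ)).re := by
    have := (abs_le.1 ((Complex.abs_re_le_norm _).trans hn)).1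
    rw [Complex.add_re, Complex.one_re]; linarith
  have hne : (1 + Z / (√s.im : ℂ)) ≠ 0 := by intro h; rw [h] at hre; simp at hre
  have hwre : 0 < ((m:ℂ) + X).re := by rw [hw, Complex.re_ofReal_mul]; positivity
  have hzd : zd m v = -I * ((m:ℂ) + X) := by unfold zd; rw [hX]; ring
  have hzne : zd m v ≠ 0 := by
    rw [hzd]; exact mul_ne_zero (by simp) (by rw [hw]; exact mul_ne_zero hαc hne)
  have hzim : (zd m v).im < 0 := by
    rw [hzd]; simp at hwre ⊢; linarith
  have hlog : Complex.log (zd m v) = (Real.log α : ℂ) + Complex.log (1 + Z / (√s.im : ℂ)) - π/2 * I := by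
    rw [log_dn _ hzne hzim.le (Or.inl hzim), hzd,
      show -I * ((m:ℂ) + X) * I = (m:ℂ) + X by linear_combination (-((m:ℂ)+X)) * Complex.I_sq, hw,
      Complex.log_ofReal_mul hα hne]
  have hEf : Ef (zd m v) = Dd X := by
    rw [zd_Ef, hX]; congr 1; push_cast; ring
  have hG : Gg (1/2) v = om * Complex.exp (-(π*I) * X^2) / Dd X := by
    unfold Gg; rw [hX]; push_cast; rfl
  have hLl : Ll (1/2) v = 2 * π * I * X := by unfold Ll; rw [hX]; push_cast; rfl
  have hper : Complex.exp (2 * π * m * (zd m v)) = Complex.exp (-(2 * π * I * m * X)) := by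
    rw [Complex.exp_eq_exp_iff_exists_int]
    refine ⟨-((m:ℤ)^2), ?_⟩
    rw [hzd]; push_cast; ring
  have hmI : -I = Complex.exp (-(π/2*I)) := by
    rw [Complex.exp_neg, Complex.exp_pi_div_two_mul_I, Complex.inv_I]
  unfold Ff gf
  rw [hEf, hG, hLl, hper, Complex.cpow_def_of_ne_zero hzne, hlog]
  unfold kap wfun
  set L := Complex.log (1 + Z / (√s.im : ℂ)) with hL
  have hE : (-I) * (Complex.exp (((Real.log α : ℂ) + L - π/2 * I) * (s-1)) * Complex.exp (-(2 * π * I * m * X))) =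
      Complex.exp ((s - 1) * (Real.log α : ℂ) - π / 2 * I * s - 2 * π * I * α * a - π * I * a^2) *
      (Complex.exp ((s-1) * L - I * (√s.im : ℂ) * Z + I * Z^2 / 2) *
        (Complex.exp (2 * a * (2 * π * I * X)) * Complex.exp (-(π*I) * X^2))) := by
    rw [hmI]
    simp only [← Complex.exp_add]
    congr 1
    have e1 : (√s.im : ℂ) * Z = 2 * π * α * (X - a) := by
      rw [hrt, hZd]; push_cast; linear_combination (α * (X - a)) * hrc2
    have e2 : Z^2 = 2 * π * (X-a)^2 := by rw [hZd]; linear_combination (X-a)^2 * hrc2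
    rw [mul_assoc I (√s.im:ℂ) Z, e1, e2, hac]
    ring
  linear_combination (om / Dd X) * hE

lemma exp_pow_dec (p : ℝ) : ∃ C : ℝ, 0 ≤ C ∧ ∀ t : ℝ, 1 ≤ t → rexp (-(t/10^6)) ≤ C * t ^ p := by
  obtain ⟨n, hn⟩ := exists_nat_ge (-p)
  refine ⟨n.factorial * (10^6)^n, by positivity, fun t ht => ?_⟩
  have h1 := Real.pow_div_factorial_le_exp (t/10^6) (by positivity) n
  have ht0 : 0 < t := by linarith
  have h2 : t ^ (-(n:ℝ)) ≤ t ^ p := Real.rpow_le_rpow_of_exponent_le ht (by linarith)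
  refine le_trans ?_ (mul_le_mul_of_nonneg_left h2 (by positivity))
  rw [Real.rpow_neg ht0.le, Real.rpow_natCast, Real.exp_neg]
  rw [show (n.factorial:ℝ) * (10^6)^n * (t^n)⁻¹ = ((t/10^6)^n / n.factorial)⁻¹ by
    rw [div_pow, inv_div]; field_simp]
  exact inv_anti₀ (by positivity) h1

def Zv (a v : ℝ) : ℂ := ((√(2*π):ℝ):ℂ) * ((1/2 + om * v) - a)
def Ev (a v : ℝ) : ℂ := Complex.exp (2 * a * Ll (1/2) v) * Gg (1/2) v

lemma Zv_norm (a v : ℝ) (h0 : 0 ≤ a) (h1 : a ≤ 1) : ‖Zv a v‖ ≤ √(2*π) * (1/2 + |v|) := by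
  unfold Zv
  rw [norm_mul, Complex.norm_real, Real.norm_of_nonneg (Real.sqrt_nonneg _)]
  refine mul_le_mul_of_nonneg_left ?_ (Real.sqrt_nonneg _)
  rw [show (1/2 + om * v) - (a:ℂ) = ((1/2 - a : ℝ):ℂ) + om * v by push_cast; ring]
  refine (norm_add_le _ _).trans ?_
  rw [norm_mul, om_norm, one_mul, Complex.norm_real, Complex.norm_real, Real.norm_eq_abs, Real.norm_eq_abs]
  have : |1/2 - a| ≤ 1/2 := abs_le.2 ⟨by linarith, by linarith⟩
  linarith

lemma rt2pi : √(2*π) ≤ 3 := by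
  rw [Real.sqrt_le_left (by norm_num)]; nlinarith [Real.pi_lt_four]

lemma Zv_pow (n : ℕ) : ∃ K : ℝ, 0 ≤ K ∧ ∀ a v : ℝ, 0 ≤ a → a ≤ 1 → (1 + ‖Zv a v‖)^n ≤ K * rexp (v^2/4) := by
  refine ⟨n.factorial * rexp 12, by positivity, fun a v h0 h1 => ?_⟩
  have h2 := Real.pow_div_factorial_le_exp (1 + ‖Zv a v‖) (by positivity) n
  rw [div_le_iff₀ (by positivity)] at h2
  have h3 : 1 + ‖Zv a v‖ ≤ 12 + v^2/4 := by
    have := Zv_norm a v h0 h1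
    have h4 : √(2*π) * (1/2 + |v|) ≤ 3 * (1/2 + |v|) := mul_le_mul_of_nonneg_right rt2pi (by positivity)
    nlinarith [sq_nonneg (|v| - 6), sq_abs v]
  have h5 := Real.exp_le_exp.2 h3
  rw [Real.exp_add 12] at h5
  calc _ ≤ _ := h2
    _ ≤ (rexp 12 * rexp (v^2/4)) * n.factorial := mul_le_mul_of_nonneg_right h5 (by positivity)
    _ = _ := by ring

lemma Zv_exp (a v : ℝ) (h0 : 0 ≤ a) (h1 : a ≤ 1) : rexp (‖Zv a v‖^2/20) ≤ rexp 1 * rexp (v^2/2) := by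
  rw [← Real.exp_add]
  apply Real.exp_le_exp.2
  have h2 := Zv_norm a v h0 h1
  have h3 : ‖Zv a v‖^2 ≤ (√(2*π) * (1/2 + |v|))^2 := pow_le_pow_left₀ (norm_nonneg _) h2 2
  rw [mul_pow, Real.sq_sqrt (by positivity)] at h3
  have h4 : 2 * π * (1/2 + |v|)^2 ≤ 6.3 * (1/2+|v|)^2 := by
    refine mul_le_mul_of_nonneg_right ?_ (by positivity)
    linarith [Real.pi_lt_d2]
  nlinarith [sq_nonneg (|v| - 2), sq_abs v]

lemma Ev_norm (a v : ℝ) (h0 : 0 ≤ a) (h1 : a ≤ 1) : ‖Ev a v‖ ≤ 2 * rexp 300 * rexp (-v^2) := by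
  unfold Ev
  rw [norm_mul]
  have h2 : ‖Complex.exp (2 * a * Ll (1/2) v)‖ ≤ rexp (7 + 13 * |v|) := by
    refine (Complex.norm_exp_le_exp_norm _).trans (Real.exp_le_exp.2 ?_)
    have h3 := Ll_norm (1/2) v
    have e : ‖(2 * a * Ll (1/2) v : ℂ)‖ = 2 * a * ‖Ll (1/2) v‖ := by
      rw [norm_mul, norm_mul, Complex.norm_real, Real.norm_of_nonneg h0]; simp
    rw [e, show |(1/2:ℝ)| = 1/2 by norm_num] at *
    have h5 : 2 * π * (1/2 + |v|) ≤ 6.5 * (1/2 + |v|) := by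
      refine mul_le_mul_of_nonneg_right ?_ (by positivity)
      linarith [Real.pi_lt_d2]
    have := norm_nonneg (Ll (1/2) v)
    nlinarith [abs_nonneg v]
  calc _ ≤ rexp (7 + 13 * |v|) * (2 * rexp (-π * v^2 + 3 * |v|)) :=
        mul_le_mul h2 (Gg_norm _ (Or.inl rfl) v) (norm_nonneg _) (Real.exp_pos _).le
    _ = 2 * rexp (7 + (-π * v^2 + 16 * |v|)) := by
        rw [show 7 + (-π * v^2 + 16 * |v|) = (7 + 13 * |v|) + (-π * v^2 + 3 * |v|) by ring, Real.exp_add (7 + 13*|v|)]; ring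
    _ ≤ 2 * rexp (300 + -v^2) := by
        refine mul_le_mul_of_nonneg_left (Real.exp_le_exp.2 ?_) (by norm_num)
        have := quad_dom 16 v
        linarith
    _ = _ := by rw [Real.exp_add]; ring

lemma Zv_cont (a : ℝ) : Continuous (Zv a) := by unfold Zv; fun_prop
lemma Ev_cont (a : ℝ) : Continuous (Ev a) := by
  unfold Ev
  have := Ll_cont (1/2)
  have := Gg_cont (1/2) (Or.inl rfl)
  fun_prop

lemma gauss4 : Integrable (fun v : ℝ => rexp (-(1/4) * v^2)) := integrable_exp_neg_mul_sq (by norm_num)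

lemma ZE_bound (k : ℕ) : ∃ K : ℝ, 0 ≤ K ∧ ∀ a v : ℝ, 0 ≤ a → a ≤ 1 → ‖Zv a v ^ k * Ev a v‖ ≤ K * rexp (-(3/4) * v^2) := by
  obtain ⟨K, hK, H⟩ := Zv_pow k
  refine ⟨K * (2 * rexp 300), by positivity, fun a v h0 h1 => ?_⟩
  rw [norm_mul, norm_pow]
  have h2 : ‖Zv a v‖^k ≤ K * rexp (v^2/4) :=
    (pow_le_pow_left₀ (norm_nonneg _) (by linarith) k).trans (H a v h0 h1)
  calc _ ≤ (K * rexp (v^2/4)) * (2 * rexp 300 * rexp (-v^2)) := mul_le_mul h2 (Ev_norm a v h0 h1) (norm_nonneg _) (by positivity)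
    _ = K * (2 * rexp 300) * (rexp (v^2/4) * rexp (-v^2)) := by ring
    _ = _ := by rw [← Real.exp_add]; congr 2; ring

lemma ZE_int (a : ℝ) (h0 : 0 ≤ a) (h1 : a ≤ 1) (k : ℕ) : Integrable (fun v : ℝ => Zv a v ^ k * Ev a v) := by
  obtain ⟨K, hK, H⟩ := ZE_bound k
  refine Integrable.mono' ((integrable_exp_neg_mul_sq (b := 3/4) (by norm_num)).const_mul K)
    (((Zv_cont a).pow k).mul (Ev_cont a)).aestronglyMeasurable (Filter.Eventually.of_forall fun v => H a v h0 h1)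

lemma wE_cont (s : ℂ) (a : ℝ) (hs : 0 < s.im) (v : ℝ) (hv : ‖Zv a v‖ ≤ √s.im / 16) :
    ContinuousAt (fun v => wfun s (Zv a v)) v := by
  have hc := Zv_cont a
  have hst0 : 0 < √s.im := Real.sqrt_pos.2 hs
  have hn : ‖Zv a v / (√s.im : ℂ)‖ ≤ 1/16 := by
    rw [norm_div, Complex.norm_real, Real.norm_of_nonneg hst0.le, div_le_iff₀ hst0]; linarith
  have hre : 0 < (1 + Zv a v / (√s.im : ℂ)).re := by
    have := (abs_le.1 ((Complex.abs_re_le_norm _).trans hn)).1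
    rw [Complex.add_re, Complex.one_re]; linarith
  have h1 : ContinuousAt (fun v => Complex.log (1 + Zv a v / (√s.im : ℂ))) v :=
    ContinuousAt.clog (by fun_prop) (Or.inl hre)
  unfold wfun
  fun_prop

lemma central_pt (A B : ℝ) (N : ℕ) : ∃ C : ℝ, 0 ≤ C ∧ ∀ s : ℂ, A ≤ s.re → s.re ≤ B → 1 ≤ s.im → ∀ ak, IsAk s ak →
    ∀ a v : ℝ, 0 ≤ a → a ≤ 1 → ‖Zv a v‖ ≤ √s.im / 16 →
    ‖wfun s (Zv a v) * Ev a v - ∑ k ∈ Finset.range N, ak k * (Zv a v ^ k * Ev a v)‖ ≤ C * s.im ^ (-(N:ℝ)/6) * rexp (-(1/4) * v^2) := by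
  obtain ⟨C, hC, H⟩ := r_bound A B N
  obtain ⟨K, hK, HK⟩ := Zv_pow (N+2)
  refine ⟨C * (K * rexp 1 * (2 * rexp 300)), by positivity, fun s hA hB ht ak hak a v h0 h1 hZ => ?_⟩
  have e : wfun s (Zv a v) * Ev a v - ∑ k ∈ Finset.range N, ak k * (Zv a v ^ k * Ev a v) =
     (wfun s (Zv a v) - ∑ k ∈ Finset.range N, ak k * Zv a v ^ k) * Ev a v := by
    rw [sub_mul, Finset.sum_mul]; simp only [mul_assoc]
  rw [e, norm_mul]
  have ht0 : 0 < s.im := by linarith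
  have hp := Real.rpow_nonneg ht0.le (-(N:ℝ)/6)
  have g1 := H s hA hB ht ak hak (Zv a v) hZ
  have g2 := HK a v h0 h1
  have g3 := Zv_exp a v h0 h1
  have g4 := Ev_norm a v h0 h1
  have g5 : (1 + ‖Zv a v‖)^(N+2) * rexp (‖Zv a v‖^2/20) ≤ (K * rexp (v^2/4)) * (rexp 1 * rexp (v^2/2)) :=
    mul_le_mul g2 g3 (Real.exp_pos _).le (by positivity)
  have g6 : ‖wfun s (Zv a v) - ∑ k ∈ Finset.range N, ak k * Zv a v ^ k‖ ≤
      C * s.im ^ (-(N:ℝ)/6) * ((K * rexp (v^2/4)) * (rexp 1 * rexp (v^2/2))) := by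
    refine g1.trans ?_
    rw [mul_assoc (C * s.im ^ (-(N:ℝ)/6))]
    exact mul_le_mul_of_nonneg_left g5 (by positivity)
  calc _ ≤ (C * s.im ^ (-(N:ℝ)/6) * ((K * rexp (v^2/4)) * (rexp 1 * rexp (v^2/2)))) * (2 * rexp 300 * rexp (-v^2)) :=
        mul_le_mul g6 g4 (norm_nonneg _) (by positivity)
    _ = C * (K * rexp 1 * (2 * rexp 300)) * s.im ^ (-(N:ℝ)/6) * (rexp (v^2/4) * rexp (v^2/2) * rexp (-v^2)) := by ring
    _ = _ := by rw [← Real.exp_add, ← Real.exp_add]; congr 2; ring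

lemma tail_pt (A B : ℝ) (N : ℕ) : ∃ C : ℝ, 0 ≤ C ∧ ∀ s : ℂ, A ≤ s.re → s.re ≤ B → 1 ≤ s.im → ∀ ak, IsAk s ak →
    ∀ a v V : ℝ, 0 ≤ a → a ≤ 1 → 0 ≤ V → V ≤ |v| →
    ‖∑ k ∈ Finset.range N, ak k * (Zv a v ^ k * Ev a v)‖ ≤ C * rexp (-(V^2/2)) * rexp (-(1/4) * v^2) := by
  choose Ca hCa Ha using ak_bound A B
  choose K hK HK using ZE_bound
  refine ⟨∑ k ∈ Finset.range N, Ca k * K k, Finset.sum_nonneg fun k _ => mul_nonneg (hCa k) (hK k), fun s hA hB ht ak hak a v V h0 h1 hV hv => ?_⟩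
  refine (norm_sum_le _ _).trans ?_
  rw [Finset.sum_mul, Finset.sum_mul]
  refine Finset.sum_le_sum fun k _ => ?_
  rw [norm_mul]
  have g1 : ‖ak k‖ ≤ Ca k := by
    refine (Ha k s hA hB ht ak hak).trans ?_
    have : s.im ^ (-(k:ℝ)/6) ≤ 1 := Real.rpow_le_one_of_one_le_of_nonpos ht (by
      have : (0:ℝ) ≤ k := by positivity
      linarith)
    nlinarith [hCa k]
  have g2 : rexp (-(3/4) * v^2) ≤ rexp (-(V^2/2)) * rexp (-(1/4) * v^2) := by
    rw [← Real.exp_add]; apply Real.exp_le_exp.2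
    have := pow_le_pow_left₀ hV hv 2
    rw [sq_abs] at this; linarith
  calc _ ≤ Ca k * (K k * rexp (-(3/4) * v^2)) := mul_le_mul g1 (HK k a v h0 h1) (norm_nonneg _) (hCa k)
    _ ≤ Ca k * (K k * (rexp (-(V^2/2)) * rexp (-(1/4) * v^2))) :=
        mul_le_mul_of_nonneg_left (mul_le_mul_of_nonneg_left g2 (hK k)) (hCa k)
    _ = _ := by ring

lemma central (A B : ℝ) (N : ℕ) : ∃ C : ℝ, 0 ≤ C ∧ ∀ Ψ, IsPsi Ψ → ∀ (s : ℂ) (m : ℕ) (α a h : ℝ) (ak : ℕ → ℂ),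
    A ≤ s.re → s.re ≤ B → IsAk s ak → 10^6 ≤ (m:ℝ) → 0 ≤ a → a ≤ 1 → a = α - m → s.im = 2 * π * α^2 → h = (m+1/2)/32 →
    ‖(∫ v in (-(√2*h))..(√2*h), wfun s (Zv a v) * Ev a v) -
      ∑ k ∈ Finset.range N, ak k * (Complex.exp (2 * π * I * a^2 - I * π / 8) * ck Ψ (2 * a) k)‖ ≤ C * s.im ^ (-(N:ℝ)/6) := by
  obtain ⟨C1, hC1, H1⟩ := central_pt A B N
  obtain ⟨C2, hC2, H2⟩ := tail_pt A B N
  obtain ⟨C3, hC3, H3⟩ := exp_pow_dec (-(N:ℝ)/6)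
  set J := ∫ v : ℝ, rexp (-(1/4) * v^2) with hJ
  have hJ0 : 0 ≤ J := integral_nonneg fun v => (Real.exp_pos _).le
  refine ⟨C1 * J + C2 * C3 * J, by positivity, fun Ψ hΨ s m α a h ak hA hB hak hm h0 h1 ha ht hh => ?_⟩
  have hαm : (m:ℝ) ≤ α := by linarith
  have hα0 : 0 < α := by linarith
  have ht1 : 1 ≤ s.im := by rw [ht]; nlinarith [Real.pi_gt_three]
  have ht0 : 0 < s.im := by linarith
  set V := √2 * h with hV
  have hh0 : 0 < h := by rw [hh]; positivity
  have hV0 : 0 < V := by positivity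
  have hrt : √s.im = √(2*π) * α := by
    rw [ht, Real.sqrt_mul (by positivity), Real.sqrt_sq hα0.le]
  have hsq2 : √2 ≤ 1.5 := by rw [Real.sqrt_le_left (by norm_num)]; norm_num
  have hVle : 1/2 + V ≤ α / 16 := by
    have : V ≤ 1.5 * h := mul_le_mul_of_nonneg_right hsq2 hh0.le
    rw [hh] at this; linarith
  have hZ : ∀ v : ℝ, |v| ≤ V → ‖Zv a v‖ ≤ √s.im / 16 := by
    intro v hv
    refine (Zv_norm a v h0 h1).trans ?_
    rw [hrt, mul_div_assoc]
    exact mul_le_mul_of_nonneg_left (by linarith) (Real.sqrt_nonneg _)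
  have hexpV : rexp (-(V^2/2)) ≤ C3 * s.im ^ (-(N:ℝ)/6) := by
    refine le_trans (Real.exp_le_exp.2 ?_) (H3 _ ht1)
    have e1 : V^2 = 2 * h^2 := by rw [hV, mul_pow, Real.sq_sqrt (by norm_num)]
    have e2 : α ≤ 2 * (m+1/2) := by linarith
    have e3 : α^2 ≤ (2 * (m+1/2))^2 := pow_le_pow_left₀ hα0.le e2 2
    have e4 : s.im ≤ 8 * α^2 := by rw [ht]; nlinarith [Real.pi_lt_four]
    rw [e1, hh]; nlinarith
  set P : ℝ → ℂ := fun v => ∑ k ∈ Finset.range N, ak k * (Zv a v ^ k * Ev a v) with hP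
  have hPi : Integrable P := integrable_finsetSum _ fun k _ => (ZE_int a h0 h1 k).const_mul _
  have hPe : ∫ v, P v = ∑ k ∈ Finset.range N, ak k * (Complex.exp (2 * π * I * a^2 - I * π / 8) * ck Ψ (2 * a) k) := by
    rw [hP, integral_finsetSum _ fun k _ => (ZE_int a h0 h1 k).const_mul _]
    refine Finset.sum_congr rfl fun k _ => ?_
    rw [integral_const_mul]
    congr 1
    exact Ik_eval Ψ hΨ a k
  set S := Set.Ioc (-V) V with hS
  have hSm : MeasurableSet S := measurableSet_Ioc
  have hSabs : ∀ v ∈ S, |v| ≤ V := fun v hv => abs_le.2 ⟨hv.1.le, hv.2⟩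
  have hwi : IntegrableOn (fun v => wfun s (Zv a v) * Ev a v) S := by
    have : ContinuousOn (fun v => wfun s (Zv a v) * Ev a v) (Set.Icc (-V) V) := by
      intro v hv
      exact ((wE_cont s a ht0 v (hZ v (abs_le.2 hv))).mul (Ev_cont a).continuousAt).continuousWithinAt
    exact (this.integrableOn_Icc).mono_set Set.Ioc_subset_Icc_self
  rw [intervalIntegral.integral_of_le (by linarith), ← hPe, ← integral_add_compl hSm hPi, ← sub_sub,
    ← integral_sub hwi hPi.integrableOn]
  have b1 : ‖∫ v in S, (wfun s (Zv a v) * Ev a v - P v)‖ ≤ C1 * s.im ^ (-(N:ℝ)/6) * J := by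
    have : ‖∫ v in S, (wfun s (Zv a v) * Ev a v - P v)‖ ≤ ∫ v in S, C1 * s.im ^ (-(N:ℝ)/6) * rexp (-(1/4) * v^2) := by
      refine norm_integral_le_of_norm_le (gauss4.const_mul _).integrableOn ?_
      refine (ae_restrict_iff' hSm).2 (Filter.Eventually.of_forall fun v hv => ?_)
      exact H1 s hA hB ht1 ak hak a v h0 h1 (hZ v (hSabs v hv))
    refine this.trans ?_
    rw [hJ, ← integral_const_mul]
    exact setIntegral_le_integral (gauss4.const_mul _) (Filter.Eventually.of_forall fun v => by positivity)
  have b2 : ‖∫ v in Sᶜ, P v‖ ≤ C2 * rexp (-(V^2/2)) * J := by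
    have : ‖∫ v in Sᶜ, P v‖ ≤ ∫ v in Sᶜ, C2 * rexp (-(V^2/2)) * rexp (-(1/4) * v^2) := by
      refine norm_integral_le_of_norm_le (gauss4.const_mul _).integrableOn ?_
      refine (ae_restrict_iff' hSm.compl).2 (Filter.Eventually.of_forall fun v hv => ?_)
      refine H2 s hA hB ht1 ak hak a v V h0 h1 hV0.le ?_
      by_contra hc
      push Not at hc
      exact hv ⟨(abs_lt.1 hc).1, (abs_lt.1 hc).2.le⟩
    refine this.trans ?_
    rw [hJ, ← integral_const_mul]
    exact setIntegral_le_integral (gauss4.const_mul _) (Filter.Eventually.of_forall fun v => by positivity)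
  have b3 : C2 * rexp (-(V^2/2)) * J ≤ C2 * (C3 * s.im ^ (-(N:ℝ)/6)) * J :=
    mul_le_mul_of_nonneg_right (mul_le_mul_of_nonneg_left hexpV hC2) hJ0
  refine (norm_sub_le _ _).trans ?_
  linarith

def Mt (s : ℂ) (m : ℕ) (S : ℂ) : ℂ := (-1:ℂ)^m *
              (((2*π : ℝ):ℂ)^s * Complex.exp ((π:ℂ)*I*s/2) /
                (Complex.Gamma s * (Complex.exp (2*(π:ℂ)*I*s) - 1))) *
              Complex.exp ((s/2 - 1/4) * (Real.log (s.im/(2*π)) : ℂ)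
                - I*(s.im:ℂ)/2 - I*(π:ℂ)/8) *
              (((2*π/s.im) ^ ((1:ℝ)/4) : ℝ) : ℂ) * S

lemma Mt_eq (s : ℂ) (α a : ℝ) (m : ℕ) (S : ℂ) (hα : 0 < α) (ha : a = α - m) (ht : s.im = 2 * π * α^2) :
    Mt s m S = preF s * (kap s α a * (Complex.exp (2 * π * I * a^2 - I * π / 8) * S)) := by
  rw [← mul_assoc (kap s α a), kap_phase s α a m ha ht]
  unfold Mt preF
  have e1 : s.im/(2*π) = α^2 := by rw [ht]; field_simp
  have e2 : (2*π/s.im) ^ ((1:ℝ)/4) = rexp (-(1/2) * Real.log α) := by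
    rw [show 2*π/s.im = (α^2)⁻¹ by rw [← e1, inv_div], Real.rpow_def_of_pos (by positivity), Real.log_inv, Real.log_pow]
    congr 1; push_cast; ring
  rw [e1, e2, Real.log_pow, Complex.ofReal_exp]
  have e3 : Complex.exp ((π:ℂ)*I*s/2) * (Complex.exp ((s/2 - 1/4) * (((2:ℕ) * Real.log α : ℝ) : ℂ)
                - I*(s.im:ℂ)/2 - I*(π:ℂ)/8) * Complex.exp ((-(1/2) * Real.log α : ℝ) : ℂ)) =
      Complex.exp ((π:ℂ)*I*s) * Complex.exp ((s-1) * (Real.log α : ℂ) - π/2 * I * s - I * s.im / 2 - I * π / 8) := by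
    simp only [← Complex.exp_add]; congr 1; push_cast; ring
  linear_combination ((-1:ℂ)^m * ((2*π : ℝ):ℂ)^s / (Complex.Gamma s * (Complex.exp (2*(π:ℂ)*I*s) - 1)) * S) * e3

lemma preF_kap (A B : ℝ) : ∃ C : ℝ, 0 ≤ C ∧ ∀ (s : ℂ) (α a : ℝ), A ≤ s.re → s.re ≤ B → 1 ≤ s.im → 0 < α →
    s.im = 2 * π * α^2 → ‖preF s‖ * ‖kap s α a‖ ≤ C * s.im ^ (-s.re/2) := by
  obtain ⟨C, hC, H⟩ := preF_bound A B
  refine ⟨C * (2*π)^((1+|A|)/2), by positivity, fun s α a hA hB ht hα htα => ?_⟩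
  have ht0 : 0 < s.im := by linarith
  rw [kap_norm s α a hα]
  have h1 := H s hA hB ht
  have hpi : (1:ℝ) ≤ 2 * π := by linarith [Real.pi_gt_three]
  have e1 : α ^ (s.re - 1) = s.im ^ ((s.re-1)/2) * (2*π) ^ ((1 - s.re)/2) := by
    rw [htα, Real.mul_rpow (by positivity) (by positivity), ← Real.rpow_natCast α 2, ← Real.rpow_mul hα.le,
      mul_right_comm, ← Real.rpow_add (by positivity)]
    rw [show (s.re-1)/2 + (1-s.re)/2 = 0 by ring, Real.rpow_zero, one_mul]; congr 1; push_cast; ring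
  have e2 : (2*π) ^ ((1 - s.re)/2) ≤ (2*π)^((1+|A|)/2) :=
    Real.rpow_le_rpow_of_exponent_le hpi (by linarith [neg_abs_le A])
  calc ‖preF s‖ * (α ^ (s.re - 1) * rexp (π * s.im / 2))
      ≤ (C * s.im^(1/2 - s.re) * rexp (-(π*s.im/2))) * (α ^ (s.re - 1) * rexp (π * s.im / 2)) :=
        mul_le_mul_of_nonneg_right h1 (by positivity)
    _ = C * (2*π) ^ ((1 - s.re)/2) * (s.im^(1/2 - s.re) * s.im ^ ((s.re-1)/2)) * (rexp (-(π*s.im/2)) * rexp (π * s.im / 2)) := by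
        rw [e1]; ring
    _ = C * (2*π) ^ ((1 - s.re)/2) * s.im ^ (-s.re/2) := by
        rw [← Real.exp_add, ← Real.rpow_add ht0, neg_add_cancel, Real.exp_zero, mul_one]; congr 2; ring
    _ ≤ _ := mul_le_mul_of_nonneg_right (mul_le_mul_of_nonneg_left e2 hC) (by positivity)

lemma large_t (A B : ℝ) (N : ℕ) : ∃ C : ℝ, 0 ≤ C ∧ ∀ Ψ, IsPsi Ψ → ∀ (s : ℂ) (m : ℕ) (α a : ℝ) (ak : ℕ → ℂ),
    A ≤ s.re → s.re ≤ B → IsAk s ak → 10^6 ≤ (m:ℝ) → 0 ≤ a → a ≤ 1 → a = α - m → s.im = 2 * π * α^2 → m = ⌊α⌋₊ →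
    ‖riemannZeta s - zetaSum α s - chi s * zetaSum α (1 - s) - Mt s m (∑ k ∈ Finset.range N, ak k * ck Ψ (2 * a) k)‖
      ≤ C * s.im ^ (-(N:ℝ)/6 - s.re/2) := by
  obtain ⟨C1, hC1, H1⟩ := preF_bound A B
  obtain ⟨C2, hC2, H2⟩ := preF_kap A B
  obtain ⟨C3, hC3, H3⟩ := central A B N
  obtain ⟨D, hD, HD⟩ := tail_all B
  obtain ⟨C4, hC4, H4⟩ := exp_pow_dec (-(N:ℝ)/6 - |A|/2 - 1/2)
  refine ⟨C1 * D * C4 + C2 * C3, by positivity, fun Ψ hΨ s m α a ak hA hB hak hm h0 h1 ha ht hmα => ?_⟩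
  have hαm : (m:ℝ) ≤ α := by linarith
  have hα0 : 0 < α := by linarith
  have ht1 : 1 ≤ s.im := by rw [ht]; nlinarith [Real.pi_gt_three]
  have ht0 : 0 < s.im := by linarith
  set h : ℝ := (m+1/2)/32 with hh
  have hh0 : 0 < h := by positivity
  set S := ∑ k ∈ Finset.range N, ak k * ck Ψ (2 * a) k with hS
  have hs2 : √2 ≤ 1.5 := by rw [Real.sqrt_le_left (by norm_num)]; norm_num
  have hV0 : 0 < √2 * h := by positivity
  rw [exact_formula s ht0 α h hh0, ← hmα, Mt_eq s α a m S hα0 ha ht, ← mul_sub, norm_mul]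
  have hint : (∫ v in (-(√2*h))..(√2*h), (-I * om) * Ff m s (zd m v)) =
      kap s α a * ∫ v in (-(√2*h))..(√2*h), wfun s (Zv a v) * Ev a v := by
    rw [← intervalIntegral.integral_const_mul]
    refine intervalIntegral.integral_congr fun v hv => ?_
    rw [Set.uIcc_of_le (by linarith)] at hv
    refine diag_id m s α a v hα0 ha ht ?_
    have hz := Zv_norm a v h0 h1
    refine le_trans hz ?_
    have hrt : √s.im = √(2*π) * α := by
      rw [ht, Real.sqrt_mul (by positivity), Real.sqrt_sq hα0.le]
    rw [hrt, mul_div_assoc]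
    refine mul_le_mul_of_nonneg_left ?_ (Real.sqrt_nonneg _)
    have hv' : |v| ≤ √2 * h := abs_le.2 hv
    have : √2 * h ≤ 1.5 * h := mul_le_mul_of_nonneg_right hs2 hh0.le
    rw [hh] at this hv' ; linarith
  have g1 := HD m s h hB hm (by rw [ht]; exact mul_le_mul_of_nonneg_left (pow_le_pow_left₀ (by positivity) hαm 2) (by positivity))
    (by rw [ht]; exact mul_le_mul_of_nonneg_left (pow_le_pow_left₀ hα0.le (by linarith) 2) (by positivity)) hh
  have g2 := H3 Ψ hΨ s m α a h ak hA hB hak hm h0 h1 ha ht hh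
  have e1 : ∑ k ∈ Finset.range N, ak k * (Complex.exp (2 * π * I * a^2 - I * π / 8) * ck Ψ (2 * a) k) =
      Complex.exp (2 * π * I * a^2 - I * π / 8) * S := by
    rw [hS, Finset.mul_sum]; exact Finset.sum_congr rfl fun k _ => by ring
  rw [e1] at g2
  rw [hint] at g1
  set W := ∫ v in (-(√2*h))..(√2*h), wfun s (Zv a v) * Ev a v with hW
  set E := Complex.exp (2 * π * I * a^2 - I * π / 8) * S with hE
  have g3 : ‖Lf m m h s - kap s α a * E‖ ≤ D * rexp (π * s.im / 2 - s.im / 10^6) + ‖kap s α a‖ * (C3 * s.im ^ (-(N:ℝ)/6)) := by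
    rw [show Lf m m h s - kap s α a * E = (Lf m m h s - kap s α a * W) + kap s α a * (W - E) by ring]
    refine (norm_add_le _ _).trans (add_le_add g1 ?_)
    rw [norm_mul]
    exact mul_le_mul_of_nonneg_left g2 (norm_nonneg _)
  have p1 := H1 s hA hB ht1
  have p2 := H2 s α a hA hB ht1 hα0 ht
  have p3 := H4 s.im ht1
  have q1 : ‖preF s‖ * (D * rexp (π * s.im / 2 - s.im / 10^6)) ≤ C1 * D * C4 * s.im ^ (-(N:ℝ)/6 - s.re/2) := by
    calc _ ≤ (C1 * s.im^(1/2 - s.re) * rexp (-(π*s.im/2))) * (D * rexp (π * s.im / 2 - s.im / 10^6)) :=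
          mul_le_mul_of_nonneg_right p1 (by positivity)
      _ = C1 * D * s.im^(1/2 - s.re) * (rexp (-(π*s.im/2)) * rexp (π * s.im / 2 - s.im / 10^6)) := by ring
      _ = C1 * D * s.im^(1/2 - s.re) * rexp (-(s.im/10^6)) := by rw [← Real.exp_add]; congr 2; ring
      _ ≤ C1 * D * s.im^(1/2 - s.re) * (C4 * s.im ^ (-(N:ℝ)/6 - |A|/2 - 1/2)) := mul_le_mul_of_nonneg_left p3 (by positivity)
      _ = C1 * D * C4 * (s.im^(1/2 - s.re) * s.im ^ (-(N:ℝ)/6 - |A|/2 - 1/2)) := by ring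
      _ ≤ _ := by
          refine mul_le_mul_of_nonneg_left ?_ (by positivity)
          rw [← Real.rpow_add ht0]
          exact Real.rpow_le_rpow_of_exponent_le ht1 (by linarith [neg_abs_le A])
  have q2 : ‖preF s‖ * (‖kap s α a‖ * (C3 * s.im ^ (-(N:ℝ)/6))) ≤ C2 * C3 * s.im ^ (-(N:ℝ)/6 - s.re/2) := by
    calc _ = (‖preF s‖ * ‖kap s α a‖) * (C3 * s.im ^ (-(N:ℝ)/6)) := by ring
      _ ≤ (C2 * s.im ^ (-s.re/2)) * (C3 * s.im ^ (-(N:ℝ)/6)) := mul_le_mul_of_nonneg_right p2 (by positivity)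
      _ = C2 * C3 * (s.im ^ (-(N:ℝ)/6) * s.im ^ (-s.re/2)) := by ring
      _ = _ := by rw [← Real.rpow_add ht0]; congr 2; ring
  calc _ ≤ ‖preF s‖ * (D * rexp (π * s.im / 2 - s.im / 10^6) + ‖kap s α a‖ * (C3 * s.im ^ (-(N:ℝ)/6))) :=
        mul_le_mul_of_nonneg_left g3 (norm_nonneg _)
    _ ≤ _ := by rw [mul_add, add_mul]; exact add_le_add q1 q2

lemma zsum_bound (A B : ℝ) (M : ℕ) : ∃ Q : ℝ, 0 ≤ Q ∧ ∀ (x : ℝ) (s : ℂ), A ≤ s.re → s.re ≤ B → ⌊x⌋₊ ≤ M → ‖zetaSum x s‖ ≤ Q := by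
  refine ⟨∑ n ∈ Finset.Icc 1 M, (n:ℝ)^|A|, Finset.sum_nonneg fun n _ => by positivity, fun x s hA hB hx => ?_⟩
  unfold zetaSum
  refine (norm_sum_le _ _).trans ?_
  refine le_trans (Finset.sum_le_sum (g := fun n : ℕ => (n:ℝ)^|A|) fun n hn => ?_)
    (Finset.sum_le_sum_of_subset_of_nonneg (Finset.Icc_subset_Icc_right hx) fun n _ _ => by positivity)
  have hn1 : 1 ≤ n := (Finset.mem_Icc.1 hn).1
  have hn1' : (1:ℝ) ≤ n := by exact_mod_cast hn1
  rw [Complex.norm_natCast_cpow_of_pos (by omega), Complex.neg_re]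
  exact Real.rpow_le_rpow_of_exponent_le hn1' (by linarith [neg_abs_le A])

lemma cpt_bound (f : ℂ → ℂ) (A B a b : ℝ) (hf : ∀ s : ℂ, a ≤ s.im → ContinuousAt f s) :
    ∃ Q : ℝ, 0 ≤ Q ∧ ∀ s : ℂ, A ≤ s.re → s.re ≤ B → a ≤ s.im → s.im ≤ b → ‖f s‖ ≤ Q := by
  have hK : IsCompact (Set.Icc A B ×ℂ Set.Icc a b) := isCompact_Icc.reProdIm isCompact_Icc
  obtain ⟨Q, hQ⟩ := hK.exists_bound_of_continuousOn (f := f) fun s hs => (hf s (hs.2.1)).continuousWithinAt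
  exact ⟨|Q|, abs_nonneg _, fun s h1 h2 h3 h4 => (hQ s ⟨⟨h1, h2⟩, ⟨h3, h4⟩⟩).trans (le_abs_self _)⟩

lemma chi_cont (s : ℂ) (hs : 1 ≤ s.im) : ContinuousAt chi s := by
  have g1 : ContinuousAt Complex.Gamma ((1 - s)/2) := by
    refine (Complex.differentiableAt_Gamma _ fun n h => ?_).continuousAt
    have := congrArg Complex.im h
    simp at this; linarith
  have hne : ∀ n : ℕ, s/2 ≠ -n := by
    intro n h
    have := congrArg Complex.im h
    simp at this; linarith
  have g2 : ContinuousAt Complex.Gamma (s/2) := (Complex.differentiableAt_Gamma _ hne).continuousAt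
  have hpi : (π:ℂ) ≠ 0 := by exact_mod_cast Real.pi_ne_zero
  have g3 : ContinuousAt (fun s : ℂ => (π:ℂ) ^ (s - 1/2)) s :=
    ContinuousAt.const_cpow (by fun_prop) (Or.inl hpi)
  have g4 : ContinuousAt (fun s : ℂ => Complex.Gamma ((1 - s)/2)) s :=
    ContinuousAt.comp (f := fun s : ℂ => (1-s)/2) g1 (by fun_prop)
  have g5 : ContinuousAt (fun s : ℂ => Complex.Gamma (s/2)) s :=
    ContinuousAt.comp (f := fun s : ℂ => s/2) g2 (by fun_prop)
  exact (g3.mul g4).div g5 (Complex.Gamma_ne_zero hne)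

lemma small_t (A B T : ℝ) (N M : ℕ) : ∃ C : ℝ, 0 ≤ C ∧ ∀ Ψ, IsPsi Ψ → ∀ (s : ℂ) (m : ℕ) (α a : ℝ) (ak : ℕ → ℂ),
    A ≤ s.re → s.re ≤ B → IsAk s ak → m ≤ M → 0 ≤ a → a ≤ 1 → a = α - m → s.im = 2 * π * α^2 → m = ⌊α⌋₊ → 0 < α → 1 ≤ s.im → s.im ≤ T →
    ‖riemannZeta s - zetaSum α s - chi s * zetaSum α (1 - s) - Mt s m (∑ k ∈ Finset.range N, ak k * ck Ψ (2 * a) k)‖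
      ≤ C * s.im ^ (-(N:ℝ)/6 - s.re/2) := by
  obtain ⟨Q1, hQ1, H1⟩ := cpt_bound riemannZeta A B 1 T fun s hs =>
    (differentiableAt_riemannZeta (by rintro rfl; simp at hs; linarith)).continuousAt
  obtain ⟨Q2, hQ2, H2⟩ := cpt_bound chi A B 1 T chi_cont
  obtain ⟨Q3, hQ3, H3⟩ := zsum_bound A B M
  obtain ⟨Q4, hQ4, H4⟩ := zsum_bound (1-B) (1-A) M
  obtain ⟨C2, hC2, H5⟩ := preF_kap A B
  choose Ca hCa Ha using ak_bound A B
  choose K hK HK using ck_bound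
  set SS := ∑ k ∈ Finset.range N, Ca k * K k with hSS
  have hSS0 : 0 ≤ SS := Finset.sum_nonneg fun k _ => mul_nonneg (hCa k) (hK k)
  set E := (N:ℝ)/6 + |A| + |B| with hE
  have hE0 : 0 ≤ E := by positivity
  refine ⟨(Q1 + Q3 + Q2 * Q4 + C2 * SS * |T|^E) * |T|^E, by positivity, fun Ψ hΨ s m α a ak hA hB hak hm h0 h1 ha ht hmα hα0 ht1 htT => ?_⟩
  have ht0 : 0 < s.im := by linarith
  have hT1 : 1 ≤ T := by linarith
  have hTa : |T| = T := abs_of_nonneg (by linarith)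
  rw [hTa]
  have hN0 : (0:ℝ) ≤ N := by positivity
  have hup : s.im ^ (-s.re/2) ≤ T ^ E := by
    refine (Real.rpow_le_rpow_of_exponent_le ht1 (?_ : _ ≤ E)).trans (Real.rpow_le_rpow ht0.le htT hE0)
    linarith [neg_abs_le A, abs_nonneg A, abs_nonneg B]
  have hlow : 1 ≤ T^E * s.im ^ (-(N:ℝ)/6 - s.re/2) := by
    have k1 : s.im ^ (-E) ≤ s.im ^ (-(N:ℝ)/6 - s.re/2) :=
      Real.rpow_le_rpow_of_exponent_le ht1 (by linarith [le_abs_self B, abs_nonneg A, abs_nonneg B])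
    have k2 : s.im ^ E ≤ T^E := Real.rpow_le_rpow ht0.le htT hE0
    calc (1:ℝ) = s.im ^ E * s.im ^ (-E) := by rw [← Real.rpow_add ht0]; simp
      _ ≤ _ := mul_le_mul k2 k1 (by positivity) (by positivity)
  have hfl : ⌊α⌋₊ ≤ M := by rw [← hmα]; exact hm
  have b1 := H1 s hA hB ht1 htT
  have b2 := H2 s hA hB ht1 htT
  have b3 := H3 α s hA hB hfl
  have b4 := H4 α (1-s) (by simp; linarith) (by simp; linarith) hfl
  have b5 := H5 s α a hA hB ht1 hα0 ht
  have bS : ‖∑ k ∈ Finset.range N, ak k * ck Ψ (2 * a) k‖ ≤ SS := by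
    refine (norm_sum_le _ _).trans (Finset.sum_le_sum fun k _ => ?_)
    rw [norm_mul]
    have g1 : ‖ak k‖ ≤ Ca k := by
      refine (Ha k s hA hB ht1 ak hak).trans ?_
      have : s.im ^ (-(k:ℝ)/6) ≤ 1 := Real.rpow_le_one_of_one_le_of_nonpos ht1 (by
        have : (0:ℝ) ≤ k := by positivity
        linarith)
      nlinarith [hCa k]
    exact mul_le_mul g1 (HK k Ψ hΨ a h0 h1) (norm_nonneg _) (hCa k)
  have bM : ‖Mt s m (∑ k ∈ Finset.range N, ak k * ck Ψ (2 * a) k)‖ ≤ C2 * SS * T^E := by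
    rw [Mt_eq s α a m _ hα0 ha ht, norm_mul, norm_mul, norm_mul,
      show (2 * π * I * (a:ℂ)^2 - I * π / 8) = ((2 * π * a^2 - π/8 : ℝ):ℂ) * I by push_cast; ring, Complex.norm_exp_ofReal_mul_I, one_mul, ← mul_assoc]
    calc _ ≤ (C2 * s.im ^ (-s.re/2)) * SS := mul_le_mul b5 bS (norm_nonneg _) (by positivity)
      _ ≤ (C2 * T^E) * SS := mul_le_mul_of_nonneg_right (mul_le_mul_of_nonneg_left hup hC2) hSS0
      _ = _ := by ring
  have hc : ‖chi s * zetaSum α (1 - s)‖ ≤ Q2 * Q4 := by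
    rw [norm_mul]; exact mul_le_mul b2 b4 (norm_nonneg _) hQ2
  have tot : ‖riemannZeta s - zetaSum α s - chi s * zetaSum α (1 - s) - Mt s m (∑ k ∈ Finset.range N, ak k * ck Ψ (2 * a) k)‖ ≤
      Q1 + Q3 + Q2 * Q4 + C2 * SS * T^E :=
    (norm_sub_le _ _).trans (add_le_add ((norm_sub_le _ _).trans (add_le_add ((norm_sub_le _ _).trans (add_le_add b1 b3)) hc)) bM)
  refine tot.trans ?_
  rw [mul_assoc (Q1 + Q3 + Q2 * Q4 + C2 * SS * T^E)]
  exact le_mul_of_one_le_right (by positivity) hlow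

theorem statement2 (A B : ℝ) (N : ℕ) :
    ∃ C : ℝ, ∀ Ψ : ℂ → ℂ, IsPsi Ψ →
      ∀ s : ℂ, s.re ∈ Set.Icc A B → 2 * π ≤ s.im →
      ∀ a : ℕ → ℂ, IsAk s a →
        ‖riemannZeta s - zetaSum (Real.sqrt (s.im / (2*π))) s
            - chi s * zetaSum (Real.sqrt (s.im / (2*π))) (1 - s)
            - (-1:ℂ)^(⌊Real.sqrt (s.im / (2*π))⌋₊) *
              (((2*π : ℝ):ℂ)^s * Complex.exp ((π:ℂ)*I*s/2) /
                (Complex.Gamma s * (Complex.exp (2*(π:ℂ)*I*s) - 1))) *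
              Complex.exp ((s/2 - 1/4) * (Real.log (s.im/(2*π)) : ℂ)
                - I*(s.im:ℂ)/2 - I*(π:ℂ)/8) *
              (((2*π/s.im) ^ ((1:ℝ)/4) : ℝ) : ℂ) *
              ∑ k ∈ Finset.range N, a k *
                ∑ r ∈ Finset.range (k/2 + 1),
                  (I ^ ((r:ℤ) - (k:ℤ)) * (Nat.factorial k : ℂ) /
                      ((Nat.factorial r : ℂ) * (Nat.factorial (k - 2*r) : ℂ))) *
                    (iteratedDeriv (k - 2*r) Ψ (2 * ((Int.fract (Real.sqrt (s.im/(2*π))) : ℝ) : ℂ)) /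
                      ((4:ℂ)^r * ((((2*π) ^ ((k:ℝ)/2 - (r:ℝ)) : ℝ)) : ℂ)))‖
          ≤ C * s.im ^ (-(N:ℝ)/6 - s.re/2) := by
  obtain ⟨C1, hC1, H1⟩ := large_t A B N
  obtain ⟨C2, hC2, H2⟩ := small_t A B (2 * π * (10^6)^2) N (10^6)
  refine ⟨C1 + C2, fun Ψ hΨ s hs ht ak hak => ?_⟩
  have ht1 : 1 ≤ s.im := by linarith [Real.pi_gt_three]
  have ht0 : 0 < s.im := by linarith
  have hα0 : 0 < √(s.im / (2*π)) := Real.sqrt_pos.2 (by positivity)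
  have hα2 : s.im = 2 * π * √(s.im / (2*π))^2 := by
    rw [Real.sq_sqrt (by positivity)]; field_simp
  have hfr : Int.fract √(s.im / (2*π)) = √(s.im / (2*π)) - (⌊√(s.im / (2*π))⌋₊ : ℝ) := by
    rw [Int.fract, natCast_floor_eq_intCast_floor hα0.le]
  have hp : 0 ≤ s.im ^ (-(N:ℝ)/6 - s.re/2) := by positivity
  rcases le_total s.im (2 * π * (10^6)^2) with hc | hc
  · have hm : ⌊√(s.im / (2*π))⌋₊ ≤ 10^6 := by
      have : √(s.im / (2*π)) ≤ 10^6 := by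
        rw [Real.sqrt_le_left (by norm_num), div_le_iff₀ (by positivity)]; linarith
      have := Nat.floor_mono this
      refine this.trans ?_
      rw [show (10^6:ℝ) = ((10^6:ℕ):ℝ) by norm_num, Nat.floor_natCast]
    refine le_trans (H2 Ψ hΨ s _ _ _ ak hs.1 hs.2 hak hm (Int.fract_nonneg _) (Int.fract_lt_one _).le hfr hα2 rfl hα0 ht1 hc) ?_
    exact mul_le_mul_of_nonneg_right (by linarith) hp
  · have hm : (10^6:ℝ) ≤ (⌊√(s.im / (2*π))⌋₊:ℝ) := by
      have : (10^6:ℝ) ≤ √(s.im / (2*π)) := by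
        apply Real.le_sqrt_of_sq_le
        rw [le_div_iff₀ (by positivity)]; linarith
      have := (Nat.le_floor_iff (n := 10^6) hα0.le).2 (by push_cast; linarith)
      exact_mod_cast this
    refine le_trans (H1 Ψ hΨ s _ _ _ ak hs.1 hs.2 hak hm (Int.fract_nonneg _) (Int.fract_lt_one _).le hfr hα2 rfl) ?_
    exact mul_le_mul_of_nonneg_right (by linarith) hp

end
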